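/- Let f_1, f_2 ∈ B_6 and let f = f_1||f_2 ∈ B_7 be their concatenation. If nl_2(f) > 40, then 15 ≤ nl_2(f_1) ≤ 16 and 15 ≤ nl_2(f_2) ≤ 16. -/

import Mathlib

open scoped BigOperators

/-- Boolean functions in `n` variables. -/
abbrev BF (n : ℕ) := (Fin n → ZMod 2) → ZMod 2

/-- Hamming distance between two Boolean functions. -/
def hd {n : ℕ} (f g : BF n) : ℕ :=
  (Finset.univ.filter (fun x : Fin n → ZMod 2 => f x ≠ g x)).card

/-- The Reed--Muller code `RM(r,n)`: Boolean functions given by evaluation of a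
multivariate polynomial over `F_2` of total degree at most `r`. -/
def RM (r n : ℕ) : Set (BF n) :=
  {f | ∃ p : MvPolynomial (Fin n) (ZMod 2),
    p.totalDegree ≤ r ∧ ∀ x, f x = MvPolynomial.eval x p}

/-- The `r`-th order nonlinearity of a Boolean function. -/
noncomputable def nl (r : ℕ) {n : ℕ} (f : BF n) : ℕ :=
  sInf {d | ∃ g ∈ RM r n, d = hd f g}

/-- Concatenation `f1 || f2` of two Boolean functions. -/
def concat {n : ℕ} (f1 f2 : BF n) : BF (n + 1) :=
  fun x => (1 + x (Fin.last n)) * f1 (x ∘ Fin.castSucc)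
    + x (Fin.last n) * f2 (x ∘ Fin.castSucc)

/-- A Boolean function is homogeneous quadratic if it is of the form
`∑_{i<j} a_{ij} x_i x_j`. -/
def HomQuad {n : ℕ} (g : BF n) : Prop :=
  ∃ a : Fin n → Fin n → ZMod 2,
    ∀ x, g x = ∑ i : Fin n, ∑ j : Fin n, (if i < j then a i j * x i * x j else 0)

/-- `Fh f r` is the set of homogeneous quadratic functions `g` with `nl(f+g) = r`. -/
def Fh {n : ℕ} (f : BF n) (r : ℕ) : Set (BF n) :=
  {g | HomQuad g ∧ nl 1 (f + g) = r}

/-- `NFh f r = |Fh f r|`. -/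
noncomputable def NFh {n : ℕ} (f : BF n) (r : ℕ) : ℕ := (Fh f r).ncard

/-- The set of 6-variable Boolean functions with nonlinearity 16. -/
def S16 : Set (BF 6) := {f | nl 1 f = 16}

/-- `f1` and `f2` are affine equivalent modulo `RM(r,n)`. -/
def AffEquivMod (r n : ℕ) (f1 f2 : BF n) : Prop :=
  ∃ A : Matrix (Fin n) (Fin n) (ZMod 2), IsUnit A ∧ ∃ b : Fin n → ZMod 2,
    (fun x => f1 x + f2 (A.mulVec x + b)) ∈ RM r n

def fun1 : BF 6 := fun x => x 0*x 1*x 5 + x 0*x 2*x 4 + x 1*x 2*x 3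

def fun2 : BF 6 := fun x => x 0*x 1*x 2*x 3 + x 0*x 1*x 5 + x 0*x 3*x 4 + x 1*x 2*x 4

def fun3 : BF 6 := fun x => x 0*x 1*x 2*x 3 + x 0*x 2*x 4 + x 0*x 3*x 5 + x 1*x 2*x 4
  + x 1*x 2*x 5 + x 1*x 3*x 4

def fun4 : BF 6 := fun x => x 0*x 1*x 2*x 5 + x 0*x 1*x 3*x 4 + x 0*x 2*x 4
  + x 0*x 3*x 4 + x 0*x 3*x 5 + x 1*x 2*x 3

def fun5 : BF 6 := fun x => x 0*x 1*x 2*x 3*x 4 + x 0*x 2*x 4 + x 0*x 3*x 5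
  + x 1*x 2*x 4 + x 1*x 2*x 5 + x 1*x 3*x 4

def fun6 : BF 6 := fun x => x 0*x 1*x 2*x 3*x 4*x 5 + x 0*x 1*x 5 + x 0*x 2*x 4
  + x 1*x 2*x 3

def fun7 : BF 6 := fun x => x 0*x 1*x 2*x 3*x 4*x 5 + x 0*x 1*x 2*x 3 + x 0*x 1*x 5
  + x 0*x 3*x 4 + x 1*x 2*x 4 + x 3*x 4

def fun8 : BF 6 := fun x => x 0*x 1*x 2*x 3*x 4*x 5 + x 0*x 1*x 2*x 3 + x 0*x 2*x 4
  + x 0*x 3*x 5 + x 1*x 2*x 4 + x 1*x 2*x 5 + x 1*x 3*x 4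

def fun9 : BF 6 := fun x => x 0*x 1*x 2*x 3*x 4*x 5 + x 0*x 1*x 2*x 5 + x 0*x 1*x 3*x 4
  + x 0*x 2*x 4 + x 0*x 3*x 4 + x 0*x 3*x 5 + x 1*x 2*x 3 + x 3*x 5

def fun10 : BF 6 := fun x => x 0*x 1*x 2*x 3*x 4*x 5 + x 0*x 1*x 2*x 3 + x 0*x 2*x 3
  + x 0*x 4*x 5 + x 1*x 2*x 3 + x 1*x 2*x 5 + x 1*x 3*x 4 + x 2*x 3 + x 2*x 5 + x 3*x 4

def fun11 : BF 6 := fun x => x 0*x 1*x 2*x 3*x 4*x 5 + x 0*x 1*x 2*x 5 + x 0*x 1*x 3*x 4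
  + x 0*x 2*x 4 + x 0*x 3*x 4 + x 0*x 3*x 5 + x 1*x 2*x 3 + x 1*x 2*x 5 + x 1*x 3*x 4
  + x 2*x 4 + x 3*x 4 + x 3*x 5

def fun12 : BF 6 := fun x => x 0*x 1*x 2*x 3*x 4*x 5 + x 1*x 2*x 3*x 4 + x 0*x 1*x 4*x 5
  + x 0*x 2*x 3*x 5 + x 0*x 1*x 3 + x 0*x 1*x 4 + x 1*x 2*x 4 + x 2*x 3*x 4
  + x 0*x 1*x 5 + x 2*x 3*x 5

def g0 : BF 6 := fun x => x 0*x 1*x 2 + x 0*x 3*x 4 + x 1*x 3*x 5 + x 2*x 4*x 5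
  + x 3*x 4*x 5


namespace QuadraticDistance
open Finset

/-- The space `F_2^n`. -/
abbrev V (n : ℕ) := Fin n → ZMod 2

/-- `Deg k f` says that all derivatives of order `k + 1` of `f` vanish. -/
def Deg {A : Type*} [AddCommGroup A] : ℕ → (A → ZMod 2) → Prop
  | 0, f => ∀ a x, f (x + a) = f x
  | k + 1, f => ∀ a, Deg k (fun x => f (x + a) + f x)

/-- Affine maps between elementary abelian 2-groups. -/
def Aff {A B : Type*} [AddCommGroup A] [AddCommGroup B] (ψ : A → B) : Prop :=
  ∀ x y z, ψ (x + y + z) = ψ x + ψ y + ψ z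

theorem z2_add_self (a : ZMod 2) : a + a = 0 := by revert a; decide

theorem z2_cases (a : ZMod 2) : a = 0 ∨ a = 1 := by revert a; decide

theorem v_add_self {n : ℕ} (a : V n) : a + a = 0 := by
  funext i; exact z2_add_self (a i)

theorem v_add_add {n : ℕ} (a b : V n) : a + b + b = a := by
  rw [add_assoc, v_add_self, add_zero]

theorem v_add_eq_iff {n : ℕ} (a b c : V n) : a + b = c ↔ a = c + b := by
  constructor
  · rintro rfl; rw [v_add_add]
  · rintro rfl; rw [v_add_add]

section deg
variable {A B : Type*} [AddCommGroup A] [AddCommGroup B]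

theorem Deg.const (k : ℕ) (c : ZMod 2) : Deg k (fun _ : A => c) := by
  induction k generalizing c with
  | zero => intro a x; rfl
  | succ k ih => intro a; exact ih (c + c)

theorem Deg.eq_const {f : A → ZMod 2} (h : Deg 0 f) (x : A) : f x = f 0 := by
  have := h x 0
  rwa [zero_add] at this

theorem Deg.add {k : ℕ} {f g : A → ZMod 2} (hf : Deg k f) (hg : Deg k g) :
    Deg k (fun x => f x + g x) := by
  induction k generalizing f g with
  | zero => intro a x; simp only [hf a x, hg a x]
  | succ k ih =>
    intro a
    have := ih (hf a) (hg a)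
    convert this using 2
    ring

theorem Deg.succ {k : ℕ} {f : A → ZMod 2} (hf : Deg k f) : Deg (k + 1) f := by
  induction k generalizing f with
  | zero =>
    intro a b x
    simp only [hf a, hf b]
  | succ k ih => intro a; exact ih (hf a)

theorem Deg.mono {k m : ℕ} {f : A → ZMod 2} (hf : Deg k f) (h : k ≤ m) : Deg m f := by
  induction h with
  | refl => exact hf
  | step _ ih => exact ih.succ

theorem Deg.comp {k : ℕ} {f : B → ZMod 2} (hf : Deg k f) {ψ : A → B} (hψ : Aff ψ) :
    Deg k (fun x => f (ψ x)) := by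
  have key : ∀ a x, ψ (x + a) = ψ x + (ψ a + ψ 0) := by
    intro a x
    have := hψ x a 0
    rw [add_zero] at this
    rw [this, add_assoc]
  induction k generalizing f with
  | zero => intro a x; simp only [key, hf _ _]
  | succ k ih =>
    intro a
    have := ih (hf (ψ a + ψ 0))
    simpa only [key] using this

theorem aff_add_right (hA : ∀ a : A, a + a = 0) (w : A) : Aff (fun x : A => x + w) := by
  intro x y z
  have : x + w + (y + w) + (z + w) = x + y + z + w + (w + w) := by abel
  rw [this, hA, add_zero]

theorem Deg.mul {r s : ℕ} {f g : A → ZMod 2} (hA : ∀ a : A, a + a = 0)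
    (hf : Deg r f) (hg : Deg s g) :
    Deg (r + s) (fun x => f x * g x) := by
  induction r generalizing s f g with
  | zero =>
    have e : (fun x => f x * g x) = fun x => f 0 * g x := by
      funext x; rw [hf.eq_const x]
    rw [e, zero_add]
    rcases z2_cases (f 0) with h | h
    · simp only [h, zero_mul]; exact Deg.const _ _
    · simpa only [h, one_mul] using hg
  | succ r ihr =>
    induction s generalizing f g with
    | zero =>
      have e : (fun x => f x * g x) = fun x => g 0 * f x := by
        funext x; rw [hg.eq_const x, mul_comm]
      rw [e, add_zero]
      rcases z2_cases (g 0) with h | h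
      · simp only [h, zero_mul]; exact Deg.const _ _
      · simpa only [h, one_mul] using hf
    | succ s ihs =>
      intro a
      have h1 := ihr (hf a) (hg.comp (aff_add_right hA a))
      have h2 := ihs hf (hg a)
      have h3 : Deg (r + 1 + s) (fun x => (f (x + a) + f x) * g (x + a) +
          f x * (g (x + a) + g x)) :=
        Deg.add (by convert h1 using 1; omega) h2
      change Deg (r + 1 + s) (fun x => f (x + a) * g (x + a) + f x * g x)
      convert h3 using 2 with x
      have := z2_add_self (f x * g (x + a))
      linear_combination -this

theorem Aff.comp {C : Type*} [AddCommGroup C] {φ : B → C} {ψ : A → B} (hφ : Aff φ) (hψ : Aff ψ) :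
    Aff (fun x => φ (ψ x)) := by
  intro x y z
  simp only [hψ x y z, hφ _ _ _]

theorem Aff.deg_one {f : A → ZMod 2} (hf : Aff f) : Deg 1 f := by
  intro a b x
  have h1 := hf x b a
  have h2 := hf x a 0
  have h3 := hf x b 0
  simp only [add_zero] at h2 h3
  simp only [h1, h2, h3]
  have := z2_add_self (f 0)
  have := z2_add_self (f b)
  ring_nf
  grind

end deg

theorem aff_coord {n : ℕ} (i : Fin n) : Aff (fun x : V n => x i) := fun _ _ _ => rfl

theorem deg_coord {n : ℕ} (i : Fin n) : Deg 1 (fun x : V n => x i) := (aff_coord i).deg_one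

theorem aff_cons {n : ℕ} (b : ZMod 2) : Aff (fun x : V n => (Matrix.vecCons b x : V (n + 1))) := by
  intro x y z
  funext i
  refine Fin.cases ?_ (fun j => ?_) i
  · simp [z2_add_self]
  · simp

theorem aff_tail {n : ℕ} : Aff (fun x : V (n + 1) => (Matrix.vecTail x : V n)) := fun _ _ _ => rfl

theorem aff_pi {A : Type*} [AddCommGroup A] {n : ℕ} {ψ : A → V n}
    (h : ∀ i, Aff (fun x => ψ x i)) : Aff ψ := fun x y z => funext fun i => h i x y z

theorem Deg.pmul {n r s : ℕ} {f g : V n → ZMod 2} (hf : Deg r f) (hg : Deg s g) :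
    Deg (r + s) (fun x => f x * g x) := Deg.mul v_add_self hf hg

/-- Restrictions to the two halves of `F_2^(n+1)`. -/
def half {n : ℕ} (b : ZMod 2) (f : V (n + 1) → ZMod 2) : V n → ZMod 2 :=
  fun x => f (Matrix.vecCons b x)

theorem cons_head_tail {n : ℕ} (x : V (n + 1)) :
    (Matrix.vecCons (x 0) (Matrix.vecTail x) : V (n + 1)) = x := by
  funext i
  refine Fin.cases ?_ (fun j => ?_) i <;> simp [Matrix.vecTail]

/-- The function with prescribed halves. -/
def glue {n : ℕ} (f g : V n → ZMod 2) : V (n + 1) → ZMod 2 :=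
  fun x => f (Matrix.vecTail x) + x 0 * (f (Matrix.vecTail x) + g (Matrix.vecTail x))

theorem half_glue_zero {n : ℕ} (f g : V n → ZMod 2) : half 0 (glue f g) = f := by
  funext x; simp [half, glue, Matrix.vecTail, Function.comp_def]

theorem half_glue_one {n : ℕ} (f g : V n → ZMod 2) : half 1 (glue f g) = g := by
  funext x
  simp [half, glue, Matrix.vecTail, Function.comp_def, ← add_assoc, z2_add_self]

theorem glue_half {n : ℕ} (f : V (n + 1) → ZMod 2) : glue (half 0 f) (half 1 f) = f := by
  funext x
  conv_rhs => rw [← cons_head_tail x]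
  rcases z2_cases (x 0) with h | h <;>
    simp [glue, half, h, ← add_assoc, z2_add_self]

theorem Deg.glue {n k : ℕ} {f g : V n → ZMod 2} (hf : Deg (k + 1) f)
    (h : Deg k (fun x => f x + g x)) : Deg (k + 1) (glue f g) := by
  have h1 := (deg_coord (0 : Fin (n + 1))).pmul (h.comp aff_tail)
  rw [add_comm 1 k] at h1
  exact (hf.comp aff_tail).add h1

theorem Deg.half {n k : ℕ} {f : V (n + 1) → ZMod 2} (hf : Deg k f) (b : ZMod 2) :
    Deg k (half b f) := hf.comp (aff_cons b)

theorem Deg.half_add {n k : ℕ} {f : V (n + 1) → ZMod 2} (hf : Deg (k + 1) f) :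
    Deg k (fun x => QuadraticDistance.half 0 f x + QuadraticDistance.half 1 f x) := by
  have := (hf (Pi.single 0 1)).comp (aff_cons 0)
  convert this using 2 with x
  rw [add_comm]
  congr 1
  unfold QuadraticDistance.half
  congr 1
  funext i
  refine Fin.cases ?_ (fun j => ?_) i <;> simp

theorem sum_cons {n : ℕ} {M : Type*} [AddCommMonoid M] (g : V (n + 1) → M) :
    ∑ x, g x = ∑ x : V n, g (Matrix.vecCons 0 x) + ∑ x : V n, g (Matrix.vecCons 1 x) := by
  rw [← (Fin.consEquiv (fun _ : Fin (n + 1) => ZMod 2)).sum_comp g, Fintype.sum_prod_type]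
  have : (Finset.univ : Finset (ZMod 2)) = {0, 1} := by decide
  rw [this, Finset.sum_pair (by decide)]
  rfl

/-- Hamming weight. -/
def wt {A : Type*} [Fintype A] (f : A → ZMod 2) : ℕ := ∑ x, (f x).val

theorem wt_half {n : ℕ} (f : V (n + 1) → ZMod 2) : wt f = wt (half 0 f) + wt (half 1 f) :=
  sum_cons _

theorem wt_comp {A B : Type*} [Fintype A] [Fintype B] (f : B → ZMod 2) {ψ : A → B}
    (hψ : Function.Bijective ψ) : wt (fun x => f (ψ x)) = wt f :=
  hψ.sum_comp (fun x => (f x).val)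

theorem wt_cast {A : Type*} [Fintype A] (f : A → ZMod 2) : ((wt f : ℕ) : ZMod 2) = ∑ x, f x := by
  simp [wt]

theorem wt_even_iff {A : Type*} [Fintype A] (f : A → ZMod 2) : Even (wt f) ↔ ∑ x, f x = 0 := by
  rw [← wt_cast, ZMod.natCast_eq_zero_iff, even_iff_two_dvd]

theorem Deg.sum_eq_zero {n k : ℕ} {f : V n → ZMod 2} (hf : Deg k f) (h : k < n) :
    ∑ x, f x = 0 := by
  induction k generalizing n f with
  | zero =>
    obtain ⟨m, rfl⟩ : ∃ m, n = m + 1 := ⟨n - 1, by omega⟩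
    rw [sum_cons, ← Finset.sum_add_distrib]
    refine Finset.sum_eq_zero fun x _ => ?_
    rw [hf.eq_const, hf.eq_const (Matrix.vecCons 1 x), z2_add_self]
  | succ k ih =>
    obtain ⟨m, rfl⟩ : ∃ m, n = m + 1 := ⟨n - 1, by omega⟩
    rw [sum_cons, ← Finset.sum_add_distrib]
    exact ih hf.half_add (by omega)

theorem Deg.wt_even {n k : ℕ} {f : V n → ZMod 2} (hf : Deg k f) (h : k < n) : Even (wt f) :=
  (wt_even_iff f).2 (hf.sum_eq_zero h)

/-- A function all of whose `(k+1)`-dimensional affine sums vanish has degree at most `k`. -/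
theorem deg_of_flats {n k : ℕ} {f : V n → ZMod 2}
    (h : ∀ ψ : V (k + 1) → V n, Aff ψ → ∑ x, f (ψ x) = 0) : Deg k f := by
  induction k generalizing f with
  | zero =>
    intro a x
    have := h (fun b => x + b 0 • a) ?_
    · rw [sum_cons] at this
      simp at this
      have h2 := z2_add_self (f x)
      grind
    · intro b c d
      funext i
      simp
      have := z2_add_self (x i)
      linear_combination -this
  | succ k ih =>
    intro a
    refine ih fun ψ hψ => ?_
    have := h (fun b => ψ (Matrix.vecTail b) + b 0 • a) ?_
    · rw [sum_cons, ← Finset.sum_add_distrib] at this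
      simpa [Matrix.vecTail, Function.comp_def, add_comm] using this
    · intro b c d
      have := hψ (Matrix.vecTail b) (Matrix.vecTail c) (Matrix.vecTail d)
      have e : (Matrix.vecTail (b + c + d) : V (k + 1)) =
        Matrix.vecTail b + Matrix.vecTail c + Matrix.vecTail d := rfl
      simp only [e, this, Pi.add_apply, add_smul]
      abel

/-- It is enough to consider injective parametrisations. -/
theorem deg_of_inj_flats {n k : ℕ} {f : V n → ZMod 2}
    (h : ∀ ψ : V (k + 1) → V n, Aff ψ → Function.Injective ψ → ∑ x, f (ψ x) = 0) :
    Deg k f := by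
  refine deg_of_flats fun ψ hψ => ?_
  by_cases hi : Function.Injective ψ
  · exact h ψ hψ hi
  · obtain ⟨a, b, hab, hne⟩ : ∃ a b, ψ a = ψ b ∧ a ≠ b := by
      simpa [Function.Injective] using hi
    refine Finset.sum_involution (fun x _ => x + (a + b)) ?_ ?_ ?_ ?_
    · intro x _
      have := hψ x a b
      rw [← add_assoc, this, hab, v_add_add, z2_add_self]
    · intro x _ _ he
      apply hne
      have : a + b = 0 := by simpa using he
      rw [v_add_eq_iff, zero_add] at this
      exact this
    · intro x _; simp
    · intro x _; exact v_add_add _ _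

/-- Extend an injective affine map by one dimension, through a prescribed new point. -/
theorem Aff.extendTo {n m : ℕ} {ψ : V n → V m} (hψ : Aff ψ) (hi : Function.Injective ψ)
    {v : V m} (hv : ∀ x, ψ x ≠ v) : ∃ ψ' : V (n + 1) → V m, Aff ψ' ∧ Function.Injective ψ' ∧
      (∀ x, ψ' (Matrix.vecCons 0 x) = ψ x) ∧ ψ' (Matrix.vecCons 1 0) = v := by
  refine ⟨fun b => ψ (Matrix.vecTail b) + b 0 • (v + ψ 0), ?_, ?_, ?_, ?_⟩
  · intro b c d
    have := hψ (Matrix.vecTail b) (Matrix.vecTail c) (Matrix.vecTail d)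
    have e : (Matrix.vecTail (b + c + d) : V n) =
      Matrix.vecTail b + Matrix.vecTail c + Matrix.vecTail d := rfl
    simp only [e, this, Pi.add_apply, add_smul]
    abel
  · have key : ∀ p q, ψ p ≠ ψ q + (v + ψ 0) := by
      intro p q h
      apply hv (p + q + 0)
      rw [hψ p q 0, h]
      have h1 := v_add_self (ψ q)
      have h2 := v_add_self (ψ 0)
      have : ψ q + (v + ψ 0) + ψ q + ψ 0 = v + (ψ q + ψ q) + (ψ 0 + ψ 0) := by abel
      rw [this, h1, h2, add_zero, add_zero]
    intro b c hbc
    rw [← cons_head_tail b, ← cons_head_tail c]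
    simp only at hbc
    rcases z2_cases (b 0) with h | h <;> rcases z2_cases (c 0) with h' | h' <;>
      rw [h, h'] at hbc ⊢ <;> simp only [zero_smul, one_smul, add_zero] at hbc
    · rw [hi hbc]
    · exact absurd hbc (key _ _)
    · exact absurd hbc.symm (key _ _)
    · rw [hi (add_right_cancel hbc)]
  · intro x
    simp [Matrix.vecTail, Function.comp_def]
  · have e : (Matrix.vecTail (Matrix.vecCons 1 0 : V (n + 1))) = (0 : V n) := rfl
    simp only [e, Matrix.cons_val_zero, one_smul]
    rw [add_left_comm, v_add_self, add_zero]

theorem Aff.extend {n m : ℕ} {ψ : V n → V m} (hψ : Aff ψ) (hi : Function.Injective ψ)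
    (hnm : n < m) : ∃ ψ' : V (n + 1) → V m, Aff ψ' ∧ Function.Injective ψ' ∧
      ∀ x, ψ' (Matrix.vecCons 0 x) = ψ x := by
  have : ∃ v, ∀ x, ψ x ≠ v := by
    by_contra! hc
    have := Fintype.card_le_of_surjective ψ hc
    simp only [Fintype.card_pi, ZMod.card, Finset.prod_const, Finset.card_univ,
      Fintype.card_fin] at this
    exact absurd this (not_le.2 (Nat.pow_lt_pow_right (by norm_num) hnm))
  obtain ⟨v, hv⟩ := this
  obtain ⟨ψ', h1, h2, h3, -⟩ := hψ.extendTo hi hv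
  exact ⟨ψ', h1, h2, h3⟩

theorem bij_of_inj {n : ℕ} {ψ : V n → V n} (hi : Function.Injective ψ) : Function.Bijective ψ :=
  Finite.injective_iff_bijective.1 hi

theorem Aff.inverse {n : ℕ} {ψ : V n → V n} (hψ : Aff ψ) (hb : Function.Bijective ψ) :
    ∃ φ : V n → V n, Aff φ ∧ Function.Bijective φ ∧ (∀ x, φ (ψ x) = x) ∧ ∀ x, ψ (φ x) = x := by
  obtain ⟨φ, h1, h2⟩ := Function.bijective_iff_has_inverse.1 hb
  refine ⟨φ, ?_, ⟨h2.injective, h1.surjective⟩, h1, h2⟩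
  intro x y z
  apply hb.1
  rw [h2, hψ, h2, h2, h2]

theorem wt_add {A : Type*} [Fintype A] (f g : A → ZMod 2) :
    wt (fun x => f x + g x) + 2 * wt (fun x => f x * g x) = wt f + wt g := by
  unfold wt
  rw [Finset.mul_sum, ← Finset.sum_add_distrib, ← Finset.sum_add_distrib]
  have : ∀ a b : ZMod 2, (a + b).val + 2 * (a * b).val = a.val + b.val := by decide
  exact Finset.sum_congr rfl fun x _ => this _ _

/-- The sign `(-1)^b`. -/
def sg (b : ZMod 2) : ℤ := if b = 0 then 1 else -1

theorem sg_add (a b : ZMod 2) : sg (a + b) = sg a * sg b := by revert a b; decide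
@[simp] theorem sg_zero : sg 0 = 1 := rfl
@[simp] theorem sg_one : sg 1 = -1 := rfl
theorem sg_mul_self (a : ZMod 2) : sg a * sg a = 1 := by revert a; decide
theorem sg_cases (a : ZMod 2) : sg a = 1 ∨ sg a = -1 := by revert a; decide
theorem sg_eq (a : ZMod 2) : sg a = 1 - 2 * (a.val : ℤ) := by revert a; decide

/-- Walsh transform. -/
def W {n : ℕ} (f : V n → ZMod 2) (a : V n) : ℤ := ∑ x, sg (f x + a ⬝ᵥ x)

theorem card_V (n : ℕ) : Fintype.card (V n) = 2 ^ n := by simp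

theorem W_eq_wt {n : ℕ} (f : V n → ZMod 2) (a : V n) :
    W f a = 2 ^ n - 2 * (wt (fun x => f x + a ⬝ᵥ x) : ℤ) := by
  unfold W wt
  simp only [sg_eq, Finset.sum_sub_distrib, ← Finset.mul_sum]
  push_cast
  simp

theorem W_cons {n : ℕ} (f : V (n + 1) → ZMod 2) (b : ZMod 2) (a : V n) :
    W f (Matrix.vecCons b a) = W (half 0 f) a + sg b * W (half 1 f) a := by
  unfold W
  rw [sum_cons, Finset.mul_sum]
  congr 1
  · refine Finset.sum_congr rfl fun x _ => ?_
    simp [half]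
  · refine Finset.sum_congr rfl fun x _ => ?_
    simp only [half, Matrix.cons_dotProduct_cons, mul_one]
    rw [← sg_add]
    congr 1
    ring

theorem parseval {n : ℕ} (f : V n → ZMod 2) : ∑ a, W f a ^ 2 = 4 ^ n := by
  induction n with
  | zero => simp [W, sg_mul_self, sq]
  | succ n ih =>
    rw [sum_cons, ← Finset.sum_add_distrib]
    have : ∀ a : V n, W f (Matrix.vecCons 0 a) ^ 2 + W f (Matrix.vecCons 1 a) ^ 2 =
        2 * W (half 0 f) a ^ 2 + 2 * W (half 1 f) a ^ 2 := by
      intro a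
      rw [W_cons, W_cons]
      simp
      ring
    rw [Finset.sum_congr rfl fun a _ => this a, Finset.sum_add_distrib, ← Finset.mul_sum,
      ← Finset.mul_sum, ih, ih]
    ring

theorem inversion {n : ℕ} (f : V n → ZMod 2) (c : V n) :
    ∑ a, W f a * sg (a ⬝ᵥ c) = 2 ^ n * sg (f c) := by
  induction n with
  | zero =>
    simp only [W, Finset.univ_unique, Finset.sum_singleton]
    rw [Subsingleton.elim c default]
    simp
    exact congrArg (fun t => sg (f t)) (Subsingleton.elim _ _)
  | succ n ih =>
    rw [sum_cons, ← Finset.sum_add_distrib]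
    rw [← cons_head_tail c]
    have : ∀ a : V n, W f (Matrix.vecCons 0 a) * sg (Matrix.vecCons 0 a ⬝ᵥ
        Matrix.vecCons (c 0) (Matrix.vecTail c)) + W f (Matrix.vecCons 1 a) *
        sg (Matrix.vecCons 1 a ⬝ᵥ Matrix.vecCons (c 0) (Matrix.vecTail c)) =
        2 * (W (half (c 0) f) a * sg (a ⬝ᵥ Matrix.vecTail c)) := by
      intro a
      rw [W_cons, W_cons]
      simp only [Matrix.cons_dotProduct_cons, zero_mul, zero_add, one_mul, sg_add, sg_zero,
        sg_one]
      rcases z2_cases (c 0) with h | h <;> rw [h] <;> simp only [sg_zero, sg_one] <;> ring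
    rw [Finset.sum_congr rfl fun a _ => this a, ← Finset.mul_sum, ih]
    simp only [half]
    ring

theorem dot_single {n : ℕ} (L : V n →+ ZMod 2) (x : V n) :
    L x = (fun i => L (Pi.single i 1)) ⬝ᵥ x := by
  conv_lhs => rw [← Finset.univ_sum_single x]
  rw [map_sum]
  refine Finset.sum_congr rfl fun i _ => ?_
  rcases z2_cases (x i) with h | h <;> simp [h]

theorem deg_one_form {n : ℕ} {l : V n → ZMod 2} (h : Deg 1 l) :
    ∃ (a : V n) (c : ZMod 2), ∀ x, l x = a ⬝ᵥ x + c := by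
  have key : ∀ a x, l (x + a) = l x + (l a + l 0) := by
    intro a x
    have := (h a).eq_const x
    simp only [zero_add] at this
    have h2 := z2_add_self (l x)
    linear_combination this - h2
  let L : V n →+ ZMod 2 :=
    { toFun := fun x => l x + l 0
      map_zero' := z2_add_self _
      map_add' := fun x y => by
        simp only [key y x]
        ring }
  refine ⟨fun i => L (Pi.single i 1), l 0, fun x => ?_⟩
  rw [← dot_single]
  change l x = l x + l 0 + l 0
  rw [add_assoc, z2_add_self, add_zero]

theorem deg_dot {n : ℕ} (a : V n) : Deg 1 (fun x : V n => a ⬝ᵥ x) := by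
  apply Aff.deg_one
  intro x y z
  simp [dotProduct_add]

theorem deg_dot_add {n : ℕ} (a : V n) (c : ZMod 2) : Deg 1 (fun x : V n => a ⬝ᵥ x + c) :=
  (deg_dot a).add (Deg.const _ _)

theorem two_wt {n : ℕ} (f : V n → ZMod 2) (a : V n) (c : ZMod 2) :
    2 * (wt (fun x => f x + (a ⬝ᵥ x + c)) : ℤ) = 2 ^ n - sg c * W f a := by
  rcases z2_cases c with h | h
  · subst h
    rw [W_eq_wt]
    simp
  · subst h
    unfold W wt
    have : ∀ b : ZMod 2, (2 * ((b + 1).val : ℤ)) = 1 + sg b := by decide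
    push_cast
    rw [Finset.mul_sum]
    simp only [← add_assoc, this, Finset.sum_add_distrib]
    simp

theorem W_add {n : ℕ} (f : V n → ZMod 2) (a b : V n) (c : ZMod 2) :
    W (fun x => f x + (b ⬝ᵥ x + c)) a = sg c * W f (a + b) := by
  unfold W
  rw [Finset.mul_sum]
  refine Finset.sum_congr rfl fun x _ => ?_
  rw [← sg_add, add_dotProduct]
  congr 1
  ring

theorem wt_add_parity {n : ℕ} (f : V n → ZMod 2) {k : ℕ} {p : V n → ZMod 2} (hp : Deg k p)
    (h : k < n) : (Even (wt (fun x => f x + p x)) ↔ Even (wt f)) := by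
  rw [wt_even_iff, wt_even_iff, Finset.sum_add_distrib, hp.sum_eq_zero h, add_zero]

/-- There is a good affine approximation as soon as some Walsh coefficient is large. -/
theorem exists_affine_le {n : ℕ} (f : V n → ZMod 2) (a : V n) {M : ℕ}
    (h : 2 ^ n - 2 * (M : ℤ) ≤ |W f a|) : ∃ l, Deg 1 l ∧ wt (fun x => f x + l x) ≤ M := by
  rcases le_total 0 (W f a) with h0 | h0
  · refine ⟨_, deg_dot_add a 0, ?_⟩
    have := two_wt f a 0
    rw [abs_of_nonneg h0] at h
    simp only [sg_zero] at this
    omega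
  · refine ⟨_, deg_dot_add a 1, ?_⟩
    have := two_wt f a 1
    rw [abs_of_nonpos h0] at h
    simp only [sg_one] at this
    omega

theorem abs_W_le {n : ℕ} {f : V n → ZMod 2} {k : ℕ}
    (h : ∀ l, Deg 1 l → k ≤ wt (fun x => f x + l x)) (a : V n) :
    |W f a| ≤ 2 ^ n - 2 * (k : ℤ) := by
  have h0 := h _ (deg_dot_add a 0)
  have h1 := h _ (deg_dot_add a 1)
  have e0 := two_wt f a 0
  have e1 := two_wt f a 1
  simp only [sg_zero, sg_one] at e0 e1
  rw [abs_le]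
  constructor <;> omega

theorem W_mod_four {n : ℕ} (hn : 2 ≤ n) (f : V n → ZMod 2) (a : V n) :
    W f a % 4 = if Even (wt f) then 0 else 2 := by
  have h := wt_add_parity f (deg_dot a) (by omega)
  rw [W_eq_wt]
  obtain ⟨m, rfl⟩ : ∃ m, n = m + 2 := ⟨n - 2, by omega⟩
  have e : (2 : ℤ) ^ (m + 2) = 4 * 2 ^ m := by ring
  rw [e]
  split_ifs with h1
  · obtain ⟨t, ht⟩ := h.2 h1
    omega
  · have h2 := (Nat.not_even_iff_odd).1 (fun h3 => h1 (h.1 h3))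
    obtain ⟨t, ht⟩ := h2
    omega

theorem exists_W_sq_ge {n : ℕ} (f : V n → ZMod 2) : ∃ a, (2 : ℤ) ^ n ≤ W f a ^ 2 := by
  by_contra! hc
  have h1 : ∑ a, W f a ^ 2 < ∑ _a : V n, (2 : ℤ) ^ n :=
    Finset.sum_lt_sum_of_nonempty Finset.univ_nonempty fun a _ => hc a
  rw [parseval] at h1
  simp only [Finset.sum_const, Finset.card_univ, card_V, nsmul_eq_mul] at h1
  push_cast at h1
  rw [← mul_pow] at h1
  norm_num at h1

theorem nl_six (f : V 6 → ZMod 2) : ∃ l, Deg 1 l ∧ wt (fun x => f x + l x) ≤ 28 := by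
  obtain ⟨a, ha⟩ := exists_W_sq_ge f
  refine exists_affine_le f a ?_
  have : |(8 : ℤ)| ≤ |W f a| := sq_le_sq.1 (by norm_num at ha ⊢; exact ha)
  norm_num at this ⊢
  exact this

theorem nl_four (f : V 4 → ZMod 2) : ∃ l, Deg 1 l ∧ wt (fun x => f x + l x) ≤ 6 := by
  obtain ⟨a, ha⟩ := exists_W_sq_ge f
  refine exists_affine_le f a ?_
  have : |(4 : ℤ)| ≤ |W f a| := sq_le_sq.1 (by norm_num at ha ⊢; exact ha)
  norm_num at this ⊢
  exact this

theorem sum_sq_le {n : ℕ} {g : V n → ℤ} {M : ℤ} (h : ∀ a, |g a| ≤ M) :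
    ∑ a, g a ^ 2 ≤ 2 ^ n * M ^ 2 := by
  calc ∑ a, g a ^ 2 ≤ ∑ _a : V n, M ^ 2 :=
        Finset.sum_le_sum fun a _ => by
          have := h a
          rw [← sq_abs]
          exact pow_le_pow_left₀ (abs_nonneg _) this 2
    _ = _ := by simp

theorem abs_eq_of_sum_sq {n : ℕ} {g : V n → ℤ} {M : ℤ} (h : ∀ a, |g a| ≤ M)
    (hs : ∑ a, g a ^ 2 = 2 ^ n * M ^ 2) (a : V n) : |g a| = M := by
  have key : ∑ a, (M ^ 2 - g a ^ 2) = 0 := by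
    rw [Finset.sum_sub_distrib, hs]
    simp
  have hnn : ∀ a ∈ (Finset.univ : Finset (V n)), 0 ≤ M ^ 2 - g a ^ 2 := fun a _ => by
    have := pow_le_pow_left₀ (abs_nonneg _) (h a) 2
    rw [sq_abs] at this
    linarith
  have := (Finset.sum_eq_zero_iff_of_nonneg hnn).1 key a (Finset.mem_univ _)
  have h2 : |g a| ^ 2 = M ^ 2 := by rw [sq_abs]; linarith
  have h3 : 0 ≤ M := le_trans (abs_nonneg _) (h a)
  exact (sq_eq_sq₀ (abs_nonneg _) h3).1 h2

theorem nl_five (f : V 5 → ZMod 2) : ∃ l, Deg 1 l ∧ wt (fun x => f x + l x) ≤ 12 := by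
  suffices h : ∃ a, 8 ≤ |W f a| by
    obtain ⟨a, ha⟩ := h
    refine exists_affine_le f a ?_
    norm_num
    exact ha
  by_contra! hc
  have h4 := W_mod_four (by norm_num) f
  by_cases he : Even (wt f)
  · simp only [he, if_true] at h4
    have : ∀ a, |W f a| ≤ 4 := fun a => by
      have := hc a
      have := h4 a
      rw [abs_lt] at *
      rw [abs_le]
      omega
    have := sum_sq_le this
    rw [parseval] at this
    norm_num at this
  · simp only [he, if_false] at h4
    have key : ∀ g h : V 4 → ZMod 2, Even (wt g) → ¬ Even (wt h) →
        (∀ a, |W g a + W h a| < 8) → (∀ a, |W g a - W h a| < 8) → False := by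
      intro g h hg hh h1 h2
      have g4 := W_mod_four (by norm_num) g
      have hh4 := W_mod_four (by norm_num) h
      simp only [hg, hh, if_true, if_false] at g4 hh4
      have e1 : ∀ a, |W g a| ≤ 4 := fun a => by
        have := h1 a; have := h2 a; have := g4 a; have := hh4 a
        rw [abs_lt] at *
        rw [abs_le]
        omega
      have e2 := abs_eq_of_sum_sq e1 (by rw [parseval]; norm_num)
      have e3 : ∀ a, |W h a| ≤ 2 := fun a => by
        have := h1 a; have := h2 a; have := g4 a; have := hh4 a; have := e2 a
        rw [abs_lt] at *
        rw [abs_le]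
        rw [abs_eq (by norm_num)] at this
        omega
      have := sum_sq_le e3
      rw [parseval] at this
      norm_num at this
    have hp : ∀ a, |W (half 0 f) a + W (half 1 f) a| < 8 := fun a => by
      have := hc (Matrix.vecCons 0 a)
      rw [W_cons] at this
      simpa using this
    have hm : ∀ a, |W (half 0 f) a - W (half 1 f) a| < 8 := fun a => by
      have := hc (Matrix.vecCons 1 a)
      rw [W_cons] at this
      simpa [← sub_eq_add_neg] using this
    rw [wt_half, Nat.even_add] at he
    by_cases h0 : Even (wt (half 0 f))
    · exact key _ _ h0 (fun h1 => he ⟨fun _ => h1, fun _ => h0⟩) hp hm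
    · have h1 : Even (wt (half 1 f)) := by
        by_contra h1
        exact he ⟨fun h => absurd h h0, fun h => absurd h h1⟩
      refine key (half 1 f) (half 0 f) h1 h0 (fun a => ?_) (fun a => ?_)
      · rw [add_comm]; exact hp a
      · rw [abs_sub_comm]; exact hm a

/-- `f` has distance at least `k` from all functions of degree at most two. -/
def Far {n : ℕ} (k : ℕ) (f : V n → ZMod 2) : Prop :=
  ∀ p : V n → ZMod 2, Deg 2 p → k ≤ wt (fun x => f x + p x)

/-- The concatenation of `f` and `g` has distance at least `k` from degree two. -/
def Far2 {n : ℕ} (k : ℕ) (f g : V n → ZMod 2) : Prop :=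
  ∀ p q : V n → ZMod 2, Deg 2 p → Deg 1 (fun x => p x + q x) →
    k ≤ wt (fun x => f x + p x) + wt (fun x => g x + q x)

theorem Far.far2 {n k : ℕ} {f : V (n + 1) → ZMod 2} (h : Far k f) :
    Far2 k (half 0 f) (half 1 f) := by
  intro p q hp hpq
  have := h _ (hp.glue hpq)
  rw [wt_half] at this
  have e0 : half 0 (fun x => f x + glue p q x) = fun x => half 0 f x + p x := by
    conv_rhs => rw [← half_glue_zero p q]
    rfl
  have e1 : half 1 (fun x => f x + glue p q x) = fun x => half 1 f x + q x := by
    conv_rhs => rw [← half_glue_one p q]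
    rfl
  rwa [e0, e1] at this

theorem Far.mono {n k m : ℕ} {f : V n → ZMod 2} (h : Far k f) (hm : m ≤ k) : Far m f :=
  fun p hp => hm.trans (h p hp)

theorem Far.add {n k : ℕ} {f p : V n → ZMod 2} (h : Far k f) (hp : Deg 2 p) :
    Far k (fun x => f x + p x) := by
  intro q hq
  have := h _ (hp.add hq)
  simpa only [add_assoc] using this

theorem Far.comp {n k : ℕ} {f : V n → ZMod 2} (h : Far k f) {ψ : V n → V n} (hψ : Aff ψ)
    (hb : Function.Bijective ψ) : Far k (fun x => f (ψ x)) := by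
  obtain ⟨φ, h1, h2, h3, h4⟩ := hψ.inverse hb
  intro q hq
  have := h _ (hq.comp h1)
  rw [← wt_comp _ hb] at this
  simpa only [h3] using this

theorem deg_swap {n : ℕ} {p q : V n → ZMod 2} (hp : Deg 2 p) (h : Deg 1 (fun x => p x + q x)) :
    Deg 2 q := by
  convert hp.add h.succ using 2 with x
  rw [← add_assoc, z2_add_self, zero_add]

theorem Far2.symm {n k : ℕ} {f g : V n → ZMod 2} (h : Far2 k f g) : Far2 k g f := by
  intro p q hp hpq
  have := h q p (deg_swap hp hpq) (by simpa only [add_comm] using hpq)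
  omega

theorem Far2.add {n k : ℕ} {f g p : V n → ZMod 2} (h : Far2 k f g) (hp : Deg 2 p) :
    Far2 k (fun x => f x + p x) (fun x => g x + p x) := by
  intro q r hq hqr
  have := h _ (fun x => p x + r x) (hp.add hq) (by
    convert hqr using 2 with x
    have := z2_add_self (p x)
    linear_combination this)
  simpa only [add_assoc] using this

theorem Far2.add_right {n k : ℕ} {f g l : V n → ZMod 2} (h : Far2 k f g) (hl : Deg 1 l) :
    Far2 k f (fun x => g x + l x) := by
  intro q r hq hqr
  have := h _ (fun x => l x + r x) hq (by
    convert hqr.add hl using 2 with x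
    ring)
  simpa only [add_assoc] using this

theorem Far2.comp {n k : ℕ} {f g : V n → ZMod 2} (h : Far2 k f g) {ψ : V n → V n} (hψ : Aff ψ)
    (hb : Function.Bijective ψ) : Far2 k (fun x => f (ψ x)) (fun x => g (ψ x)) := by
  obtain ⟨φ, h1, h2, h3, h4⟩ := hψ.inverse hb
  intro q r hq hqr
  have := h _ _ (hq.comp h1) (hqr.comp h1)
  rw [← wt_comp _ hb, ← wt_comp (fun x => g x + _) hb] at this
  simpa only [h3] using this

theorem Far2.far {n k m : ℕ} {f g : V n → ZMod 2} (h : Far2 (k + m) f g)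
    (hg : ∀ p, Deg 2 p → ∃ l, Deg 1 l ∧ wt (fun x => g x + (p x + l x)) ≤ m) : Far k f := by
  intro p hp
  obtain ⟨l, hl, hle⟩ := hg p hp
  have := h p (fun x => p x + l x) hp (by
    convert hl using 2 with x
    rw [← add_assoc, z2_add_self, zero_add])
  omega

/-- Unit vectors. -/
def ee (n : ℕ) (i : Fin n) : V n := Pi.single i 1

/-- Six points in general position in dimension five. -/
def t1 (x : V 5) : ZMod 2 :=
  if x ∈ [0, ee 5 0, ee 5 1, ee 5 2, ee 5 3, ee 5 4] then 1 else 0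

/-- Six points in general position in a hyperplane. -/
def t2 (x : V 5) : ZMod 2 :=
  if x ∈ [0, ee 5 1, ee 5 2, ee 5 3, ee 5 4, ![0, 1, 1, 1, 1]] then 1 else 0

theorem wt_mono {A : Type*} [Fintype A] {f g : A → ZMod 2} (h : ∀ x, f x = 1 → g x = 1) :
    wt f ≤ wt g := by
  refine Finset.sum_le_sum fun x _ => ?_
  rcases z2_cases (f x) with h0 | h0
  · rw [h0]; simp
  · rw [h0, h x h0]

theorem wt_range {n m : ℕ} {f : V m → ZMod 2} {ψ : V n → V m} (hi : Function.Injective ψ)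
    (h : ∀ v, f v = 1 → ∃ x, ψ x = v) : wt f = wt (fun x => f (ψ x)) := by
  unfold wt
  symm
  refine Finset.sum_of_injOn ψ hi.injOn (by simp) ?_ (by simp)
  intro v _ hv
  rcases z2_cases (f v) with h0 | h0
  · simp [h0]
  · obtain ⟨x, hx⟩ := h v h0
    exact absurd ⟨x, by simp, hx⟩ hv

/-- No four distinct points of the support sum to zero. -/
def NoPlane {n : ℕ} (s : V n → ZMod 2) : Prop :=
  ∀ a b c, a ≠ b → a ≠ c → b ≠ c → s a = 1 → s b = 1 → s c = 1 → s (a + b + c) = 0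

theorem NoPlane.comp {n m : ℕ} {s : V m → ZMod 2} (h : NoPlane s) {ψ : V n → V m} (hψ : Aff ψ)
    (hi : Function.Injective ψ) : NoPlane (fun x => s (ψ x)) := by
  intro a b c h1 h2 h3 ha hb hc
  simp only [hψ a b c]
  exact h _ _ _ (hi.ne h1) (hi.ne h2) (hi.ne h3) ha hb hc

/-- `s ∘ ψ` contains the origin and the unit vectors. -/
def Frame {n m : ℕ} (s : V m → ZMod 2) (ψ : V n → V m) : Prop :=
  Aff ψ ∧ Function.Injective ψ ∧ s (ψ 0) = 1 ∧ ∀ i, s (ψ (ee n i)) = 1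

theorem vecCons_zero_zero {n : ℕ} : (Matrix.vecCons 0 0 : V (n + 1)) = 0 := by
  funext i; refine Fin.cases ?_ (fun j => ?_) i <;> simp

theorem ee_zero {n : ℕ} : ee (n + 1) 0 = Matrix.vecCons 1 0 := by
  funext i; refine Fin.cases ?_ (fun j => ?_) i <;> simp [ee]

theorem ee_succ {n : ℕ} (i : Fin n) : ee (n + 1) i.succ = Matrix.vecCons 0 (ee n i) := by
  funext j; refine Fin.cases ?_ (fun j => ?_) j
  · simp [ee]
  · simp [ee, Pi.single_apply]

theorem Frame.step {n m : ℕ} {s : V m → ZMod 2} {ψ : V n → V m} (h : Frame s ψ) {v : V m}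
    (hv : ∀ x, ψ x ≠ v) (hs : s v = 1) :
    ∃ ψ' : V (n + 1) → V m, Frame s ψ' ∧ ∀ x, ψ' (Matrix.vecCons 0 x) = ψ x := by
  obtain ⟨h1, h2, h3, h4⟩ := h
  obtain ⟨ψ', g1, g2, g3, g4⟩ := h1.extendTo h2 hv
  refine ⟨ψ', ⟨g1, g2, ?_, fun i => ?_⟩, g3⟩
  · rw [← vecCons_zero_zero, g3, h3]
  · refine Fin.cases ?_ (fun j => ?_) i
    · rw [ee_zero, g4, hs]
    · rw [ee_succ, g3, h4]

theorem frame_zero {m : ℕ} {s : V m → ZMod 2} {v : V m} (hs : s v = 1) :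
    Frame s (fun _ : V 0 => v) := by
  refine ⟨?_, fun _ _ _ => Subsingleton.elim _ _, hs, fun i => i.elim0⟩
  intro x y z
  simp only
  rw [v_add_self, zero_add]

/-- A minimal-weight representative has at most half of each three-dimensional flat. -/
theorem flat_le_of_minimal {s : V 5 → ZMod 2}
    (hmin : ∀ q, Deg 2 q → wt s ≤ wt (fun x => s x + q x)) {ψ : V 3 → V 5} (hψ : Aff ψ)
    (hi : Function.Injective ψ) : wt (fun x => s (ψ x)) ≤ 4 := by
  obtain ⟨ψ4, a4, i4, e4⟩ := hψ.extend hi (by norm_num)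
  obtain ⟨Φ, a5, i5, e5⟩ := a4.extend i4 (by norm_num)
  obtain ⟨Ψ, b1, b2, b3, -⟩ := a5.inverse (bij_of_inj i5)
  have hq : Deg 2 (fun y => (1 + Ψ y 0) * (1 + Ψ y 1)) :=
    ((Deg.const 1 1).add ((deg_coord 0).comp b1)).pmul
      ((Deg.const 1 1).add ((deg_coord 1).comp b1))
  have h1 := hmin _ hq
  have h2 := wt_add s (fun y => (1 + Ψ y 0) * (1 + Ψ y 1))
  rw [← wt_comp (fun y => (1 + Ψ y 0) * (1 + Ψ y 1)) (bij_of_inj i5),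
    ← wt_comp (fun x => s x * _) (bij_of_inj i5)] at h2
  simp only [b3] at h2
  have h3 : wt (fun x : V 5 => (1 + x 0) * (1 + x 1)) = 8 := by decide +kernel
  rw [h3, wt_half (fun x => s (Φ x) * _), wt_half (half 0 fun x => s (Φ x) * _)] at h2
  have h4 : wt (half 0 (half 0 fun x => s (Φ x) * ((1 + x 0) * (1 + x 1)))) =
      wt (fun x => s (ψ x)) := by
    refine congrArg wt (funext fun x => ?_)
    simp [half, e5, e4]
  rw [h4] at h2
  omega

theorem noPlane_of_minimal {s : V 5 → ZMod 2} (h5 : 5 ≤ wt s)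
    (hmin : ∀ q, Deg 2 q → wt s ≤ wt (fun x => s x + q x)) : NoPlane s := by
  intro a b c hab hac hbc ha hb hc
  rcases z2_cases (s (a + b + c)) with h | hd
  · exact h
  exfalso
  obtain ⟨-, i0, -, -⟩ := frame_zero ha
  have a0 : Aff (fun _ : V 0 => a) := (frame_zero ha).1
  obtain ⟨ψ1, a1, i1, e1, e1'⟩ := a0.extendTo i0 (v := b) (fun _ => hab)
  obtain ⟨ψ2, a2, i2, e2, e2'⟩ := a1.extendTo i1 (v := c) (by
    intro x
    rw [← cons_head_tail x, Subsingleton.elim (Matrix.vecTail x) 0]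
    rcases z2_cases (x 0) with h | h <;> rw [h]
    · rwa [e1]
    · rwa [e1'])
  have all : ∀ x, s (ψ2 x) = 1 := by
    have : ∀ x : V 2, x = Matrix.vecCons 0 (Matrix.vecCons 0 0) ∨
        x = Matrix.vecCons 0 (Matrix.vecCons 1 0) ∨ x = Matrix.vecCons 1 0 ∨
        x = Matrix.vecCons 0 (Matrix.vecCons 0 0) + Matrix.vecCons 0 (Matrix.vecCons 1 0) +
          Matrix.vecCons 1 0 := by decide
    intro x
    rcases this x with h | h | h | h <;> rw [h]
    · rw [e2, e1, ha]
    · rw [e2, e1', hb]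
    · rw [e2', hc]
    · rw [a2, e2, e1, e2, e1', e2', hd]
  have : ∃ v, s v = 1 ∧ ∀ x, ψ2 x ≠ v := by
    by_contra! hcon
    have := wt_range i2 hcon
    simp only [all] at this
    have h4 : wt (fun _ : V 2 => (1 : ZMod 2)) = 4 := by decide
    rw [this, h4] at h5
    omega
  obtain ⟨v, hv, hvr⟩ := this
  obtain ⟨ψ3, a3, i3, e3, e3'⟩ := a2.extendTo i2 hvr
  have h1 := flat_le_of_minimal hmin a3 i3
  have h2 : wt (fun x : V 3 => if x 0 = 0 ∨ x = Matrix.vecCons 1 0 then (1 : ZMod 2) else 0) = 5 := by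
    decide +kernel
  have h3 := wt_mono (f := fun x : V 3 => if x 0 = 0 ∨ x = Matrix.vecCons 1 0 then (1 : ZMod 2)
    else 0) (g := fun x => s (ψ3 x)) (fun x hx => by
      have hx' : x 0 = 0 ∨ x = Matrix.vecCons 1 0 := by
        by_contra hc
        simp [hc] at hx
      rcases hx' with h | h
      · rw [← cons_head_tail x, h, e3, all]
      · rw [h, e3', hv])
  omega

theorem frame_three_wt {f : V 3 → ZMod 2} (hN : NoPlane f) (h0 : f 0 = 1)
    (hf : ∀ i, f (ee 3 i) = 1) : wt f ≤ 4 := by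
  have key : ∀ x : V 3, x ∈ [0, ee 3 0, ee 3 1, ee 3 2] ∨
      ∃ a ∈ [0, ee 3 0, ee 3 1, ee 3 2], ∃ b ∈ [0, ee 3 0, ee 3 1, ee 3 2],
      ∃ c ∈ [0, ee 3 0, ee 3 1, ee 3 2], a ≠ b ∧ a ≠ c ∧ b ≠ c ∧ x = a + b + c := by
    decide +kernel
  have all : ∀ x ∈ [0, ee 3 0, ee 3 1, ee 3 2], f x = 1 := by simp [h0, hf]
  have h4 : wt (fun x : V 3 => if x ∈ [0, ee 3 0, ee 3 1, ee 3 2] then (1 : ZMod 2) else 0) = 4 := by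
    decide +kernel
  rw [← h4]
  refine wt_mono fun x hx => ?_
  rcases key x with h | ⟨a, ha, b, hb, c, hc, hab, hac, hbc, rfl⟩
  · simp only [h, if_true]
  · rw [hN a b c hab hac hbc (all a ha) (all b hb) (all c hc)] at hx
    exact absurd hx (by decide)

theorem Frame.wt_le {s : V 5 → ZMod 2} (hN : NoPlane s) {n : ℕ} (hn : n ≤ 3)
    {ψ : V n → V 5} (h : Frame s ψ) : wt (fun x => s (ψ x)) ≤ 4 := by
  obtain ⟨h1, h2, h3, h4⟩ := h
  rcases Nat.lt_or_ge n 3 with h | h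
  · have h5 : wt (fun x => s (ψ x)) ≤ wt (fun _ : V n => (1 : ZMod 2)) :=
      wt_mono fun _ _ => rfl
    have h6 : wt (fun _ : V n => (1 : ZMod 2)) = 2 ^ n := by
      simp [wt, ZMod.val_one]
    have : 2 ^ n ≤ 2 ^ 2 := Nat.pow_le_pow_right (by norm_num) (by omega)
    omega
  · obtain rfl : n = 3 := by omega
    exact frame_three_wt (hN.comp h1 h2) h3 h4

theorem Frame.next {s : V 5 → ZMod 2} (hN : NoPlane s) (h5 : 5 ≤ wt s) {n : ℕ} (hn : n ≤ 3)
    {ψ : V n → V 5} (h : Frame s ψ) : ∃ ψ' : V (n + 1) → V 5, Frame s ψ' := by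
  have : ∃ v, s v = 1 ∧ ∀ x, ψ x ≠ v := by
    by_contra! hcon
    have := wt_range h.2.1 hcon
    have := h.wt_le hN hn
    omega
  obtain ⟨v, hv, hvr⟩ := this
  obtain ⟨ψ', F, -⟩ := h.step hvr hv
  exact ⟨ψ', F⟩

theorem t1_of_noPlane {f : V 5 → ZMod 2} (he : Even (wt f)) (hN : NoPlane f) (h0 : f 0 = 1)
    (hf : ∀ i, f (ee 5 i) = 1) : f = t1 := by
  set B : List (V 5) := [0, ee 5 0, ee 5 1, ee 5 2, ee 5 3, ee 5 4] with hB
  set Q : List (V 5) := [![0, 1, 1, 1, 1], ![1, 0, 1, 1, 1], ![1, 1, 0, 1, 1], ![1, 1, 1, 0, 1],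
    ![1, 1, 1, 1, 0], ![1, 1, 1, 1, 1]] with hQ
  have key : ∀ x : V 5, x ∈ B ∨ x ∈ Q ∨ ∃ a ∈ B, ∃ b ∈ B, ∃ c ∈ B,
      a ≠ b ∧ a ≠ c ∧ b ≠ c ∧ x = a + b + c := by
    rw [hB, hQ]; decide +kernel
  have all : ∀ x ∈ B, f x = 1 := by simp [hB, h0, hf]
  by_cases hq : ∃ q ∈ Q, f q = 1
  · exfalso
    obtain ⟨q, hqQ, hq⟩ := hq
    have k2 : ∀ q ∈ Q, ∀ r ∈ Q, r = q ∨ ∃ a ∈ B, ∃ b ∈ B, q ≠ a ∧ q ≠ b ∧ a ≠ b ∧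
        r = q + a + b := by
      rw [hB, hQ]; decide +kernel
    have k3 : ∀ q ∈ Q, wt (fun x => if x ∈ B ∨ x = q then (1 : ZMod 2) else 0) = 7 := by
      rw [hB, hQ]; decide +kernel
    have : f = fun x => if x ∈ B ∨ x = q then (1 : ZMod 2) else 0 := by
      funext x
      split_ifs with hx
      · rcases hx with hx | rfl
        · exact all x hx
        · exact hq
      · push Not at hx
        rcases key x with h | h | ⟨a, ha, b, hb, c, hc, hab, hac, hbc, rfl⟩
        · exact absurd h hx.1
        · rcases k2 q hqQ x h with h | ⟨a, ha, b, hb, h1, h2, h3, rfl⟩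
          · exact absurd h hx.2
          · exact hN _ _ _ h1 h2 h3 hq (all a ha) (all b hb)
        · exact hN a b c hab hac hbc (all a ha) (all b hb) (all c hc)
    rw [this, k3 q hqQ] at he
    exact absurd he (by decide)
  · push Not at hq
    funext x
    unfold t1
    split_ifs with hx
    · exact all x hx
    · rcases key x with h | h | ⟨a, ha, b, hb, c, hc, hab, hac, hbc, rfl⟩
      · exact absurd h hx
      · exact (z2_cases _).resolve_right (hq x h)
      · exact hN a b c hab hac hbc (all a ha) (all b hb) (all c hc)

theorem t2_of_noPlane {f : V 5 → ZMod 2} (he : Even (wt f)) (hN : NoPlane f) (h0 : f 0 = 1)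
    (hf : ∀ i : Fin 4, f (ee 5 i.succ) = 1) (hz : ∀ x, f x = 1 → x 0 = 0) : f = t2 := by
  set B : List (V 5) := [0, ee 5 1, ee 5 2, ee 5 3, ee 5 4] with hB
  have key : ∀ x : V 5, x 0 = 0 → x ∈ B ∨ x = ![0, 1, 1, 1, 1] ∨ ∃ a ∈ B, ∃ b ∈ B, ∃ c ∈ B,
      a ≠ b ∧ a ≠ c ∧ b ≠ c ∧ x = a + b + c := by
    rw [hB]; decide +kernel
  have all : ∀ x ∈ B, f x = 1 := by
    have := hf 0; have := hf 1; have := hf 2; have := hf 3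
    simp [hB]
    exact ⟨h0, hf 0, hf 1, hf 2, hf 3⟩
  by_cases hq : f ![0, 1, 1, 1, 1] = 1
  · funext x
    unfold t2
    split_ifs with hx
    · have : x ∈ B ∨ x = ![0, 1, 1, 1, 1] := by
        simp [hB] at hx ⊢
        tauto
      rcases this with h | rfl
      · exact all x h
      · exact hq
    · have hx' : ¬ (x ∈ B ∨ x = ![0, 1, 1, 1, 1]) := by
        simp [hB] at hx ⊢
        tauto
      push Not at hx'
      refine (z2_cases _).resolve_right fun h1 => ?_
      rcases key x (hz x h1) with h | h | ⟨a, ha, b, hb, c, hc, hab, hac, hbc, rfl⟩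
      · exact hx'.1 h
      · exact hx'.2 h
      · rw [hN a b c hab hac hbc (all a ha) (all b hb) (all c hc)] at h1
        exact absurd h1 (by decide)
  · exfalso
    have k3 : wt (fun x => if x ∈ B then (1 : ZMod 2) else 0) = 5 := by
      rw [hB]; decide +kernel
    have : f = fun x => if x ∈ B then (1 : ZMod 2) else 0 := by
      funext x
      split_ifs with hx
      · exact all x hx
      · refine (z2_cases _).resolve_right fun h1 => ?_
        rcases key x (hz x h1) with h | h | ⟨a, ha, b, hb, c, hc, hab, hac, hbc, rfl⟩
        · exact hx h
        · exact hq (h ▸ h1)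
        · rw [hN a b c hab hac hbc (all a ha) (all b hb) (all c hc)] at h1
          exact absurd h1 (by decide)
    rw [this, k3] at he
    exact absurd he (by decide)

/-- A representative of minimal weight modulo quadratic functions. -/
theorem exists_minimal {n : ℕ} (g : V n → ZMod 2) : ∃ p, Deg 2 p ∧
    ∀ q, Deg 2 q → wt (fun x => g x + p x) ≤ wt (fun x => g x + p x + q x) := by
  classical
  have hex : ∃ m, ∃ p, Deg 2 p ∧ wt (fun x => g x + p x) = m := ⟨_, fun _ => 0, Deg.const _ _, rfl⟩
  obtain ⟨p, hp, hm⟩ := Nat.find_spec hex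
  refine ⟨p, hp, fun q hq => ?_⟩
  rw [hm]
  exact Nat.find_min' hex ⟨_, hp.add hq, by simp only [add_assoc]⟩

theorem leader {g : V 5 → ZMod 2} (he : Even (wt g)) (hF : Far 5 g) :
    ∃ (p : V 5 → ZMod 2) (Φ : V 5 → V 5), Deg 2 p ∧ Aff Φ ∧ Function.Bijective Φ ∧
      ((∀ x, g (Φ x) + p x = t1 x) ∨ ∀ x, g (Φ x) + p x = t2 x) := by
  obtain ⟨p, hp, hmin⟩ := exists_minimal g
  set s : V 5 → ZMod 2 := fun x => g x + p x with hs
  have h5 : 5 ≤ wt s := hF p hp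
  have hse : Even (wt s) := (wt_add_parity g hp (by norm_num)).2 he
  have hN := noPlane_of_minimal h5 hmin
  have : ∃ v, s v = 1 := by
    by_contra! hc
    have : wt s = 0 := Finset.sum_eq_zero fun x _ => by
      rw [(z2_cases (s x)).resolve_right (hc x)]; rfl
    omega
  obtain ⟨v, hv⟩ := this
  obtain ⟨ψ1, F1⟩ := (frame_zero hv).next hN h5 (by norm_num)
  obtain ⟨ψ2, F2⟩ := F1.next hN h5 (by norm_num)
  obtain ⟨ψ3, F3⟩ := F2.next hN h5 (by norm_num)
  obtain ⟨ψ4, F4⟩ := F3.next hN h5 (by norm_num)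
  by_cases hex : ∃ v, s v = 1 ∧ ∀ x, ψ4 x ≠ v
  · obtain ⟨v, hv, hvr⟩ := hex
    obtain ⟨Φ, ⟨a, i, z, f⟩, -⟩ := F4.step hvr hv
    refine ⟨fun x => p (Φ x), Φ, hp.comp a, a, bij_of_inj i, Or.inl ?_⟩
    have := t1_of_noPlane (by rwa [wt_comp s (bij_of_inj i)]) (hN.comp a i) z f
    exact fun x => congrFun this x
  · push Not at hex
    obtain ⟨a4, i4, z4, f4⟩ := F4
    obtain ⟨Φ, a, i, e⟩ := a4.extend i4 (by norm_num)
    refine ⟨fun x => p (Φ x), Φ, hp.comp a, a, bij_of_inj i, Or.inr ?_⟩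
    have := t2_of_noPlane (by rwa [wt_comp s (bij_of_inj i)]) (hN.comp a i)
      (by rw [← vecCons_zero_zero, e, z4]) (fun i => by rw [ee_succ, e, f4]) (fun x hx => by
        obtain ⟨y, hy⟩ := hex _ hx
        rw [← e] at hy
        rw [← i hy]
        rfl)
    exact fun x => congrFun this x

/-- If all coordinate halves `x i = 0` have degree at most `k`, then so has the function,
up to the product of all coordinates. -/
theorem deg_of_update {n k : ℕ} {f : V n → ZMod 2}
    (h : ∀ i, Deg k (fun x => f (Function.update x i 0))) :
    ∃ c : ZMod 2, Deg k (fun x => f x + c * ∏ i, x i) := by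
  induction k generalizing n f with
  | zero =>
    refine ⟨f 1 + f 0, ?_⟩
    have key : ∀ x, f x + (f 1 + f 0) * ∏ i, x i = f 0 := by
      intro x
      by_cases hx : ∃ i, x i = 0
      · obtain ⟨i, hi⟩ := hx
        rw [Finset.prod_eq_zero (Finset.mem_univ i) hi, mul_zero, add_zero]
        have := (h i).eq_const x
        rw [← hi, Function.update_eq_self] at this
        rw [this, hi]
        congr 1
        funext j
        by_cases hj : j = i
        · subst hj; simp
        · simp [Function.update_of_ne hj]
      · push Not at hx
        have : x = 1 := funext fun i => (z2_cases (x i)).resolve_left (hx i)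
        subst this
        simp only [Pi.one_apply, Finset.prod_const_one, mul_one]
        rw [← add_assoc, z2_add_self, zero_add]
    intro a x
    simp only [key]
  | succ k ih =>
    cases n with
    | zero =>
      refine ⟨0, ?_⟩
      have : (fun x : V 0 => f x + 0 * ∏ i, x i) = fun _ => f 0 := by
        funext x
        rw [Subsingleton.elim x 0]
        simp
      rw [this]
      exact Deg.const _ _
    | succ n =>
      have hlo : Deg (k + 1) (half 0 f) := by
        have := (h 0).half 0
        have e : half 0 (fun x => f (Function.update x 0 0)) = half 0 f := by
          refine funext fun x => congrArg f (funext fun j => ?_)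
          refine Fin.cases ?_ (fun j => ?_) j <;> simp
        rwa [e] at this
      have hg : ∀ i, Deg k (fun x => (fun x => half 0 f x + half 1 f x) (Function.update x i 0)) := by
        intro i
        have := (h i.succ).half_add
        convert this using 2 with x
        have e : ∀ b : ZMod 2, (Function.update (Matrix.vecCons b x : V (n + 1)) i.succ 0) =
            Matrix.vecCons b (Function.update x i 0) := by
          intro b
          funext j
          refine Fin.cases ?_ (fun j => ?_) j
          · rw [Function.update_of_ne (Fin.succ_ne_zero i).symm]; simp
          · simp only [Matrix.cons_val_succ]
            by_cases hj : j = i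
            · subst hj; simp
            · rw [Function.update_of_ne hj,
                Function.update_of_ne (fun h => hj (Fin.succ_injective _ h))]
              simp
        simp only [half, e]
      obtain ⟨c, hc⟩ := ih (f := fun x => half 0 f x + half 1 f x) hg
      refine ⟨c, ?_⟩
      have h1 := (hlo.comp aff_tail).add (by
        have := (deg_coord (0 : Fin (n + 1))).pmul (hc.comp aff_tail)
        rwa [add_comm 1 k] at this)
      convert h1 using 2 with x
      rw [Fin.prod_univ_succ]
      have h2 : ∏ i : Fin n, x i.succ = ∏ i, (Matrix.vecTail x : V n) i := rfl
      rw [h2]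
      conv_lhs => rw [← glue_half f]
      unfold glue
      ring

/-- A function orthogonal to all affine functions has degree at most `n - 2`. -/
theorem deg_of_moments {m : ℕ} {f : V (m + 2) → ZMod 2} (h0 : ∑ x, f x = 0)
    (h1 : ∀ i, ∑ x, f x * x i = 0) : Deg m f := by
  refine deg_of_inj_flats fun ψ a i => ?_
  obtain ⟨Φ, aΦ, iΦ, eΦ⟩ := a.extend i (by omega)
  obtain ⟨Ψ, b1, b2, b3, b4⟩ := aΦ.inverse (bij_of_inj iΦ)
  have h2 : ∑ x, f (ψ x) = ∑ y, f (Φ y) * (1 + y 0) := by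
    rw [sum_cons (fun y => f (Φ y) * (1 + y 0))]
    simp only [eΦ, Matrix.cons_val_zero, add_zero, mul_one, z2_add_self, mul_zero,
      Finset.sum_const_zero]
  have h3 : ∑ y, f (Φ y) * (1 + y 0) = ∑ z, f z * (1 + Ψ z 0) := by
    rw [← (bij_of_inj iΦ).sum_comp (fun z => f z * (1 + Ψ z 0))]
    simp only [b3]
  obtain ⟨u, c, hu⟩ := deg_one_form ((deg_coord 0).comp b1)
  rw [h2, h3]
  simp only [hu]
  have : ∀ z, f z * (1 + (u ⬝ᵥ z + c)) = f z * (1 + c) + ∑ j, u j * (f z * z j) := by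
    intro z
    have : f z * (u ⬝ᵥ z) = ∑ j, u j * (f z * z j) := by
      rw [dotProduct, Finset.mul_sum]
      exact Finset.sum_congr rfl fun j _ => by ring
    rw [← this]
    ring
  simp only [this, Finset.sum_add_distrib, ← Finset.sum_mul, h0, zero_mul, zero_add]
  rw [Finset.sum_comm]
  simp only [← Finset.mul_sum, h1, mul_zero, Finset.sum_const_zero]

theorem autocorr {n : ℕ} (f : V n → ZMod 2) {e : V n} (he : e ≠ 0) :
    ∑ a, W f a * W f (a + e) = 0 := by
  induction n with
  | zero => exact absurd (Subsingleton.elim _ _) he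
  | succ n ih =>
    rw [← cons_head_tail e, sum_cons, ← Finset.sum_add_distrib]
    have : ∀ a : V n, W f (Matrix.vecCons 0 a) * W f (Matrix.vecCons 0 a +
          Matrix.vecCons (e 0) (Matrix.vecTail e)) +
        W f (Matrix.vecCons 1 a) * W f (Matrix.vecCons 1 a +
          Matrix.vecCons (e 0) (Matrix.vecTail e)) =
        2 * (W (half 0 f) a * W (half 0 f) (a + Matrix.vecTail e)) +
        2 * sg (e 0) * (W (half 1 f) a * W (half 1 f) (a + Matrix.vecTail e)) := by
      intro a
      rw [Matrix.cons_add_cons, Matrix.cons_add_cons]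
      simp only [W_cons, sg_add, sg_zero, sg_one]
      ring
    rw [Finset.sum_congr rfl fun a _ => this a, Finset.sum_add_distrib, ← Finset.mul_sum,
      ← Finset.mul_sum]
    by_cases ht : (Matrix.vecTail e : V n) = 0
    · have h0 : e 0 = 1 := by
        refine (z2_cases _).resolve_left fun h0 => he ?_
        rw [← cons_head_tail e, h0, ht, vecCons_zero_zero]
      rw [ht, h0]
      simp only [add_zero, ← sq, parseval]
      simp
    · rw [ih _ ht, ih _ ht]
      simp

/-- Sums of neighbouring Walsh coefficients. -/
theorem W_add_W_ee {f : V 4 → ZMod 2} (i : Fin 4) (a : V 4) :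
    W f a + W f (a + ee 4 i) = 16 - 4 * (wt (fun x => (f x + a ⬝ᵥ x) * (1 + x i)) : ℤ) := by
  have h : ∀ u t : ZMod 2, sg u + sg (u + t) = (1 + sg t) - 4 * ((u * (1 + t)).val : ℤ) := by
    decide
  unfold W wt
  push_cast
  rw [← Finset.sum_add_distrib, Finset.mul_sum]
  have e : ∀ x : V 4, ee 4 i ⬝ᵥ x = x i := fun x => by simp [ee]
  simp only [add_dotProduct, ← add_assoc, e, h]
  rw [Finset.sum_sub_distrib]
  congr 1
  revert i
  decide +kernel

theorem W_neighbour_mod {f : V 4 → ZMod 2} (i : Fin 4) (a : V 4) :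
    (W f a + W f (a + ee 4 i)) % 8 = if ∑ x, f x * (1 + x i) = 0 then 0 else 4 := by
  rw [W_add_W_ee]
  have h : Deg 2 (fun x : V 4 => (a ⬝ᵥ x) * (1 + x i)) :=
    (deg_dot a).pmul ((Deg.const 1 1).add (deg_coord i))
  have h2 := wt_add_parity (fun x => f x * (1 + x i)) h (by norm_num)
  simp only [← add_mul] at h2
  rw [wt_even_iff (fun x => f x * (1 + x i))] at h2
  split_ifs with h3
  · obtain ⟨t, ht⟩ := h2.2 h3
    omega
  · obtain ⟨t, ht⟩ := Nat.not_even_iff_odd.1 (fun h4 => h3 (h2.1 h4))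
    omega

/-- Directions in dimension four coming from the vertices of the simplex. -/
def D4 : List (V 4) := [0, ee 4 0, ee 4 1, ee 4 2, ee 4 3, ![1, 1, 1, 1]]

/-- Translates of `D4`. -/
def tr (x : V 4) : Finset (V 4) := univ.filter fun a => a + x ∈ D4

theorem mem_tr {a x : V 4} : a ∈ tr x ↔ a + x ∈ D4 := by simp [tr]

theorem card_tr : ∀ x, (tr x).card = 6 := by decide +kernel

theorem card_tr_inter : ∀ x y, x ≠ y → (tr x ∩ tr y).card = 2 := by decide +kernel

theorem neighbour_count : ∀ x y : V 4, x ≠ y → ∀ i, (univ.filter fun a : V 4 =>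
    (a ∉ tr x ∪ tr y) ∧ a + ee 4 i ∉ tr x ∪ tr y).card ≠ 2 := by decide +kernel

theorem card_tr_union {x y : V 4} (h : x ≠ y) : (tr x ∪ tr y).card = 10 := by
  have := Finset.card_union_add_card_inter (tr x) (tr y)
  rw [card_tr_inter x y h, card_tr, card_tr] at this
  omega

theorem card_tr_union_three {x y z : V 4} (h1 : x ≠ y) (h2 : x ≠ z) (h3 : y ≠ z) :
    12 ≤ (tr x ∪ tr y ∪ tr z).card := by
  have := Finset.card_union_add_card_inter (tr x ∪ tr y) (tr z)
  rw [card_tr_union h1, card_tr] at this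
  have h4 : ((tr x ∪ tr y) ∩ tr z).card ≤ 4 := by
    rw [Finset.union_inter_distrib_right]
    refine (Finset.card_union_le _ _).trans ?_
    rw [card_tr_inter x z h2, card_tr_inter y z h3]
  omega

/-- Compatibility of the spectra of two functions. -/
def Compat (h h' : V 4 → ZMod 2) : Prop :=
  ∀ x a, a + x ∈ D4 → |W h x| + |W h' a| ≤ 10

theorem Compat.symm {h h' : V 4 → ZMod 2} (H : Compat h h') : Compat h' h := by
  intro x a hx
  rw [add_comm] at hx ⊢
  exact H _ _ hx

theorem card_six {g : V 4 → ZMod 2} (h : ∀ a, |W g a| = 2 ∨ |W g a| = 6) :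
    (univ.filter fun a => |W g a| = 6).card = 6 := by
  have h1 := parseval g
  have h2 : ∀ a, W g a ^ 2 = 4 + if |W g a| = 6 then 32 else 0 := by
    intro a
    rw [← sq_abs]
    rcases h a with h | h <;> rw [h] <;> norm_num
  rw [Finset.sum_congr rfl fun a _ => h2 a, Finset.sum_add_distrib, ← Finset.sum_filter,
    Finset.sum_const, Finset.sum_const] at h1
  simp only [Finset.card_univ, card_V, nsmul_eq_mul] at h1
  norm_num at h1
  omega

theorem Compat.not_both_odd {h h' : V 4 → ZMod 2} (H : Compat h h') :
    Even (wt h) ∨ Even (wt h') := by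
  by_contra! hc
  obtain ⟨ho, ho'⟩ := hc
  have m := W_mod_four (by norm_num) h
  have m' := W_mod_four (by norm_num) h'
  simp only [ho, ho', if_false] at m m'
  have H8 : ∀ x a, a + x ∈ D4 → |W h x| + |W h' a| ≤ 8 := by
    intro x a hx
    have h1 := H x a hx
    have := m x
    have := m' a
    rcases abs_cases (W h x) with h2 | h2 <;> rcases abs_cases (W h' a) with h3 | h3 <;> omega
  have z4 : (0 : V 4) ∈ D4 := by decide
  have v : ∀ a, |W h a| = 2 ∨ |W h a| = 6 := by
    intro a
    have h1 := H8 a a (by rwa [v_add_self])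
    have := m a
    have := m' a
    rcases abs_cases (W h a) with h2 | h2 <;> rcases abs_cases (W h' a) with h3 | h3 <;> omega
  have v' : ∀ a, |W h' a| = 2 ∨ |W h' a| = 6 := by
    intro a
    have h1 := H8 a a (by rwa [v_add_self])
    have := m a
    have := m' a
    rcases abs_cases (W h a) with h2 | h2 <;> rcases abs_cases (W h' a) with h3 | h3 <;> omega
  have c := card_six v
  have c' := card_six v'
  obtain ⟨x, y, z, hx, hy, hz, h1, h2, h3⟩ := Finset.two_lt_card_iff.1 (by rw [c]; norm_num :
    2 < (univ.filter fun a => |W h a| = 6).card)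
  have h4 := card_tr_union_three h1 h2 h3
  have h5 : Disjoint (tr x ∪ tr y ∪ tr z) (univ.filter fun a => |W h' a| = 6) := by
    rw [Finset.disjoint_left]
    intro a ha ha'
    simp only [Finset.mem_union, mem_tr, Finset.mem_filter, Finset.mem_univ, true_and] at *
    rcases ha with (ha | ha) | ha
    · have := H8 x a ha; omega
    · have := H8 y a ha; omega
    · have := H8 z a ha; omega
  have h6 := Finset.card_le_univ ((tr x ∪ tr y ∪ tr z) ∪ (univ.filter fun a => |W h' a| = 6))
  rw [Finset.card_union_of_disjoint h5, c', card_V] at h6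
  omega

theorem Compat.deg_two {h h' : V 4 → ZMod 2} (H : Compat h h') (he : Even (wt h)) :
    Deg 2 h := by
  refine deg_of_moments ((wt_even_iff h).1 he) fun i => ?_
  by_contra hi
  have hi' : ∑ x, h x * (1 + x i) ≠ 0 := by
    simp only [mul_add, mul_one, Finset.sum_add_distrib, (wt_even_iff h).1 he, zero_add]
    exact hi
  have hm := W_neighbour_mod (f := h) i
  simp only [hi', if_false] at hm
  have m := W_mod_four (by norm_num) h
  simp only [he, if_true] at m
  have z4 : (0 : V 4) ∈ D4 := by decide
  have i4 : ∀ i, ee 4 i ∈ D4 := by decide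
  have i0 : ∀ i, ee 4 i ≠ 0 := by decide
  have b8 : ∀ a, |W h a| ≤ 8 := by
    intro a
    have h1 := H a a (by rwa [v_add_self])
    have := m a
    have := abs_nonneg (W h' a)
    rcases abs_cases (W h a) with h2 | h2 <;> omega
  -- in each pair of neighbours exactly one coefficient is `±4`
  have nb : ∀ a, |W h a| = 4 ∧ |W h (a + ee 4 i)| ≠ 4 ∨ |W h a| ≠ 4 ∧ |W h (a + ee 4 i)| = 4 := by
    intro a
    have := hm a
    have := m a
    have := m (a + ee 4 i)
    have := b8 a
    have := b8 (a + ee 4 i)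
    rcases abs_cases (W h a) with h2 | h2 <;>
      rcases abs_cases (W h (a + ee 4 i)) with h3 | h3 <;> omega
  have val : ∀ a, |W h a| = 0 ∨ |W h a| = 4 ∨ |W h a| = 8 := by
    intro a
    have := m a
    have := b8 a
    rcases abs_cases (W h a) with h2 | h2 <;> omega
  set N := univ.filter fun a => |W h a| = 4 with hN
  have cN : N.card = 8 := by
    have e1 : N.card = Nᶜ.card := by
      refine Finset.card_bij (fun a _ => a + ee 4 i) ?_ ?_ ?_
      · intro a ha
        simp only [hN, Finset.mem_compl, Finset.mem_filter, Finset.mem_univ, true_and] at *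
        have := nb a
        omega
      · intro a _ b _ hab
        exact add_right_cancel hab
      · intro b hb
        refine ⟨b + ee 4 i, ?_, v_add_add _ _⟩
        simp only [hN, Finset.mem_compl, Finset.mem_filter, Finset.mem_univ, true_and] at *
        have := nb b
        omega
    have e2 := Finset.card_add_card_compl N
    rw [card_V] at e2
    omega
  set E := univ.filter fun a => |W h a| = 8 with hE
  have cE : E.card = 2 := by
    have h1 := parseval h
    have h2 : ∀ a, W h a ^ 2 = (if |W h a| = 4 then 16 else 0) + if |W h a| = 8 then 64 else 0 := by
      intro a
      rw [← sq_abs]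
      rcases val a with h | h | h <;> rw [h] <;> norm_num
    rw [Finset.sum_congr rfl fun a _ => h2 a, Finset.sum_add_distrib, ← Finset.sum_filter,
      ← Finset.sum_filter, Finset.sum_const, Finset.sum_const, cN, ← hE] at h1
    simp only [nsmul_eq_mul] at h1
    norm_num at h1
    omega
  set Z := univ.filter fun a => |W h a| = 0 with hZ
  have cZ : Z.card = 6 := by
    have h1 : (N ∪ E)ᶜ = Z := by
      ext a
      simp only [hN, hE, hZ, Finset.mem_compl, Finset.mem_union, Finset.mem_filter,
        Finset.mem_univ, true_and]
      have := val a
      omega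
    have h2 : Disjoint N E := by
      rw [Finset.disjoint_left]
      intro a
      simp only [hN, hE, Finset.mem_filter, Finset.mem_univ, true_and]
      omega
    have := Finset.card_add_card_compl (N ∪ E)
    rw [h1, Finset.card_union_of_disjoint h2, cN, cE, card_V] at this
    omega
  obtain ⟨x, y, hxy, hE2⟩ := Finset.card_eq_two.1 cE
  have hx : |W h x| = 8 := by
    have : x ∈ E := by rw [hE2]; simp
    simpa [hE] using this
  have hy : |W h y| = 8 := by
    have : y ∈ E := by rw [hE2]; simp
    simpa [hE] using this
  have hU : ∀ a ∈ tr x ∪ tr y, |W h' a| ≤ 2 := by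
    intro a ha
    simp only [Finset.mem_union, mem_tr] at ha
    rcases ha with ha | ha
    · have := H x a ha; omega
    · have := H y a ha; omega
  have cU := card_tr_union hxy
  have cUc : (tr x ∪ tr y)ᶜ.card = 6 := by
    have := Finset.card_add_card_compl (tr x ∪ tr y)
    rw [cU, card_V] at this
    omega
  have m' := W_mod_four (by norm_num) h'
  by_cases he' : Even (wt h')
  · simp only [he', if_true] at m'
    have hU0 : ∀ a ∈ tr x ∪ tr y, W h' a = 0 := by
      intro a ha
      have := hU a ha
      have := m' a
      rcases abs_cases (W h' a) with h2 | h2 <;> omega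
    have val' : ∀ a, |W h' a| = 0 ∨ |W h' a| = 4 ∨ |W h' a| = 8 := by
      intro a
      have h1 := H a a (by rwa [v_add_self])
      have := m' a
      have := abs_nonneg (W h a)
      rcases abs_cases (W h' a) with h2 | h2 <;> omega
    set E' := univ.filter fun a => |W h' a| = 8 with hE'
    have cE' : 3 ≤ E'.card := by
      have h1 := parseval h'
      have h2 : ∀ a, W h' a ^ 2 ≤ (if a ∈ (tr x ∪ tr y)ᶜ then 16 else 0) +
          if |W h' a| = 8 then 48 else 0 := by
        intro a
        rw [← sq_abs]
        by_cases ha : a ∈ tr x ∪ tr y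
        · rw [hU0 a ha]; norm_num; split_ifs <;> norm_num
        · simp only [Finset.mem_compl, ha, not_false_eq_true, if_true]
          rcases val' a with h | h | h <;> rw [h] <;> norm_num
      have h3 := Finset.sum_le_sum fun a (_ : a ∈ univ) => h2 a
      rw [h1, Finset.sum_add_distrib, ← Finset.sum_filter, ← Finset.sum_filter,
        Finset.filter_mem_eq_inter, Finset.univ_inter, Finset.sum_const, Finset.sum_const,
        cUc, ← hE'] at h3
      simp only [nsmul_eq_mul] at h3
      norm_num at h3
      omega
    obtain ⟨p, q, r, hp, hq, hr, h1, h2, h3⟩ := Finset.two_lt_card_iff.1 cE'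
    have h4 := card_tr_union_three h1 h2 h3
    have h5 : tr p ∪ tr q ∪ tr r ⊆ Z := by
      intro a ha
      simp only [Finset.mem_union, mem_tr, hZ, hE', Finset.mem_filter, Finset.mem_univ,
        true_and] at *
      have := val a
      rcases ha with (ha | ha) | ha
      · have := H.symm p a ha; omega
      · have := H.symm q a ha; omega
      · have := H.symm r a ha; omega
    have := Finset.card_le_card h5
    omega
  · simp only [he', if_false] at m'
    have val' : ∀ a, |W h' a| = 2 ∨ |W h' a| = 6 := by
      intro a
      have h1 := H.symm a a (by rw [v_add_self]; exact z4)
      have h2 := H.symm a (a + ee 4 i) (by rw [add_right_comm, v_add_self, zero_add]; exact i4 i)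
      have := m' a
      have := nb a
      have := val a
      have := val (a + ee 4 i)
      rcases abs_cases (W h' a) with h2 | h2 <;> omega
    have c6 := card_six val'
    have hX : (univ.filter fun a => |W h' a| = 6) = (tr x ∪ tr y)ᶜ := by
      refine Finset.eq_of_subset_of_card_le ?_ (by rw [c6, cUc])
      intro a ha
      simp only [Finset.mem_filter, Finset.mem_univ, true_and, Finset.mem_compl] at *
      intro hc
      have := hU a hc
      omega
    have hX' : ∀ a, |W h' a| = 6 ↔ a ∉ tr x ∪ tr y := by
      intro a
      have := Finset.ext_iff.1 hX a
      simpa only [Finset.mem_filter, Finset.mem_univ, true_and, Finset.mem_compl] using this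
    apply neighbour_count x y hxy i
    simp only [← hX']
    have hm' := W_neighbour_mod (f := h') i
    obtain ⟨τ, hτ, hτm⟩ : ∃ τ : ℤ, (τ = 1 ∨ τ = -1) ∧
        ∀ a, (W h' a + τ * W h' (a + ee 4 i)) % 8 = 4 := by
      by_cases hs : ∑ x, h' x * (1 + x i) = 0
      · simp only [hs, if_true] at hm'
        refine ⟨-1, Or.inr rfl, fun a => ?_⟩
        have := hm' a
        have := m' (a + ee 4 i)
        omega
      · simp only [hs, if_false] at hm'
        exact ⟨1, Or.inl rfl, fun a => by rw [one_mul]; exact hm' a⟩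
    have key : ∀ a, (W h' a + τ * W h' (a + ee 4 i)) ^ 2 =
        16 + if |W h' a| = 6 ∧ |W h' (a + ee 4 i)| = 6 then 128 else 0 := by
      intro a
      have h1 := hτm a
      have h2 : (W h' a + τ * W h' (a + ee 4 i)) = 4 ∨ (W h' a + τ * W h' (a + ee 4 i)) = -4 ∨
          (W h' a + τ * W h' (a + ee 4 i)) = 12 ∨ (W h' a + τ * W h' (a + ee 4 i)) = -12 := by
        rcases hτ with rfl | rfl <;> rcases val' a with h3 | h3 <;>
          rcases val' (a + ee 4 i) with h4 | h4 <;>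
          rcases abs_cases (W h' a) with h5 | h5 <;>
          rcases abs_cases (W h' (a + ee 4 i)) with h6 | h6 <;> omega
      have h7 : (|W h' a| = 6 ∧ |W h' (a + ee 4 i)| = 6) ↔
          ((W h' a + τ * W h' (a + ee 4 i)) = 12 ∨ (W h' a + τ * W h' (a + ee 4 i)) = -12) := by
        rcases hτ with rfl | rfl <;> rcases val' a with h3 | h3 <;>
          rcases val' (a + ee 4 i) with h4 | h4 <;>
          rcases abs_cases (W h' a) with h5 | h5 <;>
          rcases abs_cases (W h' (a + ee 4 i)) with h6 | h6 <;> omega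
      simp only [h7]
      rcases h2 with h | h | h | h <;> rw [h] <;> norm_num
    have h1 : ∑ a, (W h' a + τ * W h' (a + ee 4 i)) ^ 2 = 512 := by
      have hτ2 : τ ^ 2 = 1 := by rcases hτ with rfl | rfl <;> norm_num
      have : ∀ a, (W h' a + τ * W h' (a + ee 4 i)) ^ 2 = W h' a ^ 2 +
          W h' (a + ee 4 i) ^ 2 + 2 * τ * (W h' a * W h' (a + ee 4 i)) := by
        intro a
        linear_combination W h' (a + ee 4 i) ^ 2 * hτ2
      have hs : ∑ a, W h' (a + ee 4 i) ^ 2 = ∑ a, W h' a ^ 2 :=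
        Equiv.sum_comp (Equiv.addRight (ee 4 i)) (fun a => W h' a ^ 2)
      rw [Finset.sum_congr rfl fun a _ => this a, Finset.sum_add_distrib, Finset.sum_add_distrib,
        ← Finset.mul_sum, autocorr h' (i0 i),
        hs, parseval]
      norm_num
    rw [Finset.sum_congr rfl fun a _ => key a, Finset.sum_add_distrib, ← Finset.sum_filter,
      Finset.sum_const, Finset.sum_const] at h1
    simp only [Finset.card_univ, card_V, nsmul_eq_mul] at h1
    norm_num at h1
    omega

theorem t1_near : ∀ d ∈ D4, ∃ c : ZMod 2,
    wt (fun x : V 5 => t1 x + (1 + x 0) * (d ⬝ᵥ Matrix.vecTail x + c)) ≤ 6 := by decide +kernel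

theorem compat_of_far {g : V 5 → ZMod 2} (h : Far2 17 t1 g) : Compat (half 0 g) (half 1 g) := by
  intro x a hd
  obtain ⟨c, hc⟩ := t1_near _ hd
  set p : V 5 → ZMod 2 := fun y => (1 + y 0) * ((a + x) ⬝ᵥ Matrix.vecTail y + c) with hp
  have dp : Deg 2 p := ((Deg.const 1 1).add (deg_coord 0)).pmul ((deg_dot_add (a + x) c).comp aff_tail)
  have key : ∀ l, Deg 1 l → 11 ≤ wt (fun y => (g y + p y) + l y) := by
    intro l hl
    have := h p (fun y => p y + l y) dp (by
      convert hl using 2 with y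
      rw [← add_assoc, z2_add_self, zero_add])
    simp only [add_assoc] at this ⊢
    change wt (fun y => t1 y + p y) ≤ 6 at hc
    omega
  have hW := abs_W_le key
  have e0 : half 0 (fun y => g y + p y) = fun y => half 0 g y + ((a + x) ⬝ᵥ y + c) := by
    funext y; simp [half, hp]
  have e1 : half 1 (fun y => g y + p y) = half 1 g := by
    funext y; simp [half, hp, z2_add_self]
  have h0 := hW (Matrix.vecCons 0 a)
  have h1 := hW (Matrix.vecCons 1 a)
  rw [W_cons, e0, e1, W_add, ← add_assoc, v_add_self, zero_add] at h0 h1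
  simp only [sg_zero, sg_one] at h0 h1
  norm_num at h0 h1
  rcases sg_cases c with hs | hs <;> rw [hs] at h0 h1 <;>
    rcases abs_cases (W (half 0 g) x) with h2 | h2 <;>
    rcases abs_cases (W (half 1 g) a) with h3 | h3 <;>
    rw [abs_le] at h0 h1 <;> omega

theorem half_deg_two_of_far {g : V 5 → ZMod 2} (h : Far2 17 t1 g) : ∃ b, Deg 2 (half b g) := by
  have H := compat_of_far h
  rcases H.not_both_odd with he | he
  · exact ⟨0, H.deg_two he⟩
  · exact ⟨1, H.symm.deg_two he⟩

theorem t1_swap : ∀ (e : Fin 5) (x : V 5), t1 (x ∘ Equiv.swap 0 e) = t1 x := by decide +kernel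

theorem update_swap : ∀ (e : Fin 5) (b : ZMod 2) (x : V 5), Function.update x e b =
    (Matrix.vecCons b (Matrix.vecTail (x ∘ Equiv.swap 0 e)) : V 5) ∘ Equiv.swap 0 e := by
  decide +kernel

theorem aff_perm {n : ℕ} (σ : Equiv.Perm (Fin n)) : Aff (fun x : V n => x ∘ σ) := fun _ _ _ => rfl

theorem bij_perm {n : ℕ} (σ : Equiv.Perm (Fin n)) :
    Function.Bijective (fun x : V n => x ∘ σ) := by
  refine bij_of_inj fun x y h => ?_
  funext i
  have := congrFun h (σ.symm i)
  simpa using this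

theorem wt_mul_prod (c : ZMod 2) : wt (fun x : V 5 => c * ∏ i, x i) ≤ 1 := by
  revert c; decide +kernel

theorem t1_excluded {g : V 5 → ZMod 2} (h : Far2 17 t1 g) : False := by
  have hw : ∀ e : Fin 5, ∃ b, Deg 2 (fun x => g (Function.update x e b)) := by
    intro e
    have h1 := h.comp (aff_perm (Equiv.swap 0 e)) (bij_perm _)
    simp only [t1_swap] at h1
    obtain ⟨b, hb⟩ := half_deg_two_of_far h1
    refine ⟨b, ?_⟩
    simp only [update_swap]
    exact hb.comp (aff_tail.comp (aff_perm _))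
  choose w hw using hw
  have hu : ∀ (x : V 5) i, Function.update x i 0 + w = Function.update (x + w) i (w i) := by
    intro x i
    funext j
    by_cases hj : j = i
    · subst hj; simp
    · simp [hj]
  obtain ⟨c, hc⟩ := deg_of_update (f := fun x => g (x + w)) (k := 2) (fun i => by
    simp only [hu]
    exact (hw i).comp (aff_add_right v_add_self w))
  set Q : V 5 → ZMod 2 := fun x => g x + c * ∏ i, (x + w) i with hQ
  have dQ : Deg 2 Q := by
    have := hc.comp (aff_add_right v_add_self w)
    simpa only [v_add_add] using this
  obtain ⟨l, hl, hle⟩ := nl_five (fun x => t1 x + Q x)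
  have h1 := h (fun x => Q x + l x) Q (dQ.add (hl.mono (by norm_num))) (by
    convert hl using 2 with x
    rw [add_right_comm, z2_add_self, zero_add])
  have h2 : wt (fun x => g x + Q x) ≤ 1 := by
    have : (fun x => g x + Q x) = fun x => c * ∏ i, (x + w) i := by
      funext x; rw [hQ, ← add_assoc, z2_add_self, zero_add]
    rw [this]
    have := wt_comp (fun x : V 5 => c * ∏ i, x i)
      (bij_of_inj (n := 5) (ψ := fun x => x + w) fun x y hxy => add_right_cancel hxy)
    rw [this]
    exact wt_mul_prod c
  simp only [← add_assoc] at h1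
  omega

/-- A bent quadratic function in dimension four. -/
def b4 (x : V 4) : ZMod 2 :=
  1 + (x 0 * x 1 + x 0 * x 2 + x 0 * x 3 + x 1 * x 2 + x 1 * x 3 + x 2 * x 3)

theorem b4_deg : Deg 2 b4 :=
  deg_of_moments (by decide +kernel) (by decide +kernel)

theorem t2_eq : ∀ x, t2 x = (1 + x 0) * b4 (Matrix.vecTail x) := by decide +kernel

theorem t2_deg : Deg 3 t2 := by
  have := ((Deg.const 1 1).add (deg_coord (0 : Fin 5))).pmul (b4_deg.comp aff_tail)
  convert this using 1
  funext x
  exact t2_eq x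

theorem half_zero_t2 : half 0 t2 = b4 := by
  funext x; simp [half, t2_eq]

theorem half_one_t2 : half 1 t2 = fun _ => 0 := by
  funext x; simp [half, t2_eq, z2_add_self]

theorem t2_leader {g g' : V 5 → ZMod 2} (h : Far2 17 g g') (he : Even (wt g)) :
    ∃ (p : V 5 → ZMod 2) (Φ : V 5 → V 5), Deg 2 p ∧ Aff Φ ∧ Function.Bijective Φ ∧
      ∀ x, g (Φ x) + p x = t2 x := by
  have h5 : Far 5 g := Far2.far (m := 12) h fun p _ => by
    obtain ⟨l, hl, hle⟩ := nl_five (fun x => g' x + p x)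
    exact ⟨l, hl, by simpa only [add_assoc] using hle⟩
  obtain ⟨p, Φ, hp, a, b, h1 | h2⟩ := leader he h5
  · exfalso
    have := (h.comp a b).add hp
    simp only [h1] at this
    exact t1_excluded this
  · exact ⟨p, Φ, hp, a, b, h2⟩

theorem Far.extend {k : ℕ} {f : V 6 → ZMod 2} (h : Far k f) {ψ : V 5 → V 6} (a : Aff ψ)
    (i : Function.Injective ψ) : ∃ g', Far2 k (fun x => f (ψ x)) g' := by
  obtain ⟨Ψ, a', i', e⟩ := a.extend i (by norm_num)
  have := (h.comp a' (bij_of_inj i')).far2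
  refine ⟨half 1 fun x => f (Ψ x), ?_⟩
  convert this using 1
  funext x
  simp only [half, e]

theorem Far.deg_three_of_even {f : V 6 → ZMod 2} (h : Far 17 f) {ψ : V 5 → V 6} (a : Aff ψ)
    (i : Function.Injective ψ) (he : Even (wt fun x => f (ψ x))) : Deg 3 (fun x => f (ψ x)) := by
  obtain ⟨g', hg⟩ := h.extend a i
  obtain ⟨p, Φ, hp, aΦ, bΦ, e⟩ := t2_leader hg he
  obtain ⟨Φ', a', b', e1, e2⟩ := aΦ.inverse bΦ
  have := (t2_deg.add (hp.succ)).comp a'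
  convert this using 2 with x
  rw [← e, add_assoc, z2_add_self, add_zero, e2]

theorem even_hyperplane {n : ℕ} {f : V (n + 2) → ZMod 2} (he : Even (wt f)) :
    ∃ ψ : V (n + 1) → V (n + 2), Aff ψ ∧ Function.Injective ψ ∧
      (∀ x, ψ (Matrix.vecCons 0 x) = Matrix.vecCons 0 (Matrix.vecCons 0 x)) ∧
      Even (wt fun x => f (ψ x)) := by
  have i0 : Function.Injective (fun x : V (n + 1) => (Matrix.vecCons 0 x : V (n + 2))) := by
    intro x y hxy
    exact (Matrix.vecCons_inj.1 hxy).2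
  have a1 : Aff (fun x : V (n + 1) =>
      (Matrix.vecCons (x 0) (Matrix.vecCons 0 (Matrix.vecTail x)) : V (n + 2))) := by
    refine aff_pi fun i => ?_
    refine Fin.cases (aff_coord 0) (fun j => ?_) i
    refine Fin.cases (fun _ _ _ => by simp) (fun j => ?_) j
    exact aff_coord j.succ
  have i1 : Function.Injective (fun x : V (n + 1) =>
      (Matrix.vecCons (x 0) (Matrix.vecCons 0 (Matrix.vecTail x)) : V (n + 2))) := by
    intro x y hxy
    have h1 := Matrix.vecCons_inj.1 hxy
    have h2 := (Matrix.vecCons_inj.1 h1.2).2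
    rw [← cons_head_tail x, ← cons_head_tail y, h1.1, h2]
  have a2 : Aff (fun x : V (n + 1) => (Matrix.vecCons (x 0) x : V (n + 2))) := by
    refine aff_pi fun i => ?_
    refine Fin.cases (aff_coord 0) (fun j => ?_) i
    exact aff_coord j
  have i2 : Function.Injective (fun x : V (n + 1) => (Matrix.vecCons (x 0) x : V (n + 2))) := by
    intro x y hxy
    exact (Matrix.vecCons_inj.1 hxy).2
  by_cases h0 : Even (wt fun x : V (n + 1) => f (Matrix.vecCons 0 x))
  · exact ⟨_, aff_cons 0, i0, fun x => rfl, h0⟩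
  by_cases h1 : Even (wt fun x : V (n + 1) =>
      f (Matrix.vecCons (x 0) (Matrix.vecCons 0 (Matrix.vecTail x))))
  · exact ⟨_, a1, i1, fun x => by simp, h1⟩
  refine ⟨_, a2, i2, fun x => by simp, ?_⟩
  rw [wt_half] at he h0 h1 ⊢
  rw [wt_half (half 0 f), wt_half (half 1 f)] at he
  unfold half at *
  simp only [Matrix.cons_val_zero, Matrix.tail_cons] at *
  rw [Nat.even_iff] at *
  omega

theorem update_swap_six : ∀ (e : Fin 6) (b : ZMod 2) (x : V 6), Function.update x e b =
    (Matrix.vecCons b (Matrix.vecTail (x ∘ Equiv.swap 0 e)) : V 6) ∘ Equiv.swap 0 e := by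
  decide +kernel

/-- Indicator of a point. -/
def pt {n : ℕ} (c x : V n) : ZMod 2 := if x = c then 1 else 0

theorem prod_eq_pt {n : ℕ} (w x : V n) : ∏ i, (x + w) i = pt (w + 1) x := by
  unfold pt
  split_ifs with h
  · subst h
    refine Finset.prod_eq_one fun i _ => ?_
    simp only [Pi.add_apply, Pi.one_apply]
    rw [add_right_comm, z2_add_self, zero_add]
  · have : ∃ i, (x + w) i = 0 := by
      by_contra! hc
      apply h
      rw [add_comm w, ← v_add_eq_iff]
      exact funext fun i => (z2_cases _).resolve_left (hc i)
    obtain ⟨i, hi⟩ := this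
    exact Finset.prod_eq_zero (Finset.mem_univ i) hi

theorem Far.deg_three {f : V 6 → ZMod 2} (h : Far 17 f) (he : Even (wt f)) : Deg 3 f := by
  refine deg_of_inj_flats fun ψ a i => ?_
  obtain ⟨Ψ, a1, i1, e1⟩ := a.extend i (by norm_num)
  obtain ⟨Ξ, a2, i2, e2⟩ := a1.extend i1 (by norm_num)
  have hF := h.comp a2 (bij_of_inj i2)
  obtain ⟨χ, a3, i3, e3, he3⟩ := even_hyperplane (f := fun x => f (Ξ x)) (by
    rwa [wt_comp f (bij_of_inj i2)])
  have := ((hF.deg_three_of_even a3 i3 he3).half 0).sum_eq_zero (by norm_num)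
  simpa only [half, e3, e2, e1] using this

theorem Far.deg_three_odd {f : V 6 → ZMod 2} (h : Far 17 f) (ho : ¬ Even (wt f)) :
    ∃ c, Deg 3 (fun x => f x + pt c x) := by
  have hw : ∀ e : Fin 6, ∃ b, Deg 3 (fun x => f (Function.update x e b)) := by
    intro e
    have bσ := bij_perm (Equiv.swap 0 e)
    have aσ := aff_perm (Equiv.swap 0 e)
    have hi : ∀ b, Function.Injective
        (fun x : V 5 => (Matrix.vecCons b x : V 6) ∘ Equiv.swap 0 e) := fun b x y hxy =>
      (Matrix.vecCons_inj.1 (bσ.1 hxy)).2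
    have : ∃ b, Even (wt fun x : V 5 => f ((Matrix.vecCons b x : V 6) ∘ Equiv.swap 0 e)) := by
      by_contra! hc
      apply ho
      rw [← wt_comp f bσ, wt_half]
      have h0 := hc 0
      have h1 := hc 1
      unfold half
      beta_reduce
      rw [Nat.even_iff] at *
      omega
    obtain ⟨b, hb⟩ := this
    refine ⟨b, ?_⟩
    simp only [update_swap_six]
    have := h.deg_three_of_even (aσ.comp (aff_cons b)) (hi b) hb
    exact this.comp (aff_tail.comp (aff_perm _))
  choose w hw using hw
  have hu : ∀ (x : V 6) i, Function.update x i 0 + w = Function.update (x + w) i (w i) := by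
    intro x i
    funext j
    by_cases hj : j = i
    · subst hj; simp
    · simp [hj]
  obtain ⟨c, hc⟩ := deg_of_update (f := fun x => f (x + w)) (k := 3) (fun i => by
    simp only [hu]
    exact (hw i).comp (aff_add_right v_add_self w))
  have h2 := hc.comp (aff_add_right v_add_self w)
  simp only [v_add_add, prod_eq_pt] at h2
  refine ⟨w + 1, ?_⟩
  rcases z2_cases c with rfl | rfl
  · exact absurd ((by simpa using h2 : Deg 3 f).wt_even (by norm_num)) ho
  · simpa using h2

theorem wt_t1 : wt t1 = 6 := by decide +kernel
theorem wt_t2 : wt t2 = 6 := by decide +kernel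

theorem Far.not_nineteen {f : V 6 → ZMod 2} (h : Far 19 f) : False := by
  have : ∃ ψ : V 5 → V 6, Aff ψ ∧ Function.Injective ψ ∧ Even (wt fun x => f (ψ x)) := by
    by_cases he : Even (wt f)
    · obtain ⟨ψ, a, i, -, e⟩ := even_hyperplane he
      exact ⟨ψ, a, i, e⟩
    · rw [wt_half] at he
      have : Even (wt (half 0 f)) ∨ Even (wt (half 1 f)) := by
        rw [Nat.even_iff] at *
        rw [Nat.even_iff]
        omega
      rcases this with h | h
      · exact ⟨_, aff_cons 0, fun x y hxy => (Matrix.vecCons_inj.1 hxy).2, h⟩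
      · exact ⟨_, aff_cons 1, fun x y hxy => (Matrix.vecCons_inj.1 hxy).2, h⟩
  obtain ⟨ψ, a, i, e⟩ := this
  obtain ⟨g', hg⟩ := h.extend a i
  have h7 : Far 7 (fun x => f (ψ x)) := Far2.far (m := 12) hg fun p _ => by
    obtain ⟨l, hl, hle⟩ := nl_five (fun x => g' x + p x)
    exact ⟨l, hl, by simpa only [add_assoc] using hle⟩
  obtain ⟨p, Φ, hp, a, b, h1 | h1⟩ := leader e (h7.mono (by norm_num))
  · have := h7.comp a b p hp
    simp only [h1, wt_t1] at this
    omega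
  · have := h7.comp a b p hp
    simp only [h1, wt_t2] at this
    omega

theorem wt_dot_mod : ∀ a : V 6, wt (fun x : V 6 => a ⬝ᵥ x) % 32 = 0 := by decide +kernel

theorem wt_dot_mul_even {f : V 6 → ZMod 2} (hf : Deg 3 f) (a : V 6) :
    Even (wt fun x => f x * (a ⬝ᵥ x)) := (hf.pmul (deg_dot a)).wt_even (by norm_num)

theorem wt_dot_mul_add {f : V 6 → ZMod 2} (hf : Deg 3 f) (a b : V 6) :
    (wt (fun x => f x * ((a + b) ⬝ᵥ x)) : ℤ) % 4 =
      (wt (fun x => f x * (a ⬝ᵥ x)) + wt (fun x => f x * (b ⬝ᵥ x)) : ℤ) % 4 := by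
  have h := wt_add (fun x => f x * (a ⬝ᵥ x)) (fun x => f x * (b ⬝ᵥ x))
  have e1 : (fun x => f x * (a ⬝ᵥ x) + f x * (b ⬝ᵥ x)) = fun x => f x * ((a + b) ⬝ᵥ x) := by
    funext x; rw [add_dotProduct, mul_add]
  have e2 : (fun x => f x * (a ⬝ᵥ x) * (f x * (b ⬝ᵥ x))) =
      fun x => f x * (a ⬝ᵥ x) * (b ⬝ᵥ x) := by
    funext x
    have : ∀ u v w : ZMod 2, u * v * (u * w) = u * v * w := by decide
    exact this _ _ _
  have he := ((hf.pmul (deg_dot a)).pmul (deg_dot b)).wt_even (by norm_num)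
  rw [e1, e2] at h
  obtain ⟨m, hm⟩ := he
  omega

theorem exists_half_wt {f : V 6 → ZMod 2} (hf : Deg 3 f) :
    ∃ L : V 6 →+ ZMod 2, ∀ a, (L a).val = wt (fun x => f x * (a ⬝ᵥ x)) / 2 % 2 := by
  have key : ∀ u v w : ℕ, u % 2 = 0 → v % 2 = 0 → w % 2 = 0 → (w : ℤ) % 4 = (u + v : ℤ) % 4 →
      ((w / 2 : ℕ) : ZMod 2) = ((u / 2 : ℕ) : ZMod 2) + ((v / 2 : ℕ) : ZMod 2) := by
    intro u v w hu hv hw h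
    rw [← Nat.cast_add, ZMod.natCast_eq_natCast_iff']
    omega
  have hev := fun a => Nat.even_iff.1 (wt_dot_mul_even hf a)
  exact ⟨AddMonoidHom.mk' (fun a => ((wt (fun x => f x * (a ⬝ᵥ x)) / 2 : ℕ) : ZMod 2))
    fun a b => key _ _ _ (hev a) (hev b) (hev (a + b)) (wt_dot_mul_add hf a b),
    fun a => ZMod.val_natCast _ _⟩

/-- Walsh coefficients of a function of degree three modulo 16. -/
theorem deg_three_walsh {f : V 6 → ZMod 2} (hf : Deg 3 f) :
    ∃ c : V 6, ∀ a, (W f a + 2 * (wt f : ℤ)) % 16 = 8 * ((a ⬝ᵥ c).val : ℤ) := by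
  have hev := wt_dot_mul_even hf
  obtain ⟨L, hL⟩ := exists_half_wt hf
  refine ⟨fun i => L (Pi.single i 1), fun a => ?_⟩
  rw [dotProduct_comm, ← dot_single]
  have key : ∀ (w : ℤ) (u v x y : ℕ), u + 2 * y = v + x → w = 2 ^ 6 - 2 * (u : ℤ) → x % 32 = 0 →
      y % 2 = 0 → (w + 2 * (v : ℤ)) % 16 = 8 * ((y / 2 % 2 : ℕ) : ℤ) := by
    intro w u v x y h1 h2 h3 h4
    norm_num at h2
    omega
  rw [hL]
  exact key _ _ _ _ _ (wt_add f fun x => a ⬝ᵥ x) (W_eq_wt f a) (wt_dot_mod a)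
    (Nat.even_iff.1 (hev a))

theorem exists_affine_le_of_deg_three {f : V 6 → ZMod 2} (hf : Deg 3 f) (hw : wt f % 4 = 2) :
    ∃ l, Deg 1 l ∧ wt (fun x => f x + l x) ≤ 22 := by
  by_cases hex : ∃ a, 20 ≤ |W f a|
  · obtain ⟨a, ha⟩ := hex
    exact exists_affine_le f a (by norm_num; exact ha)
  exfalso
  push Not at hex
  obtain ⟨c, hc⟩ := deg_three_walsh hf
  obtain ⟨s, hs, hX⟩ : ∃ s : ℤ, (s = 1 ∨ s = -1) ∧
      ∀ a, W f a * sg (a ⬝ᵥ c) = 4 * s ∨ W f a * sg (a ⬝ᵥ c) = -12 * s := by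
    have h2 : ∀ a, (a ⬝ᵥ c = 0 ∧ sg (a ⬝ᵥ c) = 1 ∧ ((a ⬝ᵥ c).val : ℤ) = 0) ∨
        (a ⬝ᵥ c = 1 ∧ sg (a ⬝ᵥ c) = -1 ∧ ((a ⬝ᵥ c).val : ℤ) = 1) := by
      intro a
      rcases z2_cases (a ⬝ᵥ c) with h | h <;> rw [h] <;> decide
    by_cases h8 : wt f % 8 = 6
    · refine ⟨1, Or.inl rfl, fun a => ?_⟩
      have h1 := hc a
      have h3 := hex a
      rw [abs_lt] at h3
      rcases h2 a with ⟨-, h, h'⟩ | ⟨-, h, h'⟩ <;> rw [h] <;> rw [h'] at h1 <;> omega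
    · refine ⟨-1, Or.inr rfl, fun a => ?_⟩
      have h1 := hc a
      have h3 := hex a
      rw [abs_lt] at h3
      rcases h2 a with ⟨-, h, h'⟩ | ⟨-, h, h'⟩ <;> rw [h] <;> rw [h'] at h1 <;> omega
  have h1 := parseval f
  have h2 := inversion f c
  have key : ∀ a, W f a ^ 2 = 48 - 8 * s * (W f a * sg (a ⬝ᵥ c)) := by
    intro a
    have e : W f a ^ 2 = (W f a * sg (a ⬝ᵥ c)) ^ 2 := by
      rw [mul_pow, sq (sg _), sg_mul_self, mul_one]
    rw [e]
    rcases hX a with h | h <;> rw [h] <;> rcases hs with rfl | rfl <;> norm_num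
  rw [Finset.sum_congr rfl fun a _ => key a, Finset.sum_sub_distrib, ← Finset.mul_sum, h2] at h1
  simp only [Finset.sum_const, Finset.card_univ, card_V, nsmul_eq_mul] at h1
  rcases sg_cases (f c) with h | h <;> rw [h] at h1 <;> rcases hs with rfl | rfl <;> norm_num at h1

theorem W_zero_dvd {n : ℕ} (a : V n) : (2 : ℤ) ^ n ∣ W (fun _ => 0) a := by
  induction n with
  | zero => simp
  | succ n ih =>
    obtain ⟨b, c, rfl⟩ : ∃ b c, a = Matrix.vecCons b c := ⟨_, _, (cons_head_tail a).symm⟩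
    rw [W_cons]
    have e : ∀ d, half d (fun _ : V (n + 1) => (0 : ZMod 2)) = fun _ => 0 := fun _ => rfl
    obtain ⟨k, hk⟩ := ih c
    rw [e, e, hk]
    rcases sg_cases b with h | h <;> rw [h]
    · exact ⟨k, by ring⟩
    · exact ⟨0, by ring⟩

theorem sum_sg_deg_one {n : ℕ} {l : V n → ZMod 2} (h : Deg 1 l) : (2 : ℤ) ^ n ∣ ∑ x, sg (l x) := by
  obtain ⟨a, c, e⟩ := deg_one_form h
  have h1 : ∑ x, sg (l x) = sg c * W (fun _ => 0) a := by
    unfold W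
    rw [Finset.mul_sum]
    refine Finset.sum_congr rfl fun x _ => ?_
    rw [e, zero_add, ← sg_add, add_comm]
  rw [h1]
  exact (W_zero_dvd a).mul_left _

theorem wt_deg_two {n : ℕ} (hn : 5 ≤ n) {p : V n → ZMod 2} (hp : Deg 2 p) : wt p % 4 = 0 := by
  have h1 : (∑ x, sg (p x)) ^ 2 = ∑ a, ∑ x, sg (p (x + a) + p x) := by
    rw [sq, Finset.sum_mul_sum, Finset.sum_comm]
    rw [Finset.sum_comm (f := fun a x => sg (p (x + a) + p x))]
    refine Finset.sum_congr rfl fun x _ => ?_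
    rw [← Equiv.sum_comp (Equiv.addLeft x)]
    exact Finset.sum_congr rfl fun a _ => (sg_add _ _).symm
  have h2 : (32 : ℤ) ∣ (∑ x, sg (p x)) ^ 2 := by
    rw [h1]
    exact (pow_dvd_pow 2 hn).trans (Finset.dvd_sum fun a _ => sum_sg_deg_one (hp a))
  have h3 : (8 : ℤ) ∣ ∑ x, sg (p x) := by
    have h4 : (4 : ℤ) ∣ ∑ x, sg (p x) := by
      rw [← Int.pow_dvd_pow_iff (n := 2) (by norm_num)]
      exact Dvd.dvd.trans (by norm_num) h2
    obtain ⟨k, hk⟩ := h4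
    rw [hk] at h2 ⊢
    have h5 : (2 : ℤ) ∣ k ^ 2 := by
      rw [mul_pow] at h2
      omega
    obtain ⟨m, rfl⟩ := Int.prime_two.dvd_of_dvd_pow h5
    exact ⟨m, by ring⟩
  have h4 : ∑ x, sg (p x) = 2 ^ n - 2 * (wt p : ℤ) := by
    unfold wt
    simp only [sg_eq, Finset.sum_sub_distrib, ← Finset.mul_sum]
    push_cast
    simp
  have h5 : (8 : ℤ) ∣ 2 ^ n := (by norm_num : (8 : ℤ) ∣ 2 ^ 5).trans (pow_dvd_pow 2 hn)
  rw [h4] at h3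
  omega

theorem wt_add_deg_two {f p : V 6 → ZMod 2} (hf : Deg 3 f) (hp : Deg 2 p) :
    wt (fun x => f x + p x) % 4 = wt f % 4 := by
  have h1 := wt_add f p
  have h2 := wt_deg_two (by norm_num) hp
  have h3 := (hf.pmul hp).wt_even (by norm_num)
  rw [Nat.even_iff] at h3
  omega

theorem bent_pair {k m : V 4 → ZMod 2} (he : Even (wt k)) (e : V 4)
    (h12 : ∀ a b, |W k a| + |W m b| ≤ 12) (hmod : ∀ a b, (W k a + W m b) % 8 = 4)
    (hpt : ∀ a b, |W k a| + |W m b| = 12 → W k a * sg (a ⬝ᵥ e) = |W k a| * sg (k e)) : False := by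
  have mk := W_mod_four (by norm_num) k
  simp only [he, if_true] at mk
  obtain ⟨a0, ha0⟩ := exists_W_sq_ge k
  obtain ⟨b0, hb0⟩ := exists_W_sq_ge m
  have ha0 : (4 : ℤ) ≤ |W k a0| := abs_le_of_sq_le_sq' (by norm_num at ha0; rw [sq_abs]; exact ha0) (abs_nonneg _) |>.2
  have hb0 : (4 : ℤ) ≤ |W m b0| := abs_le_of_sq_le_sq' (by norm_num at hb0; rw [sq_abs]; exact hb0) (abs_nonneg _) |>.2
  have hin := inversion k e
  have hp := parseval k
  by_cases h4 : W k 0 % 8 = 4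
  · have hk : ∀ a, |W k a| = 4 ∧ |W m b0| = 8 := by
      intro a
      have h1 := hmod a b0
      have h2 := hmod 0 b0
      have h3 := h12 a b0
      rcases abs_cases (W k a) with h5 | h5 <;> rcases abs_cases (W m b0) with h6 | h6 <;> omega
    have key : ∀ a, W k a * sg (a ⬝ᵥ e) = 4 * sg (k e) := by
      intro a
      obtain ⟨h1, h2⟩ := hk a
      rw [hpt a b0 (by omega), h1]
    rw [Finset.sum_congr rfl fun a _ => key a] at hin
    simp only [Finset.sum_const, Finset.card_univ, card_V, nsmul_eq_mul] at hin
    rcases sg_cases (k e) with h | h <;> rw [h] at hin <;> norm_num at hin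
  · have hk : ∀ a, W k a = 0 ∨ |W k a| = 8 ∧ |W k a| + |W m b0| = 12 := by
      intro a
      have h1 := hmod a b0
      have h2 := hmod 0 b0
      have h3 := h12 a b0
      have h5 := mk 0
      rcases abs_cases (W k a) with h5 | h5 <;> rcases abs_cases (W m b0) with h6 | h6 <;> omega
    have key : ∀ a, W k a ^ 2 = 8 * sg (k e) * (W k a * sg (a ⬝ᵥ e)) := by
      intro a
      rcases hk a with h1 | ⟨h1, h2⟩
      · rw [h1]; norm_num
      · rw [hpt a b0 h2, h1, ← sq_abs, h1]
        linear_combination (-64) * sg_mul_self (k e)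
    rw [Finset.sum_congr rfl fun a _ => key a, ← Finset.mul_sum, hin] at hp
    rcases sg_cases (k e) with h | h <;> rw [h] at hp <;> norm_num at hp

theorem wt_add_pt {n : ℕ} (f : V n → ZMod 2) (c : V n) :
    wt (fun x => f x + pt c x) + 2 * (f c).val = wt f + 1 := by
  have h1 := wt_add f (pt c)
  have h2 : wt (fun x => f x * pt c x) = (f c).val := by
    unfold wt pt
    rw [Finset.sum_eq_single c]
    · simp
    · intro b _ hb; simp [hb]
    · simp
  have h3 : wt (pt c) = 1 := by
    unfold wt pt
    rw [Finset.sum_eq_single c]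
    · simp [ZMod.val_one]
    · intro b _ hb; simp [hb]
    · simp
  omega

theorem exists_sg_abs (w : ℤ) : ∃ c, sg c * w = |w| := by
  rcases abs_cases w with h | h
  · exact ⟨0, by rw [h.1]; simp⟩
  · exact ⟨1, by rw [h.1]; simp⟩

theorem bent_pair' {k m : V 4 → ZMod 2} (he : Even (wt k)) (e : V 4)
    (H : ∀ l l' : V 4 → ZMod 2, Deg 1 l → Deg 1 l' →
      (wt (fun x => k x + l x) + wt (fun x => m x + l' x)) % 4 = 2 ∧
      10 + 2 * (k e + l e).val ≤ wt (fun x => k x + l x) + wt (fun x => m x + l' x)) : False := by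
  have key : ∀ a b c c', (32 - sg c * W k a - sg c' * W m b) % 8 = 4 ∧
      20 + 4 * ((k e + (a ⬝ᵥ e + c)).val : ℤ) ≤ 32 - sg c * W k a - sg c' * W m b := by
    intro a b c c'
    obtain ⟨h1, h2⟩ := H _ _ (deg_dot_add a c) (deg_dot_add b c')
    have ar : ∀ (u v w : ℕ) (X Y : ℤ), 2 * (u : ℤ) = 2 ^ 4 - X → 2 * (v : ℤ) = 2 ^ 4 - Y →
        (u + v) % 4 = 2 → 10 + 2 * w ≤ u + v →
        (32 - X - Y) % 8 = 4 ∧ 20 + 4 * (w : ℤ) ≤ 32 - X - Y := by omega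
    exact ar _ _ _ _ _ (two_wt k a c) (two_wt m b c') h1 h2
  refine bent_pair (m := m) he e (fun a b => ?_) (fun a b => ?_) (fun a b hab => ?_)
  · obtain ⟨c, hc⟩ := exists_sg_abs (W k a)
    obtain ⟨c', hc'⟩ := exists_sg_abs (W m b)
    have := (key a b c c').2
    rw [hc, hc'] at this
    omega
  · have := (key a b 0 0).1
    simp only [sg_zero] at this
    omega
  · obtain ⟨c, hc⟩ := exists_sg_abs (W k a)
    obtain ⟨c', hc'⟩ := exists_sg_abs (W m b)
    have h1 := (key a b c c').2
    rw [hc, hc'] at h1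
    have h2 : k e + (a ⬝ᵥ e + c) = 0 := by
      rw [← ZMod.val_eq_zero]
      omega
    have h3 : k e = a ⬝ᵥ e + c := by
      have : ∀ u v : ZMod 2, u + v = 0 → u = v := by decide
      exact this _ _ h2
    rw [h3, sg_add, ← hc]
    linear_combination (-W k a * sg (a ⬝ᵥ e)) * sg_mul_self c

theorem b4_near : ∀ a : V 4, ∃ m : ZMod 2, wt (fun x => b4 x + (a ⬝ᵥ x + m)) = 6 := by
  decide +kernel

theorem b4_near' {l : V 4 → ZMod 2} (hl : Deg 1 l) : ∃ m : ZMod 2, wt (fun x => b4 x + (l x + m)) = 6 := by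
  obtain ⟨a, c, e⟩ := deg_one_form hl
  obtain ⟨m, hm⟩ := b4_near a
  refine ⟨m + c, ?_⟩
  rw [← hm]
  refine congrArg wt (funext fun x => ?_)
  rw [e]
  have : ∀ u v w : ZMod 2, u + v + (w + v) = u + w := by decide
  rw [this]

theorem wt_zero {A : Type*} [Fintype A] : wt (fun _ : A => (0 : ZMod 2)) = 0 := by simp [wt]

/-- Approximations of `glue t2 g` through its four quarters. -/
theorem quarters {g : V 5 → ZMod 2} {l l' : V 4 → ZMod 2} (hl : Deg 1 l) (hl' : Deg 1 l') :
    ∃ p q : V 5 → ZMod 2, Deg 2 p ∧ Deg 1 (fun x => p x + q x) ∧ wt (fun x => t2 x + p x) = 6 ∧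
      q = glue l l' ∧ wt (fun x => g x + q x) =
        wt (fun x => half 0 g x + l x) + wt (fun x => half 1 g x + l' x) := by
  obtain ⟨m, hm⟩ := b4_near' (hl.add hl')
  have d1 : Deg 1 (fun x => l x + l' x + m) := (hl.add hl').add (Deg.const _ _)
  refine ⟨glue (fun x => l x + l' x + m) (fun _ => 0), glue l l', ?_, ?_, ?_, rfl, ?_⟩
  · exact Deg.glue d1.succ (by simpa only [add_zero] using d1)
  · have d2 : Deg 1 (glue (fun x => l' x + m) l') :=
      Deg.glue (hl'.add (Deg.const _ _)) (by
        convert Deg.const (A := V 4) 0 m using 2 with x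
        rw [add_right_comm, z2_add_self, zero_add])
    convert d2 using 1
    funext x
    unfold glue
    have ar : ∀ u v w m : ZMod 2, u + v + m + w * (u + v + m + 0) + (u + w * (u + v)) =
        v + m + w * (v + m + v) := by decide
    exact ar _ _ _ _
  · have e0 : half 0 (fun x => t2 x + glue (fun x => l x + l' x + m) (fun _ => 0) x) =
        fun x => half 0 t2 x + half 0 (glue (fun x => l x + l' x + m) (fun _ => 0)) x := rfl
    have e1 : half 1 (fun x => t2 x + glue (fun x => l x + l' x + m) (fun _ => 0) x) =
        fun x => half 1 t2 x + half 1 (glue (fun x => l x + l' x + m) (fun _ => 0)) x := rfl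
    rw [wt_half, e0, e1, half_zero_t2, half_one_t2, half_glue_zero, half_glue_one]
    simp only [add_zero, wt_zero]
    exact hm
  · have e0 : half 0 (fun x => g x + glue l l' x) =
        fun x => half 0 g x + half 0 (glue l l') x := rfl
    have e1 : half 1 (fun x => g x + glue l l' x) =
        fun x => half 1 g x + half 1 (glue l l') x := rfl
    rw [wt_half, e0, e1, half_glue_zero, half_glue_one]

theorem wt_glue {n : ℕ} (f g : V n → ZMod 2) : wt (glue f g) = wt f + wt g := by
  rw [wt_half, half_glue_zero, half_glue_one]

theorem glue_add {n : ℕ} (f g p q : V n → ZMod 2) : (fun x => glue f g x + glue p q x) =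
    glue (fun x => f x + p x) (fun x => g x + q x) := by
  funext x
  unfold glue
  ring

theorem t2_point_excluded {g : V 5 → ZMod 2} {d : V 5} (h : Far2 17 t2 (fun x => g x + pt d x))
    (hg : Deg 3 (glue t2 g)) (hw : wt (glue t2 g) % 4 = 0) : False := by
  have hg' : Deg 3 g := by
    have := hg.half 1
    rwa [half_glue_one] at this
  have H : ∀ l l' : V 4 → ZMod 2, Deg 1 l → Deg 1 l' →
      (wt (fun x => half 0 g x + l x) + wt (fun x => half 1 g x + l' x)) % 4 = 2 ∧
      10 + 2 * (g d + glue l l' d).val ≤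
        wt (fun x => half 0 g x + l x) + wt (fun x => half 1 g x + l' x) := by
    intro l l' hl hl'
    obtain ⟨p, q, hp, hpq, h6, hq, hS⟩ := quarters (g := g) hl hl'
    have h1 := wt_add_deg_two hg (hp.glue hpq)
    rw [glue_add, wt_glue, h6, hw, hS] at h1
    have h2 := h p q hp hpq
    have h3 := wt_add_pt (fun x => g x + q x) d
    have e : (fun x => g x + q x + pt d x) = fun x => g x + pt d x + q x :=
      funext fun x => add_right_comm _ _ _
    rw [e, hS] at h3
    rw [h6] at h2
    rw [← hq]
    have ar : ∀ S w t : ℕ, (6 + S) % 4 = 0 → 17 ≤ 6 + t → t + 2 * w = S + 1 →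
        S % 4 = 2 ∧ 10 + 2 * w ≤ S := by omega
    exact ar _ _ _ h1 h2 h3
  have hd := cons_head_tail d
  rcases z2_cases (d 0) with h0 | h0
  · rw [h0] at hd
    refine bent_pair' ((hg'.half 0).wt_even (by norm_num)) (Matrix.vecTail d)
      (m := half 1 g) fun l l' hl hl' => ?_
    have := H l l' hl hl'
    convert this using 6
    · exact congrArg g hd
    · simp [glue, h0]
  · rw [h0] at hd
    refine bent_pair' ((hg'.half 1).wt_even (by norm_num)) (Matrix.vecTail d)
      (m := half 0 g) fun l l' hl hl' => ?_
    have := H l' l hl' hl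
    rw [add_comm (wt _)] 
    convert this using 6
    · exact congrArg g hd
    · simp [glue, h0, ← add_assoc, z2_add_self]

theorem pt_add {n : ℕ} (c w x : V n) : pt c (x + w) = pt (c + w) x := by
  unfold pt
  simp only [v_add_eq_iff]

theorem z2_add_add (a b : ZMod 2) : a + b + b = a := by
  rw [add_assoc, z2_add_self, add_zero]

theorem Far.odd_mod_four {f : V 6 → ZMod 2} {c : V 6} (h : Far 17 f)
    (hd : Deg 3 (fun x => f x + pt c x)) (hw : wt (fun x => f x + pt c x) % 4 = 0) : False := by
  set w : V 6 := c + ee 6 0 with hwd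
  have aw : Aff (fun x : V 6 => x + w) := aff_add_right v_add_self w
  have bw : Function.Bijective (fun x : V 6 => x + w) :=
    bij_of_inj fun x y hxy => add_right_cancel hxy
  set F : V 6 → ZMod 2 := fun x => f (x + w) + pt c (x + w) with hF
  have dF : Deg 3 F := hd.comp aw
  have wF : wt F % 4 = 0 := by
    rw [← hw]
    exact congrArg (· % 4) (wt_comp (fun x => f x + pt c x) bw)
  have eF : ∀ x, f (x + w) = F x + pt (ee 6 0) x := by
    intro x
    have e : c + w = ee 6 0 := by rw [hwd, ← add_assoc, v_add_self, zero_add]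
    rw [hF]
    simp only [pt_add, e, z2_add_add]
  have h2 := (h.comp aw bw).far2
  have e0 : half 0 (fun x => f (x + w)) = half 0 F := by
    funext x
    have : (Matrix.vecCons 0 x : V 6) ≠ ee 6 0 := fun hc => by
      have := congrFun hc 0
      simp [ee] at this
    simp only [half, eF, pt, this, if_false, add_zero]
  have e1 : half 1 (fun x => f (x + w)) = fun x => half 1 F x + pt 0 x := by
    funext x
    have : pt (ee 6 0) (Matrix.vecCons 1 x : V 6) = pt 0 x := by
      unfold pt
      rw [ee_zero]
      simp [Matrix.vecCons_inj]
    simp only [half, eF, this]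
  rw [e0, e1] at h2
  obtain ⟨p, Φ, hp, aΦ, bΦ, e⟩ := t2_leader h2 ((dF.half 0).wt_even (by norm_num))
  have h3 := (h2.comp aΦ bΦ).add hp
  simp only [e] at h3
  obtain ⟨d, hd0⟩ := bΦ.2 0
  have e3 : ∀ x, pt 0 (Φ x) = pt d x := by
    intro x
    unfold pt
    rw [← hd0]
    simp [bΦ.1.eq_iff]
  simp only [e3, add_right_comm _ (pt d _)] at h3
  have hgl : glue t2 (fun x => half 1 F (Φ x) + p x) =
      glue (fun x => half 0 F (Φ x) + p x) (fun x => half 1 F (Φ x) + p x) := by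
    rw [show t2 = fun x => half 0 F (Φ x) + p x from funext fun x => (e x).symm]
  have hd3 : Deg 3 (glue (fun x => half 0 F (Φ x)) fun x => half 1 F (Φ x)) :=
    ((dF.half 0).comp aΦ).glue (dF.half_add.comp aΦ)
  have hpp : Deg 2 (glue p p) := hp.glue (by
    simp only [z2_add_self]
    exact Deg.const _ _)
  refine t2_point_excluded h3 ?_ ?_
  · rw [hgl, ← glue_add]
    exact hd3.add hpp.succ
  · rw [hgl, ← glue_add, wt_add_deg_two hd3 hpp, wt_glue, wt_comp _ bΦ, wt_comp _ bΦ, ← wt_half, wF]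

theorem Far.near {f : V 6 → ZMod 2} (h : Far 17 f) {p : V 6 → ZMod 2} (hp : Deg 2 p) :
    ∃ l, Deg 1 l ∧ wt (fun x => f x + (p x + l x)) ≤ 23 ∧
      (Even (wt f) → wt (fun x => f x + (p x + l x)) ≤ 22) := by
  by_cases he : Even (wt f)
  · have d := h.deg_three he
    have : ¬ Far 19 f := fun h => h.not_nineteen
    unfold Far at this
    push Not at this
    obtain ⟨q, hq, hlt⟩ := this
    have h1 := wt_add_deg_two d hq
    have h2 := wt_add_deg_two d hp
    have h3 := h q hq
    have h4 := (wt_add_parity f hq (by norm_num)).2 he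
    rw [Nat.even_iff] at h4
    obtain ⟨l, hl, hle⟩ := exists_affine_le_of_deg_three (d.add hp.succ) (by omega)
    simp only [add_assoc] at hle
    exact ⟨l, hl, by omega, fun _ => hle⟩
  · obtain ⟨c, d⟩ := h.deg_three_odd he
    have h1 := h.odd_mod_four d
    have h2 := d.wt_even (by norm_num)
    have h3 := wt_add_deg_two d hp
    rw [Nat.even_iff] at h2
    have h5 : wt (fun x => f x + pt c x + p x) % 4 = 2 := by
      rw [h3]
      have ar : ∀ u : ℕ, ¬ u % 4 = 0 → u % 2 = 0 → u % 4 = 2 := by omega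
      exact ar _ h1 h2
    obtain ⟨l, hl, hle⟩ := exists_affine_le_of_deg_three (d.add hp.succ) h5
    have h4 := wt_add_pt (fun x => f x + pt c x + p x + l x) c
    have e : (fun x => f x + pt c x + p x + l x + pt c x) = fun x => f x + (p x + l x) := by
      funext x
      have : ∀ u v w t : ZMod 2, u + v + w + t + v = u + (w + t) := by decide
      exact this _ _ _ _
    rw [e] at h4
    exact ⟨l, hl, by omega, fun hc => absurd hc he⟩

theorem Far2.not_far {f g : V 6 → ZMod 2} (h : Far2 41 f g) : ¬ Far 17 f := by
  intro hf
  have h18 : Far 18 g := Far2.far (m := 23) h.symm fun p hp => by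
    obtain ⟨l, hl, hle, -⟩ := hf.near hp
    exact ⟨l, hl, hle⟩
  by_cases he : Even (wt g)
  · exact (Far2.far (k := 19) (m := 22) h fun p hp => by
      obtain ⟨l, hl, -, hle⟩ := (h18.mono (by norm_num)).near hp
      exact ⟨l, hl, hle he⟩).not_nineteen
  · refine Far.not_nineteen (f := g) fun p hp => ?_
    have h1 := h18 p hp
    have h2 := (wt_add_parity g hp (by norm_num)).not.2 he
    rw [Nat.even_iff] at h2
    omega

/-- Bent functions in six variables. -/
def Bent (f : V 6 → ZMod 2) : Prop := ∀ a, |W f a| = 8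

theorem bent_of_abs_le {f : V 6 → ZMod 2} (h : ∀ a, |W f a| ≤ 8) : Bent f :=
  abs_eq_of_sum_sq h (by rw [parseval]; norm_num)

theorem Bent.wt_cases {f : V 6 → ZMod 2} (h : Bent f) {l : V 6 → ZMod 2} (hl : Deg 1 l) :
    wt (fun x => f x + l x) = 28 ∨ wt (fun x => f x + l x) = 36 := by
  obtain ⟨a, c, e⟩ := deg_one_form hl
  have h1 := two_wt f a c
  have e' : (fun x => f x + l x) = fun x => f x + (a ⬝ᵥ x + c) := funext fun x => by rw [e]
  rw [e']
  have h2 := h a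
  have ar : ∀ (u : ℕ) (s w : ℤ), (s = 1 ∨ s = -1) → |w| = 8 → 2 * (u : ℤ) = 2 ^ 6 - s * w →
      u = 28 ∨ u = 36 := by
    intro u s w hs hw he
    rcases hs with rfl | rfl <;> rcases abs_cases w with h | h <;> omega
  exact ar _ _ _ (sg_cases c) h2 h1

theorem bent_of_wt {f : V 6 → ZMod 2}
    (h : ∀ l : V 6 → ZMod 2, Deg 1 l → 28 ≤ wt (fun x => f x + l x)) : Bent f :=
  bent_of_abs_le fun a => by
    have := abs_W_le h a
    norm_num at this
    exact this

theorem Bent.comp {f : V 6 → ZMod 2} (h : Bent f) {ψ : V 6 → V 6} (a : Aff ψ)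
    (b : Function.Bijective ψ) : Bent (fun x => f (ψ x)) := by
  obtain ⟨φ, h1, h2, h3, h4⟩ := a.inverse b
  refine bent_of_wt fun l hl => ?_
  have h5 := h.wt_cases (hl.comp h1)
  rw [← wt_comp _ b] at h5
  simp only [h3] at h5
  omega

theorem Bent.add {f : V 6 → ZMod 2} (h : Bent f) {l : V 6 → ZMod 2} (hl : Deg 1 l) :
    Bent (fun x => f x + l x) := by
  refine bent_of_wt fun m hm => ?_
  have := h.wt_cases (hl.add hm)
  simp only [add_assoc]
  omega

theorem Bent.quarter {f : V 6 → ZMod 2} (h : Bent f) : Even (wt (half 0 (half 0 f))) := by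
  have m := W_mod_four (by norm_num) (half 0 (half 0 f)) 0
  have key : ∀ b c, |W (half 0 (half 0 f)) 0 + sg c * W (half 1 (half 0 f)) 0 +
      sg b * (W (half 0 (half 1 f)) 0 + sg c * W (half 1 (half 1 f)) 0)| = 8 := by
    intro b c
    rw [← W_cons, ← W_cons, ← W_cons]
    exact h _
  have h1 := key 0 0
  have h2 := key 0 1
  have h3 := key 1 0
  have h4 := key 1 1
  simp only [sg_zero, sg_one] at h1 h2 h3 h4
  by_contra hc
  rw [if_neg hc] at m
  generalize W (half 0 (half 0 f)) 0 = u at *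
  generalize W (half 0 (half 1 f)) 0 = u at *
  generalize W (half 1 (half 0 f)) 0 = u at *
  generalize W (half 1 (half 1 f)) 0 = u at *
  rw [abs_eq (by norm_num)] at h1 h2 h3 h4
  omega

theorem Bent.deg_three {f : V 6 → ZMod 2} (h : Bent f) : Deg 3 f := by
  refine deg_of_inj_flats fun ψ a i => ?_
  obtain ⟨Ψ, a1, i1, e1⟩ := a.extend i (by norm_num)
  obtain ⟨Ξ, a2, i2, e2⟩ := a1.extend i1 (by norm_num)
  have := (wt_even_iff _).1 (h.comp a2 (bij_of_inj i2)).quarter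
  simpa only [half, e2, e1] using this

theorem Bent.wt_mod {f : V 6 → ZMod 2} (h : Bent f) : wt f % 4 = 0 := by
  have : wt f = 28 ∨ wt f = 36 := by
    have h1 := h.wt_cases (Deg.const 1 0)
    have e : (fun x : V 6 => f x + 0) = f := funext fun x => add_zero _
    rwa [e] at h1
  omega

theorem W_add_pt (f : V 6 → ZMod 2) (c a : V 6) :
    W (fun x => f x + pt c x) a = W f a - 2 * sg (f c + a ⬝ᵥ c) := by
  have h1 := W_eq_wt f a
  have h2 := W_eq_wt (fun x => f x + pt c x) a
  have h3 := wt_add_pt (fun x => f x + a ⬝ᵥ x) c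
  have e : (fun x => f x + pt c x + a ⬝ᵥ x) = fun x => f x + a ⬝ᵥ x + pt c x :=
    funext fun x => add_right_comm _ _ _
  rw [e] at h2
  rw [h1, h2, sg_eq]
  have ar : ∀ u v w : ℕ, u + 2 * w = v + 1 →
      (2 ^ 6 - 2 * (u : ℤ) = 2 ^ 6 - 2 * (v : ℤ) - 2 * (1 - 2 * (w : ℤ))) := by
    intro u v w h; norm_num; omega
  exact ar _ _ _ h3

theorem W_mod_eight {f : V 6 → ZMod 2} (h : ∀ a, Even (wt fun x => f x * (a ⬝ᵥ x))) (a : V 6) :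
    (W f a + 2 * (wt f : ℤ)) % 8 = 0 := by
  have ar : ∀ (w : ℤ) (u v x y : ℕ), u + 2 * y = v + x → w = 2 ^ 6 - 2 * (u : ℤ) → x % 32 = 0 →
      y % 2 = 0 → (w + 2 * (v : ℤ)) % 8 = 0 := by
    intro w u v x y h1 h2 h3 h4
    norm_num at h2
    omega
  exact ar _ _ _ _ _ (wt_add f fun x => a ⬝ᵥ x) (W_eq_wt f a) (wt_dot_mod a)
    (Nat.even_iff.1 (h a))

theorem exists_moment_point (f : V 6 → ZMod 2) :
    ∃ c, ∀ a, Even (wt fun x => (f x + pt c x) * (a ⬝ᵥ x)) := by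
  refine ⟨fun i => ∑ x, f x * x i, fun a => ?_⟩
  rw [wt_even_iff]
  simp only [add_mul, Finset.sum_add_distrib]
  have h1 : ∀ c : V 6, ∑ x, pt c x * (a ⬝ᵥ x) = a ⬝ᵥ c := by
    intro c
    rw [Finset.sum_eq_single c]
    · simp [pt]
    · intro b _ hb; simp [pt, hb]
    · simp
  rw [h1]
  simp only [dotProduct, Finset.mul_sum]
  rw [Finset.sum_comm, ← Finset.sum_add_distrib]
  refine Finset.sum_eq_zero fun i _ => ?_
  rw [← Finset.sum_add_distrib]
  refine Finset.sum_eq_zero fun x _ => ?_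
  rw [mul_left_comm, z2_add_self]

theorem bent_of_odd {f : V 6 → ZMod 2} (ho : ¬ Even (wt f)) (h : ∀ a, |W f a| ≤ 10) :
    ∃ c, Bent (fun x => f x + pt c x) := by
  obtain ⟨c, hc⟩ := exists_moment_point f
  refine ⟨c, ?_⟩
  have m8 := W_mod_eight hc
  have hW := W_add_pt f c
  have mf := fun a => W_mod_four (by norm_num) f a
  simp only [ho, if_false] at mf
  set b : V 6 → ZMod 2 := fun x => f x + pt c x with hb
  by_cases h4 : wt b % 4 = 0
  · refine bent_of_abs_le fun a => ?_
    have h1 := m8 a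
    have h2 := hW a
    have h3 := h a
    have ar : ∀ (u v s : ℤ) (w : ℕ), w % 4 = 0 → (u + 2 * (w : ℤ)) % 8 = 0 → u = v - 2 * s →
        |v| ≤ 10 → (s = 1 ∨ s = -1) → |u| ≤ 8 := by
      intro u v s w h1 h2 h3 h4 h5
      rw [abs_le] at *
      omega
    exact ar _ _ _ _ h4 h1 h2 h3 (sg_cases _)
  exfalso
  have h2 : wt b % 2 = 0 := by
    have h1 := wt_add_pt f c
    rw [Nat.even_iff] at ho
    have ar : ∀ u v w : ℕ, u + 2 * v = w + 1 → ¬ w % 2 = 0 → u % 2 = 0 := by omega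
    exact ar _ _ _ h1 ho
  have key : ∀ a, W b a ^ 2 ≤ 48 + 8 * (sg (b c) * (W b a * sg (a ⬝ᵥ c))) := by
    intro a
    have hs : sg (f c + a ⬝ᵥ c) = - (sg (b c) * sg (a ⬝ᵥ c)) := by
      rw [hb]
      simp only [pt, if_true, sg_add, sg_one]
      ring
    have h5 := hW a
    rw [hs] at h5
    have ar : ∀ (u v s t : ℤ) (w : ℕ), w % 2 = 0 → ¬ w % 4 = 0 → (u + 2 * (w : ℤ)) % 8 = 0 →
        u = v - 2 * (-(s * t)) → |v| ≤ 10 → (s = 1 ∨ s = -1) → (t = 1 ∨ t = -1) →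
        u ^ 2 ≤ 48 + 8 * (s * (u * t)) := by
      intro u v s t w h1 h2 h3 h4 h5 h6 h7
      rw [abs_le] at h5
      have : u = 4 ∨ u = -4 ∨ u = 12 ∨ u = -12 := by
        rcases h6 with rfl | rfl <;> rcases h7 with rfl | rfl <;> omega
      rcases this with rfl | rfl | rfl | rfl <;> rcases h6 with rfl | rfl <;>
        rcases h7 with rfl | rfl <;> omega
    exact ar _ _ _ _ _ h2 h4 (m8 a) h5 (h a) (sg_cases _) (sg_cases _)
  have h5 := Finset.sum_le_sum fun a (_ : a ∈ univ) => key a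
  rw [parseval, Finset.sum_add_distrib, ← Finset.mul_sum, ← Finset.mul_sum, inversion] at h5
  simp only [Finset.sum_const, Finset.card_univ, card_V, nsmul_eq_mul] at h5
  have := sg_mul_self (b c)
  rcases sg_cases (b c) with h | h <;> rw [h] at h5 <;> norm_num at h5

/-- If one function is close to degree two, the other is, up to one point, bent and far from degree two. -/
theorem Far2.bent {s f : V 6 → ZMod 2} (h : Far2 41 s f) (hs : wt s ≤ 14) :
    (wt s = 13 ∨ wt s = 14) ∧ ((Bent f ∧ Far 13 f) ∨
      (wt s = 14 ∧ ∃ c, Bent (fun x => f x + pt c x) ∧ Far 13 (fun x => f x + pt c x))) := by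
  have h1 : ∀ l, Deg 1 l → 41 ≤ wt s + wt (fun x => f x + l x) := by
    intro l hl
    have := h (fun _ => 0) l (Deg.const _ _) (by simpa only [zero_add] using hl)
    simpa only [add_zero] using this
  have h13 : Far 13 f := Far2.far (m := 28) h.symm fun p _ => by
    obtain ⟨l, hl, hle⟩ := nl_six (fun x => s x + p x)
    exact ⟨l, hl, by simpa only [add_assoc] using hle⟩
  have hW : ∀ a, |W f a| ≤ 10 := by
    intro a
    have := abs_W_le (f := f) (k := 27) (fun l hl => by have := h1 l hl; omega) a
    norm_num at this
    exact this
  obtain ⟨l, hl, hle⟩ := nl_six f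
  have hl1 := h1 l hl
  have m := fun a => W_mod_four (by norm_num) f a
  refine ⟨by omega, ?_⟩
  by_cases he : Even (wt f)
  · left
    refine ⟨bent_of_abs_le fun a => ?_, h13⟩
    have h2 := m a
    have h3 := hW a
    rw [if_pos he] at h2
    rcases abs_cases (W f a) with h4 | h4 <;> omega
  · right
    have h2 := (wt_add_parity f hl (by norm_num)).not.2 he
    rw [Nat.even_iff] at h2
    have h14 : wt s = 14 := by omega
    refine ⟨h14, ?_⟩
    obtain ⟨c, hc⟩ := bent_of_odd he hW
    refine ⟨c, hc, fun p hp => ?_⟩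
    by_contra! hlt
    have h3 := wt_add_pt (fun x => f x + p x) c
    have e : (fun x => f x + p x + pt c x) = fun x => f x + pt c x + p x :=
      funext fun x => add_right_comm _ _ _
    rw [e] at h3
    have h4 : wt (fun x => f x + p x) ≤ 13 := by
      have := (f c + p c).val_lt
      omega
    have hb : Bent (fun x => s x + p x) := bent_of_wt fun l hl => by
      have h5 := h (fun x => p x + l x) p (hp.add (hl.succ)) (by
        convert hl using 2 with x
        rw [add_right_comm, z2_add_self, zero_add])
      simp only [← add_assoc] at h5
      omega
    have h6 := hb.wt_mod
    have h7 := wt_add_deg_two hb.deg_three hp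
    simp only [z2_add_add] at h7
    rw [h6] at h7
    change wt s % 4 = 0 at h7
    omega

theorem wt_eq_card {A : Type*} [Fintype A] (f : A → ZMod 2) :
    wt f = #{x | f x = 1} := by
  rw [Finset.card_filter]
  refine Finset.sum_congr rfl fun x _ => ?_
  rcases z2_cases (f x) with h | h <;> rw [h] <;> rfl

theorem sum_support {A : Type*} [Fintype A] (f l : A → ZMod 2) :
    ∑ x with f x = 1, l x = ∑ x, f x * l x := by
  rw [Finset.sum_filter]
  refine Finset.sum_congr rfl fun x _ => ?_
  rcases z2_cases (f x) with h | h <;> rw [h] <;> simp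

/-- A small nonempty support of a cubic in five variables is a plane. -/
theorem plane_of_deg_three {s : V 5 → ZMod 2} (hd : Deg 3 s) (h0 : wt s ≠ 0) (h4 : wt s ≤ 4) :
    wt s = 4 ∧ ∃ a b c : V 5, a ≠ b ∧ a ≠ c ∧ b ≠ c ∧ ∀ x, s x = 1 → x = a ∨ x = b ∨ x = c ∨ x = a + b + c := by
  have hs : ∀ l : V 5 → ZMod 2, Deg 1 l → ∑ x with s x = 1, l x = 0 := by
    intro l hl
    rw [sum_support]
    exact (hd.pmul hl).sum_eq_zero (by norm_num)
  have he := hd.wt_even (by norm_num)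
  have hm : ∀ x, x ∈ ({x | s x = 1} : Finset (V 5)) ↔ s x = 1 := by simp
  rw [wt_eq_card] at h0 h4 he ⊢
  generalize ({x | s x = 1} : Finset (V 5)) = S at *
  have : #S = 2 ∨ #S = 4 := by
    rw [Nat.even_iff] at he
    omega
  rcases this with h | h
  · exfalso
    obtain ⟨a, b, hab, rfl⟩ := Finset.card_eq_two.1 h
    refine hab (funext fun i => ?_)
    have := hs _ (deg_coord i)
    rw [Finset.sum_pair hab] at this
    revert this
    generalize a i = u
    generalize b i = v
    revert u v
    decide
  · obtain ⟨a, b, c, d, hab, hac, had, hbc, hbd, hcd, rfl⟩ := Finset.card_eq_four.1 h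
    refine ⟨h, a, b, c, hab, hac, hbc, fun x hx => ?_⟩
    have hd : d = a + b + c := by
      funext i
      have := hs _ (deg_coord i)
      rw [Finset.sum_insert (by simp [hab, hac, had]), Finset.sum_insert (by simp [hbc, hbd]),
        Finset.sum_pair hcd] at this
      simp only [Pi.add_apply]
      revert this
      generalize a i = u
      generalize b i = v
      generalize c i = w
      generalize d i = z
      revert u v w z
      decide
    have := (hm x).2 hx
    simpa [hd] using this

theorem eq_of_support {A : Type*} [Fintype A] {f g : A → ZMod 2} (h : ∀ x, f x = 1 → g x = 1)
    (hw : wt g ≤ wt f) : f = g := by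
  rw [wt_eq_card, wt_eq_card] at hw
  have := Finset.eq_of_subset_of_card_le
    (Finset.monotone_filter_right univ (p := fun x => f x = 1) (q := fun x => g x = 1)
      fun x _ => h x) hw
  funext x
  have h2 : f x = 1 ↔ g x = 1 := by
    have := Finset.ext_iff.1 this x
    simpa using this
  rcases z2_cases (f x) with h3 | h3 <;> rcases z2_cases (g x) with h4 | h4
  · rw [h3, h4]
  · exact (h2.2 h4).trans h4.symm
  · exact h3.trans (h2.1 h3).symm
  · rw [h3, h4]

def planeMap (x : V 5) : V 5 := ![x 2 + 1, x 3 + 1, x 4 + 1, x 0, x 1]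

theorem planeMap_aff : Aff planeMap := aff_pi fun i => by
  intro x y z
  fin_cases i
  all_goals simp only [planeMap, Pi.add_apply]
  · exact (by decide : ∀ u v w : ZMod 2, u + v + w + 1 = u + 1 + (v + 1) + (w + 1)) _ _ _
  · exact (by decide : ∀ u v w : ZMod 2, u + v + w + 1 = u + 1 + (v + 1) + (w + 1)) _ _ _
  · exact (by decide : ∀ u v w : ZMod 2, u + v + w + 1 = u + 1 + (v + 1) + (w + 1)) _ _ _
  · rfl
  · rfl

theorem planeMap_bij : Function.Bijective planeMap := bij_of_inj (by
  intro x y h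
  have h0 := congrFun h 0
  have h1 := congrFun h 1
  have h2 := congrFun h 2
  have h3 := congrFun h 3
  have h4 := congrFun h 4
  simp [planeMap] at h0 h1 h2 h3 h4
  funext i
  fin_cases i <;> assumption)

theorem planeMap_prod : ∀ (x : V 5) (y : V 2), planeMap x = Matrix.vecCons 0 (Matrix.vecCons 0
    (Matrix.vecCons 0 y)) → x 2 * x 3 * x 4 = 1 := by decide +kernel

theorem wt_plane : wt (fun x : V 5 => x 2 * x 3 * x 4) = 4 := by decide +kernel

theorem flat_of_deg_three {s : V 5 → ZMod 2} (hd : Deg 3 s) (h0 : wt s ≠ 0) (h4 : wt s ≤ 4) :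
    ∃ Φ : V 5 → V 5, Aff Φ ∧ Function.Bijective Φ ∧ ∀ x, s (Φ x) = x 2 * x 3 * x 4 := by
  obtain ⟨hw, a, b, c, hab, hac, hbc, hS⟩ := plane_of_deg_three hd h0 h4
  obtain ⟨a0, i0, -⟩ := frame_zero (s := fun _ => 1) (v := a) rfl
  obtain ⟨ψ1, a1, i1, e1, e1'⟩ := a0.extendTo i0 (v := b) (fun _ => hab)
  have r1 : ∀ x : V 1, x = Matrix.vecCons 0 0 ∨ x = Matrix.vecCons 1 0 := by decide
  obtain ⟨ψ2, a2, i2, e2, e2'⟩ := a1.extendTo i1 (v := c) (fun x => by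
    rcases r1 x with rfl | rfl
    · rw [e1]; exact hac
    · rw [e1']; exact hbc)
  obtain ⟨ψ3, a3, i3, e3⟩ := a2.extend i2 (by norm_num)
  obtain ⟨ψ4, a4, i4, e4⟩ := a3.extend i3 (by norm_num)
  obtain ⟨ψ5, a5, i5, e5⟩ := a4.extend i4 (by norm_num)
  have hr : ∀ v, s v = 1 → ∃ y, ψ2 y = v := by
    intro v hv
    have ea : ψ2 (Matrix.vecCons 0 (Matrix.vecCons 0 0)) = a := by rw [e2, e1]
    have eb : ψ2 (Matrix.vecCons 0 (Matrix.vecCons 1 0)) = b := by rw [e2, e1']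
    rcases hS v hv with rfl | rfl | rfl | rfl
    · exact ⟨_, ea⟩
    · exact ⟨_, eb⟩
    · exact ⟨_, e2'⟩
    · exact ⟨_, (a2 (Matrix.vecCons 0 (Matrix.vecCons 0 0)) (Matrix.vecCons 0 (Matrix.vecCons 1 0))
        (Matrix.vecCons 1 0)).trans (by rw [ea, eb, e2'])⟩
  have a := a5.comp planeMap_aff
  have b := (bij_of_inj i5).comp planeMap_bij
  refine ⟨_, a, b, congrFun (eq_of_support (f := fun x => s (ψ5 (planeMap x))) ?_ ?_)⟩
  · intro x hx
    obtain ⟨y, hy⟩ := hr _ hx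
    refine planeMap_prod x y (i5 ?_)
    rw [e5, e4, e3, hy]
  · rw [wt_plane, ← hw]
    exact (wt_comp s b).ge

/-- Cubic functions of doubly even weight that are not close to degree two. -/
def Tame (b : V 6 → ZMod 2) : Prop := Deg 3 b ∧ wt b % 4 = 0 ∧ Far 13 b

/-- Affine equivalence modulo functions of degree at most two. -/
def Eqv {n : ℕ} (b b' : V n → ZMod 2) : Prop :=
  ∃ (Ξ : V n → V n) (p : V n → ZMod 2), Aff Ξ ∧ Function.Bijective Ξ ∧ Deg 2 p ∧
    ∀ x, b' x = b (Ξ x) + p x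

theorem aff_id {n : ℕ} : Aff (fun x : V n => x) := fun _ _ _ => rfl

theorem Eqv.trans {n : ℕ} {a b c : V n → ZMod 2} (h : Eqv a b) (h' : Eqv b c) : Eqv a c := by
  obtain ⟨Ξ, p, a1, b1, d1, e1⟩ := h
  obtain ⟨Θ, q, a2, b2, d2, e2⟩ := h'
  exact ⟨_, _, a1.comp a2, b1.comp b2, (d1.comp a2).add d2, fun x => by
    rw [e2, e1, add_assoc]⟩

theorem Eqv.of_comp {n : ℕ} (b : V n → ZMod 2) {Ξ : V n → V n} (a : Aff Ξ)
    (h : Function.Bijective Ξ) : Eqv b (fun x => b (Ξ x)) :=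
  ⟨Ξ, fun _ => 0, a, h, Deg.const _ _, fun _ => (add_zero _).symm⟩

theorem Eqv.tame {b b' : V 6 → ZMod 2} (h : Eqv b b') (t : Tame b) : Tame b' := by
  obtain ⟨Ξ, p, a, hb, d, e⟩ := h
  obtain ⟨t1, t2, t3⟩ := t
  obtain rfl : b' = fun x => b (Ξ x) + p x := funext e
  refine ⟨(t1.comp a).add d.succ, ?_, (t3.comp a hb).add d⟩
  rw [wt_add_deg_two (t1.comp a) d, wt_comp _ hb, t2]

theorem Eqv.of_flat (b : V 6 → ZMod 2) {ψ : V 5 → V 6} (a : Aff ψ) (i : Function.Injective ψ)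
    {p : V 5 → ZMod 2} (hp : Deg 2 p) : ∃ b', Eqv b b' ∧ ∀ x, half 0 b' x = b (ψ x) + p x := by
  obtain ⟨Ξ, a1, i1, e⟩ := a.extend i (by norm_num)
  refine ⟨_, ⟨Ξ, fun x => p (Matrix.vecTail x), a1, bij_of_inj i1, hp.comp aff_tail,
    fun _ => rfl⟩, fun x => ?_⟩
  simp only [half, e]
  rfl

theorem aff_zero_cons {n : ℕ} : Aff (fun x : V n => (Matrix.vecCons 0 x : V (n + 1))) := aff_cons 0

theorem inj_cons {n : ℕ} (c : ZMod 2) :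
    Function.Injective (fun x : V n => (Matrix.vecCons c x : V (n + 1))) := fun _ _ h =>
  congrArg Matrix.vecTail h

theorem half_t1_odd : wt (half 0 t1) = 5 := by decide +kernel

theorem t1_not_deg_three : ¬ Deg 3 t1 := fun h => by
  have := (h.half 0).wt_even (by norm_num)
  rw [half_t1_odd] at this
  exact absurd this (by decide)

theorem leader_deg_three {g : V 5 → ZMod 2} (hd : Deg 3 g) (hF : Far 5 g) : Eqv g t2 := by
  obtain ⟨p, Φ, hp, a, b, h | h⟩ := leader (hd.wt_even (by norm_num)) hF
  · exact absurd (by simpa only [h] using (hd.comp a).add hp.succ) t1_not_deg_three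
  · exact ⟨Φ, p, a, b, hp, fun x => (h x).symm⟩

/-- The hyperplane of `V 6` where the second coordinate is `1` or the complement of the first one. -/
def hyp (y : ZMod 2) (x : V 5) : V 6 :=
  Matrix.vecCons (x 0) (Matrix.vecCons (1 + x 0 * (1 + y)) (Matrix.vecTail x))

theorem hyp_aff : ∀ y, Aff (hyp y) := by
  intro y
  refine aff_pi fun i => ?_
  refine Fin.cases (aff_coord 0) (fun j => Fin.cases ?_ (fun k => aff_coord k.succ) j) i
  intro u v w
  simp only [hyp, Matrix.cons_val_succ, Matrix.cons_val_zero, Pi.add_apply]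
  generalize u 0 = a
  generalize v 0 = b
  generalize w 0 = c
  revert y a b c
  decide

theorem hyp_inj (y : ZMod 2) : Function.Injective (hyp y) := by
  intro u v h
  rw [← cons_head_tail u, ← cons_head_tail v]
  have h0 : u 0 = v 0 := congrFun h 0
  have h1 : (Matrix.vecTail u : V 4) = Matrix.vecTail v :=
    congrArg (fun z : V 6 => (Matrix.vecTail (Matrix.vecTail z) : V 4)) h
  rw [h0, h1]

theorem half_zero_hyp (f : V 6 → ZMod 2) (y : ZMod 2) (x : V 4) :
    half 0 (fun z => f (hyp y z)) x = half 1 (half 0 f) x := by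
  simp [half, hyp]

theorem half_one_hyp (f : V 6 → ZMod 2) (y : ZMod 2) (x : V 4) :
    half 1 (fun z => f (hyp y z)) x = half y (half 1 f) x := by
  simp [half, hyp, ← add_assoc, z2_add_self]

theorem exists_light_of_mod {k : V 4 → ZMod 2}
    (h : ∀ l : V 4 → ZMod 2, Deg 1 l → wt (fun x => k x + l x) % 4 = 0) :
    ∃ l, Deg 1 l ∧ wt (fun x => k x + l x) ≤ 4 := by
  obtain ⟨l, hl, hle⟩ := nl_four k
  have := h l hl
  exact ⟨l, hl, by omega⟩

theorem Tame.light_of_t2 {b : V 6 → ZMod 2} (h : Tame b) (e : half 0 b = t2) :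
    ∃ (ψ : V 5 → V 6) (p : V 5 → ZMod 2), Aff ψ ∧ Function.Injective ψ ∧ Deg 2 p ∧
      wt (fun x => b (ψ x) + p x) ≤ 4 := by
  have hm : ∀ l l' : V 4 → ZMod 2, Deg 1 l → Deg 1 l' →
      (wt (fun x => half 0 (half 1 b) x + l x) + wt (fun x => half 1 (half 1 b) x + l' x)) % 4 = 2 := by
    intro l l' hl hl'
    obtain ⟨p, q, hp, hpq, w1, -, w2⟩ := quarters (g := half 1 b) hl hl'
    have h1 := wt_add_deg_two h.1 (Deg.glue (k := 1) hp hpq)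
    have e2 : (fun x => b x + glue p q x) =
        glue (fun x => t2 x + p x) (fun x => half 1 b x + q x) := by
      rw [← e, ← glue_add, glue_half]
    rw [e2, wt_glue, w1, w2, h.2.1] at h1
    have ar : ∀ u v : ℕ, (6 + (u + v)) % 4 = 0 → (u + v) % 4 = 2 := by omega
    exact ar _ _ h1
  have z : Deg 1 (fun _ : V 4 => (0 : ZMod 2)) := Deg.const _ _
  have ev : ∀ c, Even (wt (half c (half 1 b))) := fun c =>
    ((h.1.half 1).half c).wt_even (by norm_num)
  have e0 := ev 0
  have e1 := ev 1
  rw [Nat.even_iff] at e0 e1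
  have m0 := hm _ _ z z
  simp only [add_zero] at m0
  change (wt (half 0 (half 1 b)) + wt (half 1 (half 1 b))) % 4 = 2 at m0
  have hk : ∃ y, ∃ l, Deg 1 l ∧ wt (fun x => half y (half 1 b) x + l x) ≤ 4 := by
    by_cases hc : wt (half 1 (half 1 b)) % 4 = 2
    · refine ⟨0, exists_light_of_mod fun l hl => ?_⟩
      have := hm l _ hl z
      simp only [add_zero] at this
      change (_ + wt (half 1 (half 1 b))) % 4 = 2 at this
      have ar : ∀ u v : ℕ, (u + v) % 4 = 2 → v % 4 = 2 → u % 4 = 0 := by omega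
      exact ar _ _ this hc
    · refine ⟨1, exists_light_of_mod fun l hl => ?_⟩
      have := hm _ l z hl
      simp only [add_zero] at this
      change (wt (half 0 (half 1 b)) + _) % 4 = 2 at this
      have ar : ∀ u v w : ℕ, (u + v) % 4 = 2 → (u + w) % 4 = 2 → u % 2 = 0 → w % 2 = 0 →
        ¬ w % 4 = 2 → v % 4 = 0 := by omega
      exact ar _ _ _ this m0 e0 e1 hc
  obtain ⟨y, l, hl, hle⟩ := hk
  refine ⟨hyp y, glue (fun _ => 0) l, hyp_aff y, hyp_inj y,
    Deg.glue (Deg.const _ _) (by simpa only [zero_add] using hl), ?_⟩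
  have s0 : half 0 (fun x => b (hyp y x) + glue (fun _ => 0) l x) = fun _ => 0 := by
    have : half 0 (fun x => b (hyp y x) + glue (fun _ => 0) l x) =
      fun x => half 0 (fun x => b (hyp y x)) x + half 0 (glue (fun _ => 0) l) x := rfl
    rw [this, half_glue_zero]
    funext x
    rw [half_zero_hyp, e, half_one_t2, add_zero]
  have s1 : half 1 (fun x => b (hyp y x) + glue (fun _ => 0) l x) =
      fun x => half y (half 1 b) x + l x := by
    have : half 1 (fun x => b (hyp y x) + glue (fun _ => 0) l x) =
      fun x => half 1 (fun x => b (hyp y x)) x + half 1 (glue (fun _ => 0) l) x := rfl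
    rw [this, half_glue_one]
    funext x
    rw [half_one_hyp]
  rw [wt_half, s0, s1, wt_zero, zero_add]
  exact hle

theorem Tame.light {b : V 6 → ZMod 2} (h : Tame b) : ∃ (ψ : V 5 → V 6) (p : V 5 → ZMod 2),
    Aff ψ ∧ Function.Injective ψ ∧ Deg 2 p ∧ wt (fun x => b (ψ x) + p x) ≤ 4 := by
  by_cases hF : Far 5 (half 0 b)
  · obtain ⟨Φ, p, a, i, hp, e⟩ := leader_deg_three (h.1.half 0) hF
    obtain ⟨b', hb, e'⟩ := Eqv.of_flat b (aff_zero_cons.comp a) ((inj_cons 0).comp i.1) hp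
    have e2 : half 0 b' = t2 := funext fun x => by rw [e', e]; rfl
    obtain ⟨ψ, q, a2, i2, hq, hle⟩ := (hb.tame h).light_of_t2 e2
    obtain ⟨Ξ, r, a3, i3, hr, e3⟩ := hb
    refine ⟨_, _, a3.comp a2, i3.1.comp i2, (hr.comp a2).add hq, ?_⟩
    simp only [e3, add_assoc] at hle
    exact hle
  · unfold Far at hF
    push Not at hF
    obtain ⟨p, hp, hlt⟩ := hF
    exact ⟨_, p, aff_zero_cons, inj_cons 0, hp, Nat.lt_succ_iff.1 hlt⟩

/-- A tame function is a plane on some hyperplane. -/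
theorem Tame.plane {b : V 6 → ZMod 2} (h : Tame b) :
    ∃ b', Eqv b b' ∧ half 0 b' = fun x => x 2 * x 3 * x 4 := by
  obtain ⟨ψ, p, a, i, hp, hle⟩ := h.light
  obtain ⟨b', hb, e⟩ := Eqv.of_flat b a i hp
  have ht := hb.tame h
  have e1 : half 0 b' = fun x => b (ψ x) + p x := funext e
  rw [← e1] at hle
  by_cases h0 : wt (half 0 b') = 0
  · exfalso
    obtain ⟨l, hl, hle⟩ := nl_five (half 1 b')
    have := ht.2.2.far2 (fun _ => 0) l (Deg.const _ _) (by simpa only [zero_add] using hl)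
    simp only [add_zero] at this
    change 13 ≤ wt (half 0 b') + _ at this
    have ar : ∀ u v : ℕ, v ≤ 12 → u = 0 → ¬ 13 ≤ u + v := by omega
    exact ar _ _ hle h0 this
  obtain ⟨Φ, a2, b2, e2⟩ := flat_of_deg_three (ht.1.half 0) h0 hle
  obtain ⟨b'', hb', e3⟩ := Eqv.of_flat b' (aff_zero_cons.comp a2) ((inj_cons 0).comp b2.1)
    (p := fun _ => 0) (Deg.const _ _)
  refine ⟨b'', hb.trans hb', funext fun x => ?_⟩
  rw [e3, add_zero, ← e2]
  rfl

/-- The pure quadratic form with coefficients `c`. -/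
def quad {n : ℕ} (c : Fin n → Fin n → ZMod 2) (x : V n) : ZMod 2 :=
  ∑ i, ∑ j, if i < j then c i j * (x i * x j) else 0

theorem quad_cons {n : ℕ} (c : Fin (n + 1) → Fin (n + 1) → ZMod 2) (x : V (n + 1)) :
    quad c x = x 0 * ((fun j => c 0 (Fin.succ j)) ⬝ᵥ Matrix.vecTail x) +
      quad (fun i j => c i.succ j.succ) (Matrix.vecTail x) := by
  unfold quad
  rw [Fin.sum_univ_succ]
  congr 1
  · rw [Fin.sum_univ_succ]
    simp only [lt_irrefl, if_false, zero_add, Fin.succ_pos, if_true, dotProduct, Finset.mul_sum]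
    exact Finset.sum_congr rfl fun j _ => mul_left_comm _ _ _
  · refine Finset.sum_congr rfl fun i _ => ?_
    rw [Fin.sum_univ_succ]
    simp only [Fin.not_lt_zero, if_false, zero_add, Fin.succ_lt_succ_iff]
    rfl

theorem exists_quad {n : ℕ} {p : V n → ZMod 2} (hp : Deg 2 p) :
    ∃ c, Deg 1 (fun x => p x + quad c x) := by
  induction n with
  | zero =>
    refine ⟨fun _ _ => 0, fun a b x => ?_⟩
    rw [Subsingleton.elim (x + b) x]
  | succ n ih =>
    obtain ⟨c, hc⟩ := ih (hp.half 0)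
    obtain ⟨a, e, h⟩ := deg_one_form hp.half_add
    let c' : Fin (n + 1) → Fin (n + 1) → ZMod 2 :=
      Fin.cons (Fin.cons 0 a) fun i => Fin.cons 0 (c i)
    refine ⟨c', ?_⟩
    have := (hc.comp aff_tail).add ((deg_coord (0 : Fin (n + 1))).pmul
      (Deg.const (A := V (n + 1)) 0 e))
    convert this using 2 with x
    rw [quad_cons]
    have h1 : p x = half 0 p (Matrix.vecTail x) + x 0 * (a ⬝ᵥ Matrix.vecTail x + e) := by
      rw [← h]
      exact (congrFun (glue_half p) x).symm
    rw [h1]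
    simp only [c', Fin.cons_zero, Fin.cons_succ]
    have ar : ∀ u v w z e : ZMod 2, u + w + z * e = u + z * (v + e) + (z * v + w) := by decide
    exact (ar _ _ _ _ _).symm

/-- A function with a derivative of degree one is close to degree two. -/
theorem Tame.deriv_not_deg_one {b : V 6 → ZMod 2} (h : Tame b) {e : V 6} (he : e ≠ 0)
    (hd : Deg 1 (fun x => b (x + e) + b x)) : False := by
  obtain ⟨a0, i0, -⟩ := frame_zero (s := fun _ => 1) (v := (0 : V 6)) rfl
  obtain ⟨ψ1, a1, i1, e1, e1'⟩ := a0.extendTo i0 (v := e) (fun _ => he.symm)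
  obtain ⟨ψ2, a2, i2, e2⟩ := a1.extend i1 (by norm_num)
  obtain ⟨ψ3, a3, i3, e3⟩ := a2.extend i2 (by norm_num)
  obtain ⟨ψ4, a4, i4, e4⟩ := a3.extend i3 (by norm_num)
  obtain ⟨ψ5, a5, i5, e5⟩ := a4.extend i4 (by norm_num)
  obtain ⟨ψ6, a6, i6, e6⟩ := a5.extend i5 (by norm_num)
  let σ : Equiv.Perm (Fin 6) := Equiv.swap 0 5
  have aσ : Aff (fun x : V 6 => ψ6 (x ∘ σ)) := a6.comp (aff_perm σ)
  have bσ := (bij_of_inj i6).comp (bij_perm σ)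
  have s0 : ((Matrix.vecCons 0 0 : V 6) ∘ σ) = Matrix.vecCons 0 (Matrix.vecCons 0 (Matrix.vecCons 0
    (Matrix.vecCons 0 (Matrix.vecCons 0 (Matrix.vecCons 0 0))))) := by decide
  have s1 : ((Matrix.vecCons 1 0 : V 6) ∘ σ) = Matrix.vecCons 0 (Matrix.vecCons 0 (Matrix.vecCons 0
    (Matrix.vecCons 0 (Matrix.vecCons 0 (Matrix.vecCons 1 0))))) := by decide
  have hs : ∀ x : V 5, ψ6 ((Matrix.vecCons 1 x : V 6) ∘ σ) =
      ψ6 ((Matrix.vecCons 0 x : V 6) ∘ σ) + e := by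
    intro x
    have h1 : (Matrix.vecCons 1 x : V 6) = Matrix.vecCons 0 x + Matrix.vecCons 1 0 +
        Matrix.vecCons 0 0 := by simp
    have h2 := aσ (Matrix.vecCons 0 x) (Matrix.vecCons 1 0) (Matrix.vecCons 0 0)
    simp only at h2
    rw [s0, s1] at h2
    rw [h1, h2, e6, e5, e4, e3, e2, e1', e6, e5, e4, e3, e2, e1, add_zero]
  have t : Tame (fun x => b (ψ6 (x ∘ σ))) := (Eqv.of_comp b aσ bσ).tame h
  set b' : V 6 → ZMod 2 := fun x => b (ψ6 (x ∘ σ)) with hb'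
  have hl : Deg 1 (fun x => half 0 b' x + half 1 b' x) := by
    have := hd.comp (aσ.comp (aff_cons 0))
    convert this using 2 with x
    simp only [half, hb', hs]
    rw [add_comm]
  have hn : ∃ p, Deg 2 p ∧ wt (fun x => half 0 b' x + p x) ≤ 6 := by
    by_cases hF : Far 5 (half 0 b')
    · obtain ⟨Φ, p, a, i, hp, e⟩ := leader_deg_three (t.1.half 0) hF
      obtain ⟨Θ, a', i', f1, f2⟩ := a.inverse i
      refine ⟨_, hp.comp a', ?_⟩
      have h1 := wt_comp t2 i'
      rw [wt_t2] at h1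
      have : (fun x => half 0 b' x + p (Θ x)) = fun x => t2 (Θ x) := by
        funext x
        rw [e, f2]
      rw [this, h1]
    · unfold Far at hF
      push Not at hF
      obtain ⟨p, hp, hlt⟩ := hF
      exact ⟨p, hp, by omega⟩
  obtain ⟨p, hp, hle⟩ := hn
  have h1 := t.2.2.far2 p (fun x => p x + (half 0 b' x + half 1 b' x)) hp (by
    convert hl using 2 with x
    rw [← add_assoc, z2_add_self, zero_add])
  have h2 : (fun x => half 1 b' x + (p x + (half 0 b' x + half 1 b' x))) =
      fun x => half 0 b' x + p x := by
    funext x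
    generalize half 0 b' x = u
    generalize half 1 b' x = v
    generalize p x = w
    revert u v w
    decide
  rw [h2] at h1
  have ar : ∀ u : ℕ, u ≤ 6 → ¬ 13 ≤ u + u := by omega
  exact ar _ hle h1

/-- The last three coordinates. -/
def tl (x : V 6) : V 3 := Matrix.vecTail (Matrix.vecTail (Matrix.vecTail x))

theorem tl_aff : Aff tl := fun _ _ _ => rfl

theorem prod_sum : ∀ κ : ZMod 2, ∑ z : V 3, z 0 * z 1 * z 2 * κ = κ := by decide +kernel

theorem Tame.split {b : V 6 → ZMod 2} (h : Tame b) (hP : half 0 b = fun x => x 2 * x 3 * x 4) :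
    ∃ q m m' : V 3 → ZMod 2, Deg 2 q ∧ Deg 1 m ∧ Deg 1 m' ∧
      ∀ x, b x = x 3 * x 4 * x 5 + x 0 * (q (tl x) + x 2 * m' (tl x) + x 1 * m (tl x)) := by
  set r : V 5 → ZMod 2 := fun x => half 0 b x + half 1 b x with hr
  have hdr : Deg 2 r := h.1.half_add
  have hb : ∀ x, b x = half 0 b (Matrix.vecTail x) + x 0 * r (Matrix.vecTail x) :=
    fun x => (congrFun (glue_half b) x).symm
  have hev : Even (wt fun x => half 0 b x * r x) := by
    have h1 := wt_add (half 0 b) r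
    have h2 : (fun x => half 0 b x + r x) = half 1 b := by
      funext x
      simp only [hr]
      rw [← add_assoc, z2_add_self, zero_add]
    have h3 := wt_half b
    have h4 := wt_deg_two le_rfl hdr
    have h5 := h.2.1
    have h6 : wt (half 0 b) = 4 := by rw [hP, wt_plane]
    rw [h2] at h1
    have ar : ∀ u v w x y : ℕ, v + 2 * w = u + x → y = u + v → x % 4 = 0 → y % 4 = 0 → u = 4 →
        w % 2 = 0 := by omega
    exact Nat.even_iff.2 (ar _ _ _ _ _ h1 h3 h4 h5 h6)
  set s : V 4 → ZMod 2 := fun x => half 0 r x + half 1 r x with hs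
  have hds : Deg 1 s := hdr.half_add
  have hr0 : ∀ x, r x = half 0 r (Matrix.vecTail x) + x 0 * s (Matrix.vecTail x) :=
    fun x => (congrFun (glue_half r) x).symm
  set t : V 3 → ZMod 2 := fun x => half 0 s x + half 1 s x with ht
  have hdt : Deg 0 t := hds.half_add
  have hs0 : ∀ x, s x = half 0 s (Matrix.vecTail x) + x 0 * t (Matrix.vecTail x) :=
    fun x => (congrFun (glue_half s) x).symm
  set u : V 3 → ZMod 2 := fun x => half 0 (half 0 r) x + half 1 (half 0 r) x with hu
  have hdu : Deg 1 u := (hdr.half 0).half_add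
  have hu0 : ∀ x, half 0 r x = half 0 (half 0 r) (Matrix.vecTail x) + x 0 * u (Matrix.vecTail x) :=
    fun x => (congrFun (glue_half (half 0 r)) x).symm
  have ht0 : ∀ x, t x = 0 := by
    have h1 := (wt_even_iff _).1 hev
    rw [sum_cons (n := 4), sum_cons (n := 3), sum_cons (n := 3), ← Finset.sum_add_distrib,
      ← Finset.sum_add_distrib, ← Finset.sum_add_distrib] at h1
    have h2 := prod_sum (t 0)
    have hp : ∀ (c d : ZMod 2) (z : V 3),
        half 0 b (Matrix.vecCons c (Matrix.vecCons d z)) = z 0 * z 1 * z 2 := by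
      intro c d z
      rw [hP]
      rfl
    have h3 : ∑ z : V 3, z 0 * z 1 * z 2 * t z = 0 := by
      rw [← h1]
      refine Finset.sum_congr rfl fun z _ => ?_
      rw [hp, hp, hp, hp]
      simp only [ht, hs, half]
      ring
    intro x
    rw [hdt.eq_const, ← h2, ← h3]
    exact Finset.sum_congr rfl fun z _ => by rw [hdt.eq_const z]
  refine ⟨half 0 (half 0 r), half 0 s, u, (hdr.half 0).half 0, hds.half 0, hdu, fun x => ?_⟩
  rw [hb, hP, hr0, hs0, hu0, ht0, mul_zero, add_zero]
  rfl

theorem Tame.dir {b : V 6 → ZMod 2} (h : Tame b) {q m m' : V 3 → ZMod 2} {a a' : V 3}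
    {c c' : ZMod 2} (hm : ∀ x, m x = a ⬝ᵥ x + c) (hm' : ∀ x, m' x = a' ⬝ᵥ x + c')
    (e : ∀ x, b x = x 3 * x 4 * x 5 + x 0 * (q (tl x) + x 2 * m' (tl x) + x 1 * m (tl x)))
    {u v : ZMod 2} (huv : u ≠ 0 ∨ v ≠ 0) (h0 : ∀ i, u * a i + v * a' i = 0) : False := by
  have hz : ∀ z, u * m z + v * m' z = u * c + v * c' := by
    intro z
    have : u * (a ⬝ᵥ z) + v * (a' ⬝ᵥ z) = 0 := by
      simp only [dotProduct, Finset.mul_sum, ← Finset.sum_add_distrib]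
      refine Finset.sum_eq_zero fun i _ => ?_
      rw [← mul_assoc, ← mul_assoc, ← add_mul, h0, zero_mul]
    rw [hm, hm']
    linear_combination this
  refine h.deriv_not_deg_one (e := ![0, u, v, 0, 0, 0]) ?_ ?_
  · intro h1
    rcases huv with hu | hv
    · exact hu (congrFun h1 1)
    · exact hv (congrFun h1 2)
  · have := (deg_coord (0 : Fin 6)).pmul (Deg.const (A := V 6) 0 (u * c + v * c'))
    convert this using 2 with x
    have ht : tl (x + ![0, u, v, 0, 0, 0]) = tl x := by
      funext i
      fin_cases i
      · exact add_zero (x 3)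
      · exact add_zero (x 4)
      · exact add_zero (x 5)
    have e0 : (x + ![0, u, v, 0, 0, 0]) 0 = x 0 := add_zero _
    have e1 : (x + ![0, u, v, 0, 0, 0]) 1 = x 1 + u := rfl
    have e2 : (x + ![0, u, v, 0, 0, 0]) 2 = x 2 + v := rfl
    have e3 : (x + ![0, u, v, 0, 0, 0]) 3 = x 3 := add_zero _
    have e4 : (x + ![0, u, v, 0, 0, 0]) 4 = x 4 := add_zero _
    have e5 : (x + ![0, u, v, 0, 0, 0]) 5 = x 5 := add_zero _
    rw [e, e, ht, e0, e1, e2, e3, e4, e5, ← hz (tl x)]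
    generalize m (tl x) = m1
    generalize m' (tl x) = m2
    generalize q (tl x) = q1
    linear_combination z2_add_self (x 3 * x 4 * x 5 + x 0 * (q1 + x 2 * m2 + x 1 * m1))

set_option synthInstance.maxSize 2000 in
set_option synthInstance.maxHeartbeats 400000 in
theorem exists_third : ∀ a a' : V 3, a ≠ 0 → a' ≠ 0 → a ≠ a' → ∃ i : Fin 3, ∀ z : V 3,
    a ⬝ᵥ z = 0 → a' ⬝ᵥ z = 0 → z i = 0 → z = 0 := by decide +kernel

theorem exists_coords {m m' : V 3 → ZMod 2} {a a' : V 3}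
    {c c' : ZMod 2} (hm : ∀ x, m x = a ⬝ᵥ x + c) (hm' : ∀ x, m' x = a' ⬝ᵥ x + c')
    (h1 : a ≠ 0) (h2 : a' ≠ 0) (h3 : a ≠ a') : ∃ B : V 3 → V 3, Aff B ∧ Function.Bijective B ∧
      (∀ z, m (B z) = z 0) ∧ ∀ z, m' (B z) = z 1 := by
  obtain ⟨i, hi⟩ := exists_third a a' h1 h2 h3
  have aA : Aff (fun z : V 3 => (![m z, m' z, z i] : V 3)) := by
    refine aff_pi fun j => ?_
    intro x y z
    fin_cases j
    · simp only [hm, dotProduct_add]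
      simp
      linear_combination -(z2_add_self c)
    · simp only [hm', dotProduct_add]
      simp
      linear_combination -(z2_add_self c')
    · rfl
  have iA : Function.Injective (fun z : V 3 => (![m z, m' z, z i] : V 3)) := by
    intro x y h
    have e0 : m x = m y := congrFun h 0
    have e1 : m' x = m' y := congrFun h 1
    have e2 : x i = y i := congrFun h 2
    rw [hm, hm] at e0
    rw [hm', hm'] at e1
    have := hi (x + y)
      (by rw [dotProduct_add]; linear_combination e0 + z2_add_self (a ⬝ᵥ y))
      (by rw [dotProduct_add]; linear_combination e1 + z2_add_self (a' ⬝ᵥ y))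
      (by rw [Pi.add_apply, e2, z2_add_self])
    rw [v_add_eq_iff, zero_add] at this
    exact this
  obtain ⟨B, b1, b2, -, b4⟩ := aA.inverse (bij_of_inj iA)
  exact ⟨B, b1, b2, fun z => congrFun (b4 z) 0, fun z => congrFun (b4 z) 1⟩

theorem prod_three_deg : Deg 3 (fun z : V 3 => z 0 * z 1 * z 2) :=
  ((deg_coord 0).pmul (deg_coord 1)).pmul (deg_coord 2)

theorem prod_comp_deg {B : V 3 → V 3} (b : Function.Bijective B) :
    Deg 2 (fun z => B z 0 * B z 1 * B z 2 + z 0 * z 1 * z 2) := by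
  obtain ⟨c, hc⟩ := b.2 1
  have h1 : ∀ z : V 3, z 0 * z 1 * z 2 = pt 1 z := by decide
  have h2 : ∀ c z : V 3, pt c z = pt 1 (z + (c + 1)) := by decide +kernel
  have h3 : ∀ z, pt 1 (B z) = pt c z := by
    intro z
    unfold pt
    rw [← hc]
    simp only [b.1.eq_iff]
  have := prod_three_deg (c + 1)
  convert this using 2 with z
  beta_reduce
  rw [h1 (B z), h1 z, h3, h1 (z + (c + 1)), h2 c]

/-- The cubic form in canonical position. -/
def t0 (x : V 6) : ZMod 2 := x 3 * x 4 * x 5 + x 0 * x 1 * x 3 + x 0 * x 2 * x 4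

/-- Up to affine equivalence and degree two there is only one tame function. -/
theorem Tame.eqv_t0 {b : V 6 → ZMod 2} (h : Tame b) : Eqv b t0 := by
  obtain ⟨b1, hb, hP⟩ := h.plane
  replace h := hb.tame h
  refine hb.trans ?_
  clear hb
  obtain ⟨q, m, m', hq, dm, dm', e⟩ := h.split hP
  obtain ⟨a, c, hm⟩ := deg_one_form dm
  obtain ⟨a', c', hm'⟩ := deg_one_form dm'
  have n1 : a ≠ 0 := fun h0 => h.dir hm hm' e (u := 1) (v := 0) (Or.inl one_ne_zero) fun i => by
    rw [h0]; simp
  have n2 : a' ≠ 0 := fun h0 => h.dir hm hm' e (u := 0) (v := 1) (Or.inr one_ne_zero) fun i => by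
    rw [h0]; simp
  have n3 : a ≠ a' := fun h0 => h.dir hm hm' e (u := 1) (v := 1) (Or.inl one_ne_zero) fun i => by
    rw [h0]; simp [z2_add_self]
  obtain ⟨B, aB, bB, B0, B1⟩ := exists_coords hm hm' n1 n2 n3
  obtain ⟨k, hk⟩ := exists_quad (hq.comp aB)
  have hquad : ∀ z, quad k z = k 0 1 * (z 0 * z 1) + k 0 2 * (z 0 * z 2) + k 1 2 * (z 1 * z 2) := by
    intro z
    simp [quad, Fin.sum_univ_succ]
  let Ξ : V 6 → V 6 := fun x => Matrix.vecCons (x 0) (Matrix.vecCons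
    (x 1 + (k 0 1 * tl x 1 + k 0 2 * tl x 2)) (Matrix.vecCons (x 2 + k 1 2 * tl x 2) (B (tl x))))
  have t3 : ∀ x, tl (Ξ x) = B (tl x) := fun x => rfl
  have aΞ : Aff Ξ := by
    refine aff_pi fun i => ?_
    refine Fin.cases (aff_coord 0) (fun i => Fin.cases ?_ (fun i => Fin.cases ?_ (fun i => ?_) i) i) i
    · intro x y z
      simp only [Ξ, Matrix.cons_val_succ, Matrix.cons_val_zero, tl_aff x y z, Pi.add_apply]
      ring
    · intro x y z
      simp only [Ξ, Matrix.cons_val_succ, Matrix.cons_val_zero, tl_aff x y z, Pi.add_apply]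
      ring
    · exact (aff_coord i).comp (aB.comp tl_aff)
  have iΞ : Function.Injective Ξ := by
    intro x y hxy
    have h3 : tl x = tl y := bB.1 (by rw [← t3, ← t3, hxy])
    have h0 : x 0 = y 0 := congrFun hxy 0
    have h1 : x 1 + _ = y 1 + _ := congrFun hxy 1
    have h2 : x 2 + _ = y 2 + _ := congrFun hxy 2
    rw [h3] at h1 h2
    have h1' := add_right_cancel h1
    have h2' := add_right_cancel h2
    funext i
    fin_cases i
    exacts [h0, h1', h2', congrFun h3 0, congrFun h3 1, congrFun h3 2]
  have d1 : Deg 2 (fun x : V 6 => B (tl x) 0 * B (tl x) 1 * B (tl x) 2 +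
    tl x 0 * tl x 1 * tl x 2) := (prod_comp_deg bB).comp tl_aff
  have d2 : Deg 2 (fun x : V 6 => x 0 * (q (B (tl x)) + quad k (tl x))) :=
    (deg_coord 0).pmul (hk.comp tl_aff)
  refine ⟨Ξ, _, aΞ, bij_of_inj iΞ, d1.add d2, fun x => ?_⟩
  have f0 : Ξ x 0 = x 0 := rfl
  have f1 : Ξ x 1 = x 1 + (k 0 1 * tl x 1 + k 0 2 * tl x 2) := rfl
  have f2 : Ξ x 2 = x 2 + k 1 2 * tl x 2 := rfl
  have f3 : Ξ x 3 = B (tl x) 0 := rfl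
  have f4 : Ξ x 4 = B (tl x) 1 := rfl
  have f5 : Ξ x 5 = B (tl x) 2 := rfl
  rw [e, t3, B0, B1, f0, f1, f2, f3, f4, f5, hquad]
  have g0 : x 3 = tl x 0 := rfl
  have g1 : x 4 = tl x 1 := rfl
  have g2 : x 5 = tl x 2 := rfl
  unfold t0
  rw [g0, g1, g2]
  generalize B (tl x) 0 = b0
  generalize B (tl x) 1 = b1
  generalize B (tl x) 2 = b2
  generalize q (B (tl x)) = q1
  generalize tl x 0 = z0
  generalize tl x 1 = z1
  generalize tl x 2 = z2
  linear_combination -(z2_add_self (b0 * b1 * b2)) - z2_add_self (x 0 * q1) -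
    z2_add_self (x 0 * (k 0 1 * z0 * z1 + k 0 2 * z0 * z2 + k 1 2 * z1 * z2))

/-- The cubic form `t0` plus a reduced quadratic part. -/
def tq (d : V 9) (x : V 6) : ZMod 2 :=
  t0 x + (d 0 * (x 0 * x 1) + d 1 * (x 0 * x 2) + d 2 * (x 0 * x 5) + d 3 * (x 1 * x 2) +
    d 4 * (x 1 * x 4) + d 5 * (x 1 * x 5) + d 6 * (x 2 * x 3) + d 7 * (x 2 * x 4) +
    d 8 * (x 2 * x 5))

/-- Booleans as elements of the field. -/
def zb (b : Bool) : ZMod 2 := if b then 1 else 0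

theorem zb_xor : ∀ a b, zb (a ^^ b) = zb a + zb b := by decide
theorem zb_and : ∀ a b, zb (a && b) = zb a * zb b := by decide
theorem zb_val : ∀ a, (zb a).val = a.toNat := by decide

theorem exists_zb (a : ZMod 2) : ∃ b, a = zb b := by revert a; decide

/-- Summation over the two booleans. -/
def sb (g : Bool → ℕ) : ℕ := g false + g true

theorem wt_six (f : V 6 → ZMod 2) : wt f = sb fun x0 => sb fun x1 => sb fun x2 => sb fun x3 =>
    sb fun x4 => sb fun x5 => (f ![zb x0, zb x1, zb x2, zb x3, zb x4, zb x5]).val := by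
  have h0 : zb false = 0 := rfl
  have h1 : zb true = 1 := rfl
  have h : ∀ g : V 0 → ℕ, ∑ x, g x = g ![] := fun g => by
    rw [Fintype.sum_unique]
    exact congrArg g (Subsingleton.elim _ _)
  unfold wt sb
  simp only [sum_cons, h, h0, h1]

/-- The truth table of `tq` plus a linear form. -/
def tb (d0 d1 d2 d3 d4 d5 d6 d7 d8 a0 a1 a2 a3 a4 a5 x0 x1 x2 x3 x4 x5 : Bool) : Bool :=
  ((x3 && x4 && x5) ^^ (x0 && x1 && x3) ^^ (x0 && x2 && x4)) ^^
    ((d0 && (x0 && x1)) ^^ (d1 && (x0 && x2)) ^^ (d2 && (x0 && x5)) ^^ (d3 && (x1 && x2)) ^^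
    (d4 && (x1 && x4)) ^^ (d5 && (x1 && x5)) ^^ (d6 && (x2 && x3)) ^^ (d7 && (x2 && x4)) ^^
    (d8 && (x2 && x5))) ^^
    ((a0 && x0) ^^ (a1 && x1) ^^ (a2 && x2) ^^ (a3 && x3) ^^ (a4 && x4) ^^ (a5 && x5))

theorem tb_bent : ∀ d0 d1 d2 d3 d4 d5 d6 d7 d8 : Bool, (∀ a0 a1 a2 a3 a4 a5 : Bool,
    (sb fun x0 => sb fun x1 => sb fun x2 => sb fun x3 => sb fun x4 => sb fun x5 =>
      (tb d0 d1 d2 d3 d4 d5 d6 d7 d8 a0 a1 a2 a3 a4 a5 x0 x1 x2 x3 x4 x5).toNat) ∈ [28, 36]) →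
    [d0, d1, d2, d3, d4, d5, d6, d7, d8] =
      [true, true, true, false, true, false, true, true, false] := by
  decide +kernel

theorem tq_bent (d : V 9) (h : Bent (tq d)) : d = ![1, 1, 1, 0, 1, 0, 1, 1, 0] := by
  choose D hD using fun i => exists_zb (d i)
  have h1 := tb_bent (D 0) (D 1) (D 2) (D 3) (D 4) (D 5) (D 6) (D 7) (D 8) (by
    intro a0 a1 a2 a3 a4 a5
    have h2 := h.wt_cases (deg_dot ![zb a0, zb a1, zb a2, zb a3, zb a4, zb a5])
    have e : ∀ x0 x1 x2 x3 x4 x5 : Bool, (tq d ![zb x0, zb x1, zb x2, zb x3, zb x4, zb x5] +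
        ![zb a0, zb a1, zb a2, zb a3, zb a4, zb a5] ⬝ᵥ
          ![zb x0, zb x1, zb x2, zb x3, zb x4, zb x5]).val =
        (tb (D 0) (D 1) (D 2) (D 3) (D 4) (D 5) (D 6) (D 7) (D 8) a0 a1 a2 a3 a4 a5
          x0 x1 x2 x3 x4 x5).toNat := by
      intro x0 x1 x2 x3 x4 x5
      rw [← zb_val]
      congr 1
      simp only [tb, zb_xor, zb_and, tq, t0, hD, dotProduct, Fin.sum_univ_six, Matrix.cons_val]
    rw [wt_six] at h2
    simp only [e] at h2
    rw [List.mem_cons, List.mem_singleton]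
    exact h2)
  simp only [List.cons.injEq, and_true] at h1
  obtain ⟨h0, h1, h2, h3, h4, h5, h6, h7, h8⟩ := h1
  funext i
  rw [hD]
  fin_cases i <;> simp [h0, h1, h2, h3, h4, h5, h6, h7, h8, zb]

/-- The inverse-like permutation of the three-dimensional space. -/
def pe (y : V 3) : V 3 :=
  ![y 0 * y 1 + y 0 + y 2, y 0 * y 2 + y 0 + y 1 + y 2, y 1 * y 2 + y 0]

/-- Joining two vectors of length three. -/
def jn (y x : V 3) : V 6 :=
  Matrix.vecCons (y 0) (Matrix.vecCons (y 1) (Matrix.vecCons (y 2) x))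

/-- The first three coordinates. -/
def hd3 (z : V 6) : V 3 := ![z 0, z 1, z 2]

/-- The canonical bent function. -/
def mm (z : V 6) : ZMod 2 := pe (hd3 z) ⬝ᵥ tl z

theorem quad_six (c : Fin 6 → Fin 6 → ZMod 2) (x : V 6) : quad c x =
    c 0 1 * (x 0 * x 1) + c 0 2 * (x 0 * x 2) + c 0 3 * (x 0 * x 3) + c 0 4 * (x 0 * x 4) +
    c 0 5 * (x 0 * x 5) + c 1 2 * (x 1 * x 2) + c 1 3 * (x 1 * x 3) + c 1 4 * (x 1 * x 4) +
    c 1 5 * (x 1 * x 5) + c 2 3 * (x 2 * x 3) + c 2 4 * (x 2 * x 4) + c 2 5 * (x 2 * x 5) +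
    c 3 4 * (x 3 * x 4) + c 3 5 * (x 3 * x 5) + c 4 5 * (x 4 * x 5) := by
  have h : ∀ i j : Fin 6, (i < j) = (i.val < j.val) := fun _ _ => rfl
  simp only [quad, Fin.sum_univ_six, h]
  norm_num
  ring

theorem quad_deg {n : ℕ} (c : Fin n → Fin n → ZMod 2) : Deg 2 (quad c) := by
  induction n with
  | zero =>
    intro a b d x
    rw [Subsingleton.elim (x + d) x]
  | succ n ih =>
    have h1 := (deg_coord (0 : Fin (n + 1))).pmul (((deg_dot (fun j => c 0 (Fin.succ j)))).comp
      aff_tail)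
    have h2 := h1.add ((ih fun i j => c i.succ j.succ).comp aff_tail)
    convert h2 using 2 with x
    exact quad_cons c x

theorem t0_add (w : V 6) : ∃ a : V 6, ∀ x, t0 (x + w) = t0 x + (w 5 * (x 3 * x 4) +
    w 4 * (x 3 * x 5) + w 3 * (x 4 * x 5) + w 3 * (x 0 * x 1) + w 1 * (x 0 * x 3) +
    w 0 * (x 1 * x 3) + w 4 * (x 0 * x 2) + w 2 * (x 0 * x 4) + w 0 * (x 2 * x 4)) +
    (a ⬝ᵥ x + t0 w) := by
  refine ⟨![w 1 * w 3 + w 2 * w 4, w 0 * w 3, w 0 * w 4, w 4 * w 5 + w 0 * w 1,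
    w 3 * w 5 + w 0 * w 2, w 3 * w 4], fun x => ?_⟩
  have : ∀ a : V 6, a ⬝ᵥ x = a 0 * x 0 + a 1 * x 1 + a 2 * x 2 + a 3 * x 3 + a 4 * x 4 +
    a 5 * x 5 := fun a => Fin.sum_univ_six _
  rw [this]
  simp only [t0, Pi.add_apply, Matrix.cons_val]
  ring

/-- The affine map which translates and reorders the coordinates. -/
theorem mm_of_tq {f : V 6 → ZMod 2} {l : V 6 → ZMod 2} {w : V 6} (hl : Deg 1 l)
    (h : ∀ x, f (x + w) = tq ![1, 1, 1, 0, 1, 0, 1, 1, 0] x + l x) :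
    ∃ (φ : V 6 → V 6) (m : V 6 → ZMod 2), Aff φ ∧ Function.Bijective φ ∧ Deg 1 m ∧
      ∀ x, f (φ x) + m x = mm x := by
  have aτ : Aff (fun x : V 6 => (![x 0, x 3, x 4, x 1, x 2, x 5] : V 6)) :=
    fun x y z => funext fun i => by fin_cases i <;> rfl
  have iτ : Function.Injective (fun x : V 6 => (![x 0, x 3, x 4, x 1, x 2, x 5] : V 6)) := by
    intro x y h
    funext i
    fin_cases i
    exacts [congrFun h 0, congrFun h 3, congrFun h 4, congrFun h 1, congrFun h 2, congrFun h 5]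
  obtain ⟨φ, a, b, c, d⟩ := aτ.inverse (bij_of_inj iτ)
  have aw := aff_add_right (v_add_self (n := 6)) w
  have bw : Function.Injective (fun x : V 6 => x + w) := fun x y h => add_right_cancel h
  refine ⟨fun x => φ x + w, _, aw.comp a, (bij_of_inj bw).comp b, hl.comp a, fun x => ?_⟩
  rw [h, z2_add_add]
  obtain ⟨z, rfl⟩ : ∃ z : V 6, x = ![z 0, z 3, z 4, z 1, z 2, z 5] := ⟨φ x, (d x).symm⟩
  rw [c]
  have e : ∀ a b : V 3, a ⬝ᵥ b = a 0 * b 0 + a 1 * b 1 + a 2 * b 2 := fun a b =>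
    Fin.sum_univ_three _
  unfold mm tq t0
  rw [e]
  simp only [pe, hd3, tl, Matrix.cons_val, Matrix.vecTail, Function.comp]
  change _ = (z 0 * z 3 + z 0 + z 4) * z 1 + (z 0 * z 4 + z 0 + z 3 + z 4) * z 2 +
    (z 3 * z 4 + z 0) * z 5
  ring

/-- Up to affine equivalence there is only one bent function at distance `13` from degree two. -/
theorem Bent.canonical {b : V 6 → ZMod 2} (h : Bent b) (hf : Far 13 b) :
    ∃ (φ : V 6 → V 6) (m : V 6 → ZMod 2), Aff φ ∧ Function.Bijective φ ∧ Deg 1 m ∧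
      ∀ x, b (φ x) + m x = mm x := by
  obtain ⟨Ξ, p, aΞ, bΞ, dp, e⟩ := Tame.eqv_t0 ⟨h.deg_three, h.wt_mod, hf⟩
  obtain ⟨c, hc⟩ := exists_quad dp
  have e1 : ∀ x, b (Ξ x) + (p x + quad c x) = t0 x + quad c x := fun x => by
    rw [e]; ring
  obtain ⟨w, hw⟩ : ∃ w : V 6, w = ![c 1 3, c 0 3, c 0 4, c 4 5, c 3 5, c 3 4] := ⟨_, rfl⟩
  have w0 : w 0 = c 1 3 := by rw [hw]; rfl
  have w1 : w 1 = c 0 3 := by rw [hw]; rfl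
  have w2 : w 2 = c 0 4 := by rw [hw]; rfl
  have w3 : w 3 = c 4 5 := by rw [hw]; rfl
  have w4 : w 4 = c 3 5 := by rw [hw]; rfl
  have w5 : w 5 = c 3 4 := by rw [hw]; rfl
  obtain ⟨a, ha⟩ := t0_add w
  have d1 : Deg 1 (fun x => quad c (x + w) + quad c x) := quad_deg c w
  obtain ⟨d, hd⟩ : ∃ d : V 9, d = ![c 0 1 + c 4 5, c 0 2 + c 3 5, c 0 5, c 1 2, c 1 4, c 1 5, c 2 3,
    c 2 4 + c 1 3, c 2 5] := ⟨_, rfl⟩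
  have e2 : ∀ x, b (Ξ (x + w)) + (p (x + w) + quad c (x + w)) =
      tq d x + ((a ⬝ᵥ x + t0 w) + (quad c (x + w) + quad c x)) := by
    intro x
    rw [e1, ha]
    have : (w 5 * (x 3 * x 4) +
      w 4 * (x 3 * x 5) + w 3 * (x 4 * x 5) + w 3 * (x 0 * x 1) + w 1 * (x 0 * x 3) +
      w 0 * (x 1 * x 3) + w 4 * (x 0 * x 2) + w 2 * (x 0 * x 4) + w 0 * (x 2 * x 4)) + t0 x =
      tq d x + quad c x := by
      rw [w0, w1, w2, w3, w4, w5, quad_six, hd]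
      simp only [tq, Matrix.cons_val]
      linear_combination -(z2_add_self (c 0 1 * (x 0 * x 1))) - z2_add_self (c 0 2 * (x 0 * x 2)) -
        z2_add_self (c 0 5 * (x 0 * x 5)) - z2_add_self (c 1 2 * (x 1 * x 2)) -
        z2_add_self (c 1 4 * (x 1 * x 4)) - z2_add_self (c 1 5 * (x 1 * x 5)) -
        z2_add_self (c 2 3 * (x 2 * x 3)) - z2_add_self (c 2 4 * (x 2 * x 4)) -
        z2_add_self (c 2 5 * (x 2 * x 5))
    linear_combination this + z2_add_self (quad c (x + w)) - z2_add_self (quad c (x + w))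
  have aw := aff_add_right (v_add_self (n := 6)) w
  have bw : Function.Bijective (fun x : V 6 => x + w) := bij_of_inj fun x y h => add_right_cancel h
  have d2 : Deg 1 (fun x => (a ⬝ᵥ x + t0 w) + (quad c (x + w) + quad c x)) :=
    (deg_dot_add a _).add d1
  have hb : Bent (tq d) := by
    have := ((h.comp (aΞ.comp aw) (bΞ.comp bw)).add (hc.comp aw)).add d2
    convert this using 2 with x
    have := e2 x
    have h2 : tq d x = (b (Ξ (x + w)) + (p (x + w) + quad c (x + w))) +
      ((a ⬝ᵥ x + t0 w) + (quad c (x + w) + quad c x)) := by rw [e2, z2_add_add]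
    exact h2
  rw [tq_bent d hb] at e2
  have d3 := d2.add (hc.comp aw)
  obtain ⟨φ, m, f1, f2, f3, f4⟩ := mm_of_tq (f := fun x => b (Ξ x)) d3 (w := w) fun x => by
    have := e2 x
    have h3 := z2_add_self (p (x + w) + quad c (x + w))
    linear_combination this - h3
  exact ⟨_, m, aΞ.comp f1, bΞ.comp f2, f3, f4⟩

/-- The vector of binary digits. -/
def oct (d : ℕ) : V 3 := fun i => if d.testBit i then 1 else 0

/-- The number with given binary digits. -/
def num (y : V 3) : ℕ := (y 0).val + 2 * (y 1).val + 4 * (y 2).val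

/-- Digits of `n`, as vectors. -/
def dg (n k : ℕ) : V 3 := oct (n / 10 ^ k % 10)

/-- The affine map with digits `8`, `7`, `6`, `5` of `n` as coefficients. -/
def ov (n : ℕ) (y : V 3) : V 3 := fun i =>
  dg n 8 i + y 0 * dg n 7 i + y 1 * dg n 6 i + y 2 * dg n 5 i

/-- The plane through digits `2`, `1`, `0` of `n`. -/
def qd (n : ℕ) (y : V 3) : ZMod 2 :=
  if y = dg n 2 ∨ y = dg n 1 ∨ y = dg n 0 ∨ y = dg n 2 + dg n 1 + dg n 0 then 1 else 0

/-- Affine interpolations of `pe` at four points, shifted by digit `4`. -/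
def tab : List (List ℕ) :=
  [
  [63517123, 363527123, 563547123, 663577123, 50122145, 150132145, 450162145,
    550172145, 303141356, 203151356, 103161356, 3171356, 246014167, 46034167,
    646054167, 446074167, 666723246, 766733246, 66743246, 166753246, 447716257,
    747726257, 47756257, 347766257, 757515347, 557535347, 257545347, 57565347],
  [62005023, 262025023, 462045023, 662065023, 2300247, 102310247, 202320247,
    302330247, 40503067, 140513067, 440543067, 540553067, 56306045, 356336045,
    556356045, 656366045, 666722346, 766732346, 66742346, 166752346, 447717256,
    747727256, 47757256, 347767256, 757514357, 557534357, 257544357, 57564357],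
  [73304013, 373334013, 473344013, 773374013, 77101057, 177111057, 677161057,
    777171057, 40500367, 140510367, 440540367, 540550367, 56305046, 356335046,
    556355046, 656365046, 303143156, 203153156, 103163156, 3173156, 246016147,
    46036147, 646056147, 446076147, 757517345, 557537345, 257547345, 57567345],
  [72706012, 272726012, 572756012, 772776012, 77100157, 177110157, 677160157,
    777170157, 2302047, 102312047, 202322047, 302332047, 56304056, 356334056,
    556354056, 656364056, 50121245, 150131245, 450161245, 550171245, 246017146,
    46037146, 646057146, 446077146, 447715267, 747725267, 47755267, 347765267],
  [72701026, 272721026, 572751026, 772771026, 77107015, 177117015, 677167015,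
    777177015, 62000235, 262020235, 462040235, 662060235, 40506037, 140516037,
    440546037, 540556037, 63513127, 363523127, 563543127, 663573127, 303145136,
    203155136, 103165136, 3175136, 447712567, 747722567, 47752567, 347762567],
  [72700126, 272720126, 572750126, 772770126, 73303014, 373333014, 473343014,
    773373014, 2304027, 102314027, 202324027, 302334027, 40507036, 140517036,
    440547036, 540557036, 63512137, 363522137, 563542137, 663572137, 246011467,
    46031467, 646051467, 446071467, 666726234, 766736234, 66746234, 166756234],
  [73300134, 373330134, 473340134, 773370134, 77105017, 177115017, 677165017,
    777175017, 62002035, 262022035, 462042035, 662062035, 2307024, 102317024,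
    202327024, 302337024, 63511237, 363521237, 563541237, 663571237, 50124125,
    150134125, 450164125, 550174125, 757513457, 557533457, 257543457, 57563457],
  [72702016, 272722016, 572752016, 772772016, 73301034, 373331034, 473341034,
    773371034, 62003025, 262023025, 462043025, 662063025, 56300456, 356330456,
    556350456, 656360456, 50125124, 150135124, 450165124, 550175124, 303146135,
    203156135, 103166135, 3176135, 666724236, 766734236, 66744236, 166754236]]

/-- An entry of the table. -/
def op (c : V 3) (o : Fin 28) : ℕ := (tab.getD (num c) []).getD o 0

theorem op_sum : ∀ c o, dg (op c o) 2 + dg (op c o) 1 + dg (op c o) 0 = c := by decide +kernel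

set_option synthInstance.maxSize 2000 in
set_option synthInstance.maxHeartbeats 400000 in
theorem op_only : ∀ c o, ∀ y : V 3, pe y = ov (op c o) y + dg (op c o) 4 →
    ∃ k : Fin 4, y = dg (op c o) k := by decide +kernel

theorem op_card : ∀ c o, #{y | pe y ≠ ov (op c o) y + dg (op c o) 4} = 4 := by decide +kernel

set_option synthInstance.maxSize 2000 in
set_option synthInstance.maxHeartbeats 400000 in
theorem op_indep : ∀ c o, ∀ w : V 3, w ⬝ᵥ (dg (op c o) 2 + dg (op c o) 3) = 0 →
    w ⬝ᵥ (dg (op c o) 1 + dg (op c o) 3) = 0 → w ⬝ᵥ (dg (op c o) 0 + dg (op c o) 3) = 0 →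
    w = 0 := by decide +kernel

theorem qd_card : ∀ c o b, #{y | qd (op c o) y = b} = 4 := by decide +kernel

theorem qd_mul : ∀ c o, ∀ y, qd (op c o) y = pt c y + pt (dg (op c o) 2) y +
    pt (dg (op c o) 1) y + pt (dg (op c o) 0) y := by decide +kernel

theorem op_count : ∀ c y u, #{o | ov (op c o) y = u} = if u = 0 then 7 else 3 := by decide +kernel

theorem op_pair : ∀ c, ∀ z z' : V 3, ∃ o, ov (op c o) z = 0 ∧ ov (op c o) z' = 0 := by
  decide +kernel

/-- The deviation of the weight of `T + u` from `4`. -/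
def dev (T : V 3 → ZMod 2) (u : V 3) : ℕ := ((wt fun x => T x + u ⬝ᵥ x : ℤ) - 4).natAbs

/-- The function on `V 3` with given table. -/
def fn (t : V 8) (x : V 3) : ZMod 2 := t (Fin.ofNat 8 (num x))

theorem exists_fn (T : V 3 → ZMod 2) : ∃ t, T = fn t := by
  have h : ∀ x : V 3, oct (Fin.ofNat 8 (num x)).val = x := by decide
  exact ⟨fun i => T (oct i.val), funext fun x => by simp only [fn, h]⟩

theorem dev_fn : ∀ t : V 8, (wt (fn t) = 0 → 28 ≤ ∑ u, (if u = 0 then 7 else 3) * dev (fn t) u) ∧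
    (wt (fn t) ≠ 0 → 52 ≤ ∑ u, (if u = 0 then 7 else 3) * dev (fn t) u + 10 * wt (fn t)) := by
  decide +kernel

theorem dev_sum_ge (T : V 3 → ZMod 2) :
    (wt T = 0 → 28 ≤ ∑ u, (if u = 0 then 7 else 3) * dev T u) ∧
    (wt T ≠ 0 → 52 ≤ ∑ u, (if u = 0 then 7 else 3) * dev T u + 10 * wt T) := by
  obtain ⟨t, rfl⟩ := exists_fn T
  exact dev_fn t

theorem dev_op (T : V 3 → ZMod 2) (c y : V 3) :
    ∑ o, dev T (ov (op c o) y) = ∑ u, (if u = 0 then 7 else 3) * dev T u := by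
  rw [← Finset.sum_fiberwise' univ (fun o => ov (op c o) y) (dev T)]
  refine Finset.sum_congr rfl fun u _ => ?_
  rw [Finset.sum_const, op_count, smul_eq_mul]

theorem dev_zero {T : V 3 → ZMod 2} (h : wt T = 0) : dev T 0 = 4 := by
  unfold dev
  have : (fun x => T x + (0 : V 3) ⬝ᵥ x) = T := by
    funext x
    rw [zero_dotProduct, add_zero]
  rw [this, h]
  rfl

theorem wt_add_one (T : V 3 → ZMod 2) : wt (fun x => T x + 1) + wt T = 8 := by
  unfold wt
  rw [← Finset.sum_add_distrib]
  have : ∀ a : ZMod 2, (a + 1).val + a.val = 1 := by decide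
  simp only [this]
  simp

/-- The constant which makes the weight small. -/
theorem exists_min (T : V 3 → ZMod 2) (u : V 3) : ∃ η : ZMod 2, ∀ b : ZMod 2,
    wt (fun x => T x + (u ⬝ᵥ x + (η + b))) + dev T u = 4 + 2 * (b.val * dev T u) := by
  have h1 := wt_add_one (fun x => T x + u ⬝ᵥ x)
  have e0 : (fun x => T x + (u ⬝ᵥ x + 0)) = fun x => T x + u ⬝ᵥ x := by
    funext x; ring
  have e1 : (fun x => T x + (u ⬝ᵥ x + 1)) = fun x => T x + u ⬝ᵥ x + 1 := by
    funext x; ring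
  have hd : dev T u = ((wt fun x => T x + u ⬝ᵥ x : ℤ) - 4).natAbs := rfl
  have o1 : (1 : ZMod 2) + 1 = 0 := by decide
  have v1 : (1 : ZMod 2).val = 1 := rfl
  have v0 : (0 : ZMod 2).val = 0 := rfl
  generalize dev T u = d at *
  have ar : ∀ u v d : ℕ, v + u = 8 → d = ((u : ℤ) - 4).natAbs →
      (u + d = 4 ∧ v + d = 4 + 2 * d) ∨ (v + d = 4 ∧ u + d = 4 + 2 * d) := by omega
  rcases ar _ _ _ h1 hd with ⟨a1, a2⟩ | ⟨a1, a2⟩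
  · refine ⟨0, fun b => ?_⟩
    rcases z2_cases b with rfl | rfl
    · rw [zero_add, e0, a1, v0, zero_mul, mul_zero, add_zero]
    · rw [zero_add, e1, a2, v1, one_mul]
  · refine ⟨1, fun b => ?_⟩
    rcases z2_cases b with rfl | rfl
    · rw [add_zero, e1, a1, v0, zero_mul, mul_zero, add_zero]
    · rw [o1, e0, a2, v1, one_mul]

theorem jn_bij : Function.Bijective (fun z : V 3 × V 3 => jn z.1 z.2) := by
  rw [Fintype.bijective_iff_injective_and_card]
  constructor
  · rintro ⟨y, x⟩ ⟨y', x'⟩ h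
    refine Prod.ext (funext fun i => ?_) (funext fun i => ?_)
    · fin_cases i
      exacts [congrFun h 0, congrFun h 1, congrFun h 2]
    · fin_cases i
      exacts [congrFun h 3, congrFun h 4, congrFun h 5]
  · rw [Fintype.card_prod, card_V, card_V]
    rfl

theorem wt_jn (f : V 6 → ZMod 2) : wt f = ∑ y, wt (fun x => f (jn y x)) := by
  unfold wt
  rw [← jn_bij.sum_comp, Fintype.sum_prod_type]

theorem hd3_jn (y x : V 3) : hd3 (jn y x) = y := funext fun i => by fin_cases i <;> rfl

theorem tl_jn (y x : V 3) : tl (jn y x) = x := rfl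

theorem jn_hd3_tl (z : V 6) : jn (hd3 z) (tl z) = z := funext fun i => by fin_cases i <;> rfl

theorem hd3_aff : Aff hd3 := fun x y z => funext fun i => by fin_cases i <;> rfl

theorem ov_aff (n : ℕ) : Aff (ov n) := by
  intro x y z
  funext i
  simp only [ov, Pi.add_apply]
  linear_combination -(z2_add_self (dg n 8 i))

theorem wt_affine : ∀ u : V 3, ∀ b : ZMod 2, wt (fun x => u ⬝ᵥ x + b) =
    if u = 0 then 8 * b.val else 4 := by decide +kernel

/-- An affine function with prescribed values at four independent points. -/
theorem exists_interpolation {a : Fin 4 → V 3} (h : ∀ w : V 3, w ⬝ᵥ (a 2 + a 3) = 0 →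
    w ⬝ᵥ (a 1 + a 3) = 0 → w ⬝ᵥ (a 0 + a 3) = 0 → w = 0) (g : V 3 → ZMod 2) :
    ∃ (w : V 3) (e : ZMod 2), ∀ k, w ⬝ᵥ a k + e = g (a k) := by
  have inj : Function.Injective (fun w : V 3 =>
      (![w ⬝ᵥ (a 2 + a 3), w ⬝ᵥ (a 1 + a 3), w ⬝ᵥ (a 0 + a 3)] : V 3)) := by
    intro w w' hw
    have h2 : w ⬝ᵥ (a 2 + a 3) = w' ⬝ᵥ (a 2 + a 3) := congrFun hw 0
    have h1 : w ⬝ᵥ (a 1 + a 3) = w' ⬝ᵥ (a 1 + a 3) := congrFun hw 1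
    have h0 : w ⬝ᵥ (a 0 + a 3) = w' ⬝ᵥ (a 0 + a 3) := congrFun hw 2
    have := h (w + w') (by rw [add_dotProduct, h2, z2_add_self])
      (by rw [add_dotProduct, h1, z2_add_self]) (by rw [add_dotProduct, h0, z2_add_self])
    rwa [v_add_eq_iff, zero_add] at this
  obtain ⟨w, hw⟩ := (bij_of_inj inj).2 (![g (a 2) + g (a 3), g (a 1) + g (a 3), g (a 0) + g (a 3)])
  have h2 : w ⬝ᵥ (a 2 + a 3) = g (a 2) + g (a 3) := congrFun hw 0
  have h1 : w ⬝ᵥ (a 1 + a 3) = g (a 1) + g (a 3) := congrFun hw 1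
  have h0 : w ⬝ᵥ (a 0 + a 3) = g (a 0) + g (a 3) := congrFun hw 2
  rw [dotProduct_add] at h0 h1 h2
  have z3 := z2_add_self (g (a 3))
  have zw := z2_add_self (w ⬝ᵥ a 3)
  refine ⟨w, g (a 3) + w ⬝ᵥ a 3, fun k => ?_⟩
  fin_cases k
  · change w ⬝ᵥ a 0 + (g (a 3) + w ⬝ᵥ a 3) = g (a 0)
    linear_combination h0 + z3
  · change w ⬝ᵥ a 1 + (g (a 3) + w ⬝ᵥ a 3) = g (a 1)
    linear_combination h1 + z3
  · change w ⬝ᵥ a 2 + (g (a 3) + w ⬝ᵥ a 3) = g (a 2)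
    linear_combination h2 + z3
  · change w ⬝ᵥ a 3 + (g (a 3) + w ⬝ᵥ a 3) = g (a 3)
    linear_combination zw

theorem sum_pt_mul (c : V 3) (h : V 3 → ZMod 2) : ∑ y, pt c y * h y = h c := by
  simp [pt]

theorem op_form (c : V 3) (o : Fin 28) {h : V 3 → ZMod 2} (hh : ∑ y, h y = 0) :
    ∃ p q : V 6 → ZMod 2, Deg 2 p ∧ Deg 1 (fun x => p x + q x) ∧
      (∀ y x, p (jn y x) = ov (op c o) y ⬝ᵥ x + h y) ∧ wt (fun x => mm x + q x) ≤ 16 ∧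
      ∀ x, mm (jn c x) + q (jn c x) = (pe c + (ov (op c o) c + dg (op c o) 4)) ⬝ᵥ x +
        ∑ y, qd (op c o) y * h y := by
  obtain ⟨n, hn⟩ : ∃ n, n = op c o := ⟨_, rfl⟩
  obtain ⟨w, e, hw⟩ := exists_interpolation (a := fun k : Fin 4 => dg (op c o) k) (op_indep c o) h
  have hdh : Deg 2 h := by
    refine deg_of_inj_flats fun ψ _ i => ?_
    rw [(bij_of_inj i).sum_comp h, hh]
  have hs := op_sum c o
  have hz := op_only c o
  have hcard := op_card c o
  have hq := qd_mul c o
  rw [← hn] at *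
  have hl : Deg 1 (fun y : V 3 => w ⬝ᵥ y + e) := deg_dot_add w e
  have hov : ∀ i, Deg 1 (fun z : V 6 => ov n (hd3 z) i) := fun i =>
    ((aff_coord i).comp ((ov_aff n).comp hd3_aff)).deg_one
  have hpr : Deg 2 (fun z : V 6 => ov n (hd3 z) ⬝ᵥ tl z) := by
    have := (((hov 0).pmul (((aff_coord 0).comp tl_aff).deg_one)).add
      ((hov 1).pmul (((aff_coord 1).comp tl_aff).deg_one))).add
      ((hov 2).pmul (((aff_coord 2).comp tl_aff).deg_one))
    convert this using 2 with z
    exact Fin.sum_univ_three _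
  refine ⟨fun z => ov n (hd3 z) ⬝ᵥ tl z + h (hd3 z),
    fun z => (ov n (hd3 z) + dg n 4) ⬝ᵥ tl z + (h (hd3 z) + (w ⬝ᵥ hd3 z + e)),
    hpr.add (hdh.comp hd3_aff), ?_, ?_, ?_, ?_⟩
  · convert ((deg_dot (dg n 4)).comp tl_aff).add (hl.comp hd3_aff) using 2 with z
    beta_reduce
    rw [add_dotProduct]
    linear_combination z2_add_self (ov n (hd3 z) ⬝ᵥ tl z) + z2_add_self (h (hd3 z))
  · intro y x
    beta_reduce
    rw [hd3_jn, tl_jn]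
  · have key : ∀ y, wt (fun x => mm (jn y x) + ((ov n (hd3 (jn y x)) + dg n 4) ⬝ᵥ tl (jn y x) +
        (h (hd3 (jn y x)) + (w ⬝ᵥ hd3 (jn y x) + e)))) ≤
        if pe y ≠ ov n y + dg n 4 then 4 else 0 := by
      intro y
      have e1 : (fun x => mm (jn y x) + ((ov n (hd3 (jn y x)) + dg n 4) ⬝ᵥ tl (jn y x) +
        (h (hd3 (jn y x)) + (w ⬝ᵥ hd3 (jn y x) + e)))) = fun x =>
        (pe y + (ov n y + dg n 4)) ⬝ᵥ x + (h y + (w ⬝ᵥ y + e)) := by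
        funext x
        unfold mm
        rw [hd3_jn, tl_jn, add_dotProduct (pe y), add_assoc]
      rw [e1, wt_affine]
      by_cases hy : pe y = ov n y + dg n 4
      · obtain ⟨k, rfl⟩ := hz y hy
        have h0 : h (dg n k) + (w ⬝ᵥ dg n k + e) = 0 := by
          have := hw k
          beta_reduce at this
          rw [this, z2_add_self]
        rw [h0, hy, v_add_self, if_pos rfl, if_neg (fun h => h rfl)]
        exact le_rfl
      · rw [if_neg, if_pos hy]
        rwa [v_add_eq_iff, zero_add]
    rw [wt_jn]
    refine (Finset.sum_le_sum fun y _ => key y).trans ?_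
    rw [Finset.sum_ite, Finset.sum_const, Finset.sum_const, hcard]
    norm_num
  · intro x
    have e1 : mm (jn c x) = pe c ⬝ᵥ x := by
      unfold mm
      rw [hd3_jn, tl_jn]
    beta_reduce
    rw [e1, hd3_jn, tl_jn, add_dotProduct (pe c)]
    have e2 : ∑ y, qd n y * h y = h c + h (dg n 2) + h (dg n 1) + h (dg n 0) := by
      simp only [hq, add_mul, Finset.sum_add_distrib, sum_pt_mul]
    have g0 : w ⬝ᵥ dg n 0 + e = h (dg n 0) := hw 0
    have g1 : w ⬝ᵥ dg n 1 + e = h (dg n 1) := hw 1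
    have g2 : w ⬝ᵥ dg n 2 + e = h (dg n 2) := hw 2
    have g : w ⬝ᵥ c = w ⬝ᵥ dg n 2 + w ⬝ᵥ dg n 1 + w ⬝ᵥ dg n 0 := by
      rw [← hs, dotProduct_add, dotProduct_add]
    rw [e2]
    linear_combination g + g0 + g1 + g2 - z2_add_self e

theorem sum_pt_val (c : V 3) (K : V 3 → ℕ) : ∑ y, (pt c y).val * K y = K c := by
  rw [Finset.sum_eq_single c]
  · unfold pt
    rw [if_pos rfl]
    exact one_mul _
  · intro y _ hy
    unfold pt
    rw [if_neg hy]
    exact zero_mul _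
  · intro h
    exact absurd (Finset.mem_univ _) h

theorem sum_pt (c : V 3) : ∑ y, pt c y = 1 := by
  have := sum_pt_mul c fun _ => 1
  simpa only [mul_one] using this

theorem wt_mod_two_dev (T : V 3 → ZMod 2) (u : V 3) : dev T u % 2 = wt T % 2 := by
  have h1 := (deg_dot u).wt_even (by norm_num)
  have h2 := wt_add T (fun x => u ⬝ᵥ x)
  have hd : dev T u = ((wt fun x => T x + u ⬝ᵥ x : ℤ) - 4).natAbs := rfl
  have ar : ∀ a b c d e : ℕ, a + 2 * b = c + d → d % 2 = 0 → e = ((a : ℤ) - 4).natAbs →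
      e % 2 = c % 2 := by omega
  exact ar _ _ _ _ _ h2 (Nat.even_iff.1 h1) hd

/-- The total deviation of the slices of `s` from an affine map. -/
def tot (s : V 6 → ZMod 2) (n : ℕ) : ℕ := ∑ y, dev (fun x => s (jn y x)) (ov n y)

theorem tot_mod (s : V 6 → ZMod 2) (n : ℕ) : tot s n % 2 = wt s % 2 := by
  unfold tot
  rw [wt_jn, Finset.sum_nat_mod]
  simp only [wt_mod_two_dev]
  rw [← Finset.sum_nat_mod]

theorem tot_sum (s : V 6 → ZMod 2) (c : V 3) : 224 + 24 * #{y | wt (fun x => s (jn y x)) ≠ 0} ≤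
    ∑ o, tot s (op c o) + 10 * wt s := by
  unfold tot
  rw [Finset.sum_comm, wt_jn, Finset.mul_sum, ← Finset.sum_add_distrib]
  have h : ∀ y, 28 + 24 * (if wt (fun x => s (jn y x)) ≠ 0 then 1 else 0) ≤
      ∑ o, dev (fun x => s (jn y x)) (ov (op c o) y) + 10 * wt (fun x => s (jn y x)) := by
    intro y
    rw [dev_op]
    have := dev_sum_ge fun x => s (jn y x)
    by_cases h0 : wt (fun x => s (jn y x)) = 0
    · rw [if_neg (not_not.2 h0)]
      exact (this.1 h0).trans (Nat.le_add_right _ _)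
    · rw [if_pos h0]
      exact this.2 h0
  refine le_trans ?_ (Finset.sum_le_sum fun y _ => h y)
  rw [Finset.sum_add_distrib, ← Finset.mul_sum, Finset.card_filter, Finset.sum_const,
    Finset.card_univ, card_V]
  exact le_rfl

/-- A pair of empty slices, if the total deviation is always small. -/
theorem exists_empty {s : V 6 → ZMod 2} {c : V 3} {k : ℕ} (h : ∀ o, tot s (op c o) ≤ k)
    (hk : 28 * k + 10 * wt s < 392) : ∃ z z', z ≠ z' ∧ wt (fun x => s (jn z x)) = 0 ∧
      wt (fun x => s (jn z' x)) = 0 := by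
  have h1 := tot_sum s c
  have h2 : ∑ o, tot s (op c o) ≤ 28 * k := by
    refine (Finset.sum_le_sum fun o _ => h o).trans ?_
    rw [Finset.sum_const, Finset.card_univ]
    exact le_rfl
  have h3 := Finset.card_filter_add_card_filter_not (s := (univ : Finset (V 3)))
    (fun y => wt (fun x => s (jn y x)) = 0)
  rw [Finset.card_univ, card_V] at h3
  have h4 : 1 < #{y | wt (fun x => s (jn y x)) = 0} := by
    have ar : ∀ a b w S k : ℕ, 224 + 24 * b ≤ S + 10 * w → S ≤ 28 * k → a + b = 2 ^ 3 →
      28 * k + 10 * w < 392 → 1 < a := by omega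
    exact ar _ _ _ _ _ h1 h2 h3 hk
  obtain ⟨z, hz, z', hz', hne⟩ := Finset.one_lt_card.1 h4
  exact ⟨z, z', hne, (Finset.mem_filter.1 hz).2, (Finset.mem_filter.1 hz').2⟩

theorem exists_eta (s : V 6 → ZMod 2) (n : ℕ) : ∃ η : V 3 → ZMod 2, ∀ f : V 3 → ZMod 2,
    ∑ y, wt (fun x => s (jn y x) + (ov n y ⬝ᵥ x + (η y + f y))) + tot s n =
      32 + 2 * ∑ y, (f y).val * dev (fun x => s (jn y x)) (ov n y) := by
  choose η hη using fun y => exists_min (fun x => s (jn y x)) (ov n y)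
  refine ⟨η, fun f => ?_⟩
  unfold tot
  rw [← Finset.sum_add_distrib, Finset.sum_congr rfl fun y _ => hη y (f y), Finset.sum_add_distrib,
    Finset.mul_sum, Finset.sum_const, Finset.card_univ, card_V]
  rfl

theorem Far2.tot_form {s g : V 6 → ZMod 2} (h : Far2 41 s g) (c : V 3) (o : Fin 28) :
    ∃ η : V 3 → ZMod 2, ∀ f : V 3 → ZMod 2, ∑ y, f y = ∑ y, η y → ∃ q : V 6 → ZMod 2,
      wt (fun x => mm x + q x) ≤ 16 ∧
      (∀ x, mm (jn c x) + q (jn c x) = (pe c + (ov (op c o) c + dg (op c o) 4)) ⬝ᵥ x +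
        ∑ y, qd (op c o) y * (η y + f y)) ∧
      tot s (op c o) + 41 ≤ 32 + 2 * ∑ y, (f y).val * dev (fun x => s (jn y x)) (ov (op c o) y) +
        wt (fun x => g x + q x) := by
  obtain ⟨η, hη⟩ := exists_eta s (op c o)
  refine ⟨η, fun f hf => ?_⟩
  obtain ⟨p, q, d1, d2, e1, e2, e3⟩ := op_form c o (h := fun y => η y + f y) (by
    rw [Finset.sum_add_distrib, hf, z2_add_self])
  refine ⟨q, e2, e3, ?_⟩
  have h1 := h p q d1 d2
  have h2 := hη f
  rw [wt_jn fun x => s x + p x] at h1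
  simp only [e1] at h1
  have ar : ∀ a b t u : ℕ, 41 ≤ a + b → a + t = u → t + 41 ≤ u + b := by omega
  exact ar _ _ _ _ h1 h2

theorem Far2.tot_mm {s : V 6 → ZMod 2} (h : Far2 41 s mm) (c : V 3) (o : Fin 28) :
    ∃ α : ZMod 2, ∀ f : V 3 → ZMod 2, ∑ y, f y = α →
      tot s (op c o) ≤ 7 + 2 * ∑ y, (f y).val * dev (fun x => s (jn y x)) (ov (op c o) y) := by
  obtain ⟨η, hη⟩ := h.tot_form c o
  refine ⟨∑ y, η y, fun f hf => ?_⟩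
  obtain ⟨q, h1, -, h2⟩ := hη f hf
  have ar : ∀ t u w : ℕ, t + 41 ≤ 32 + 2 * u + w → w ≤ 16 → t ≤ 7 + 2 * u := by omega
  exact ar _ _ _ h2 h1

theorem Far2.tot_mm_pt {s : V 6 → ZMod 2} {d : V 6} (h : Far2 41 s fun x => mm x + pt d x)
    (o : Fin 28) : ∃ α β : ZMod 2, ∀ f : V 3 → ZMod 2, ∑ y, f y = α →
      (tot s (op (hd3 d) o) ≤ 8 + 2 * ∑ y, (f y).val *
        dev (fun x => s (jn y x)) (ov (op (hd3 d) o) y)) ∧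
      (∑ y, qd (op (hd3 d) o) y * f y = β → tot s (op (hd3 d) o) ≤ 6 + 2 * ∑ y, (f y).val *
        dev (fun x => s (jn y x)) (ov (op (hd3 d) o) y)) := by
  obtain ⟨η, hη⟩ := h.tot_form (hd3 d) o
  refine ⟨∑ y, η y, (pe (hd3 d) + (ov (op (hd3 d) o) (hd3 d) + dg (op (hd3 d) o) 4)) ⬝ᵥ (tl d) +
    ∑ y, qd (op (hd3 d) o) y * η y + 1, fun f hf => ?_⟩
  obtain ⟨q, h1, h3, h2⟩ := hη f hf
  have h4 := wt_add_pt (fun x => mm x + q x) d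
  have e : (fun x => mm x + pt d x + q x) = fun x => mm x + q x + pt d x := by
    funext x; ring
  rw [e] at h2
  generalize wt (fun x => mm x + q x + pt d x) = w1 at *
  generalize wt (fun x => mm x + q x) = w0 at *
  have h5 := h3 (tl d)
  rw [jn_hd3_tl] at h5
  simp only [mul_add, Finset.sum_add_distrib] at h5
  constructor
  · have ar : ∀ t u w w' v : ℕ, t + 41 ≤ 32 + 2 * u + w' → w' + 2 * v = w + 1 → w ≤ 16 →
      t ≤ 8 + 2 * u := by omega
    exact ar _ _ _ _ _ h2 h4 h1
  · intro hβ
    have h6 : mm d + q d = 1 := by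
      rw [h5, hβ]
      have := z2_add_self ((pe (hd3 d) + (ov (op (hd3 d) o) (hd3 d) + dg (op (hd3 d) o) 4)) ⬝ᵥ tl d +
        ∑ y, qd (op (hd3 d) o) y * η y)
      linear_combination this
    rw [h6] at h4
    have h7 : (1 : ZMod 2).val = 1 := rfl
    rw [h7] at h4
    have ar : ∀ t u w w' : ℕ, t + 41 ≤ 32 + 2 * u + w' → w' + 2 * 1 = w + 1 → w ≤ 16 →
      t ≤ 6 + 2 * u := by omega
    exact ar _ _ _ _ h2 h4 h1

theorem sum_val_zero (K : V 3 → ℕ) : ∑ y, ((0 : V 3 → ZMod 2) y).val * K y = 0 := by simp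

theorem Far2.tot_mm_le {s : V 6 → ZMod 2} (h : Far2 41 s mm) (c : V 3) (o : Fin 28) :
    tot s (op c o) ≤ 9 := by
  obtain ⟨α, hα⟩ := h.tot_mm c o
  rcases z2_cases α with rfl | rfl
  · have := hα 0 (by simp)
    rw [sum_val_zero] at this
    exact this.trans (by norm_num)
  · have h1 : ∀ y, tot s (op c o) ≤ 7 + 2 * dev (fun x => s (jn y x)) (ov (op c o) y) := by
      intro y
      have := hα (pt y) (sum_pt y)
      rwa [sum_pt_val] at this
    have h2 := Finset.sum_le_sum fun y (_ : y ∈ (univ : Finset (V 3))) => h1 y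
    rw [Finset.sum_add_distrib, ← Finset.mul_sum, Finset.sum_const, Finset.sum_const,
      Finset.card_univ, card_V, smul_eq_mul, smul_eq_mul] at h2
    have ar : ∀ t u : ℕ, 2 ^ 3 * t ≤ 2 ^ 3 * 7 + 2 * u → u = t → t ≤ 9 := by omega
    exact ar _ _ h2 rfl

theorem Far2.tot_mm_empty {s : V 6 → ZMod 2} (h : Far2 41 s mm) (c : V 3) {z z' : V 3}
    (hz : z ≠ z') (h0 : wt (fun x => s (jn z x)) = 0) (h0' : wt (fun x => s (jn z' x)) = 0) :
    False := by
  obtain ⟨o, ho, ho'⟩ := op_pair c z z'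
  obtain ⟨α, hα⟩ := h.tot_mm c o
  have k := dev_zero h0
  have k' := dev_zero h0'
  rw [← ho] at k
  rw [← ho'] at k'
  have hm : z' ∈ (univ : Finset (V 3)).erase z := Finset.mem_erase.2 ⟨hz.symm, Finset.mem_univ _⟩
  have ht : tot s (op c o) = 4 + (4 + ∑ y ∈ ((univ : Finset (V 3)).erase z).erase z',
      dev (fun x => s (jn y x)) (ov (op c o) y)) := by
    unfold tot
    rw [← Finset.add_sum_erase _ _ (Finset.mem_univ z), ← Finset.add_sum_erase _ _ hm, k, k']
  rcases z2_cases α with rfl | rfl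
  · have := hα 0 (by simp)
    rw [sum_val_zero] at this
    omega
  · have h1 : ∀ y, tot s (op c o) ≤ 7 + 2 * dev (fun x => s (jn y x)) (ov (op c o) y) := by
      intro y
      have := hα (pt y) (sum_pt y)
      rwa [sum_pt_val] at this
    have h2 := Finset.sum_le_sum fun y (_ : y ∈ ((univ : Finset (V 3)).erase z).erase z') => h1 y
    have hc : (((univ : Finset (V 3)).erase z).erase z').card = 6 := by
      rw [Finset.card_erase_of_mem hm, Finset.card_erase_of_mem (Finset.mem_univ _),
        Finset.card_univ, card_V]
      norm_num
    rw [Finset.sum_add_distrib, ← Finset.mul_sum, Finset.sum_const, Finset.sum_const, hc,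
      smul_eq_mul, smul_eq_mul] at h2
    have ar : ∀ t u : ℕ, 6 * t ≤ 6 * 7 + 2 * u → t = 4 + (4 + u) → False := by omega
    exact ar _ _ h2 ht

theorem Far2.not_mm {s : V 6 → ZMod 2} (h : Far2 41 s mm) (hs : wt s = 13 ∨ wt s = 14) : False := by
  have h1 : ∃ k, (∀ o, tot s (op 0 o) ≤ k) ∧ 28 * k + 10 * wt s < 392 := by
    rcases hs with hs | hs
    · refine ⟨9, h.tot_mm_le 0, ?_⟩
      rw [hs]
      norm_num
    · refine ⟨8, fun o => ?_, ?_⟩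
      · have h2 := tot_mod s (op 0 o)
        have h3 := h.tot_mm_le 0 o
        rw [hs] at h2
        omega
      · rw [hs]
        norm_num
  obtain ⟨k, h2, h3⟩ := h1
  obtain ⟨z, z', hz, h0, h0'⟩ := exists_empty h2 h3
  exact h.tot_mm_empty 0 hz h0 h0'

theorem sum_mul_pt (g : V 3 → ZMod 2) (c : V 3) : ∑ y, g y * pt c y = g c := by
  simp only [mul_comm (g _)]
  exact sum_pt_mul c g

theorem average_le {q : V 3 → ZMod 2} {b : ZMod 2} {t : ℕ} {K : V 3 → ℕ}
    (hc : #{y | q y = b} = 4) (h : ∀ y, t + (if q y = b then 2 else 0) ≤ 8 + 2 * K y) :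
    8 * t + 8 ≤ 64 + 2 * ∑ y, K y := by
  have h2 : ∑ y, (t + if q y = b then 2 else 0) ≤ ∑ y, (8 + 2 * K y) :=
    Finset.sum_le_sum fun y _ => h y
  rw [Finset.sum_add_distrib, Finset.sum_add_distrib, ← Finset.mul_sum, Finset.sum_const,
    Finset.sum_const, Finset.card_univ, card_V, smul_eq_mul, smul_eq_mul, ← Finset.sum_filter,
    Finset.sum_const, hc, smul_eq_mul] at h2
  exact h2

theorem Far2.tot_mm_pt_le {s : V 6 → ZMod 2} {d : V 6} (h : Far2 41 s fun x => mm x + pt d x)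
    (hs : wt s = 14) (o : Fin 28) : tot s (op (hd3 d) o) ≤ 8 := by
  obtain ⟨α, β, hα⟩ := h.tot_mm_pt o
  rcases z2_cases α with rfl | rfl
  · have := (hα 0 (by simp)).1
    rwa [sum_val_zero] at this
  · have hc := qd_card (hd3 d) o β
    have hm := tot_mod s (op (hd3 d) o)
    generalize op (hd3 d) o = n at *
    have h1 : ∀ y, tot s n + (if qd n y = β then 2 else 0) ≤
        8 + 2 * dev (fun x => s (jn y x)) (ov n y) := by
      intro y
      have h2 := hα (pt y) (sum_pt y)
      rw [sum_pt_val, sum_mul_pt] at h2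
      split_ifs with hy
      · have := h2.2 hy
        have ar : ∀ t u : ℕ, t ≤ 6 + 2 * u → t + 2 ≤ 8 + 2 * u := by omega
        exact ar _ _ this
      · rw [add_zero]
        exact h2.1
    have h2 := average_le hc h1
    have ar : ∀ t u w : ℕ, 8 * t + 8 ≤ 64 + 2 * u → u = t → t % 2 = w % 2 → w = 14 → t ≤ 8 := by
      omega
    exact ar _ _ _ h2 rfl hm hs

theorem exists_ne_qd (c : V 3) (o : Fin 28) (b : ZMod 2) (z z' : V 3) :
    ∃ y, qd (op c o) y = b ∧ y ≠ z ∧ y ≠ z' := by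
  have h : ∃ y ∈ ({y | qd (op c o) y = b} : Finset (V 3)), y ∉ ({z, z'} : Finset (V 3)) := by
    apply Finset.exists_mem_notMem_of_card_lt_card
    rw [qd_card]
    exact lt_of_le_of_lt Finset.card_le_two (by norm_num)
  obtain ⟨y, h1, h2⟩ := h
  simp only [Finset.mem_insert, Finset.mem_singleton, not_or] at h2
  exact ⟨y, (Finset.mem_filter.1 h1).2, h2.1, h2.2⟩

theorem Far2.not_mm_pt {s : V 6 → ZMod 2} {d : V 6} (h : Far2 41 s fun x => mm x + pt d x)
    (hs : wt s = 14) : False := by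
  obtain ⟨z, z', hz, h0, h0'⟩ := exists_empty (h.tot_mm_pt_le hs) (by rw [hs]; norm_num)
  obtain ⟨o, ho, ho'⟩ := op_pair (hd3 d) z z'
  have k := dev_zero h0
  have k' := dev_zero h0'
  rw [← ho] at k
  rw [← ho'] at k'
  have hm : z' ∈ (univ : Finset (V 3)).erase z := Finset.mem_erase.2 ⟨hz.symm, Finset.mem_univ _⟩
  have ht : tot s (op (hd3 d) o) = 4 + (4 + ∑ y ∈ ((univ : Finset (V 3)).erase z).erase z',
      dev (fun x => s (jn y x)) (ov (op (hd3 d) o) y)) := by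
    unfold tot
    rw [← Finset.add_sum_erase _ _ (Finset.mem_univ z), ← Finset.add_sum_erase _ _ hm, k, k']
  have hle := h.tot_mm_pt_le hs o
  have hzero : ∀ y, y ≠ z → y ≠ z' → dev (fun x => s (jn y x)) (ov (op (hd3 d) o) y) = 0 := by
    have ar : ∀ t u : ℕ, t = 4 + (4 + u) → t ≤ 8 → u = 0 := by omega
    intro y h1 h2
    exact Finset.sum_eq_zero_iff.1 (ar _ _ ht hle) y
      (Finset.mem_erase.2 ⟨h2, Finset.mem_erase.2 ⟨h1, Finset.mem_univ _⟩⟩)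
  obtain ⟨α, β, hα⟩ := h.tot_mm_pt o
  obtain ⟨y1, q1, a1, b1⟩ := exists_ne_qd (hd3 d) o 1 z z'
  obtain ⟨y2, q2, a2, b2⟩ := exists_ne_qd (hd3 d) o 0 z z'
  have h1 := (hα (fun y => β * pt y1 y + (α + β) * pt y2 y) (by
    rw [Finset.sum_add_distrib, ← Finset.mul_sum, ← Finset.mul_sum, sum_pt, sum_pt]
    have := z2_add_self β
    linear_combination this)).2 (by
    have e : ∀ y, qd (op (hd3 d) o) y * (β * pt y1 y + (α + β) * pt y2 y) =
        β * (qd (op (hd3 d) o) y * pt y1 y) + (α + β) * (qd (op (hd3 d) o) y * pt y2 y) := by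
      intro y; ring
    simp only [e]
    rw [Finset.sum_add_distrib, ← Finset.mul_sum, ← Finset.mul_sum, sum_mul_pt, sum_mul_pt, q1, q2,
      mul_one, mul_zero, add_zero])
  rw [Finset.sum_eq_zero, ht] at h1
  · have ar : ∀ u : ℕ, ¬ 4 + (4 + u) ≤ 6 + 2 * 0 := by omega
    exact ar _ h1
  · intro y _
    by_cases hy : y = z ∨ y = z'
    · have : β * pt y1 y + (α + β) * pt y2 y = 0 := by
        unfold pt
        rw [if_neg, if_neg, mul_zero, mul_zero, add_zero]
        · rintro rfl
          rcases hy with hy | hy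
          · exact a2 hy
          · exact b2 hy
        · rintro rfl
          rcases hy with hy | hy
          · exact a1 hy
          · exact b1 hy
      rw [this, ZMod.val_zero, zero_mul]
    · rw [not_or] at hy
      rw [hzero y hy.1 hy.2, mul_zero]

theorem Far2.canonical {s f b : V 6 → ZMod 2} {g : V 6 → ZMod 2} (h : Far2 41 s f)
    (hf : ∀ x, f x = b x + g x) (hb : Bent b) (hb' : Far 13 b) :
    ∃ φ : V 6 → V 6, Function.Bijective φ ∧
      Far2 41 (fun x => s (φ x)) (fun x => mm x + g (φ x)) := by
  obtain ⟨φ, m, h1, h2, h3, h4⟩ := hb.canonical hb'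
  refine ⟨φ, h2, ?_⟩
  have h5 := (h.comp h1 h2).add_right h3
  convert h5 using 2 with x
  rw [← h4 x, hf]
  ring

theorem Far2.far_fifteen {f g : V 6 → ZMod 2} (h : Far2 41 f g) : Far 15 f := by
  intro p hp
  by_contra hlt
  have hs : wt (fun x => f x + p x) ≤ 14 := by
    have ar : ∀ t : ℕ, ¬ 15 ≤ t → t ≤ 14 := by omega
    exact ar _ hlt
  have h' := h.add hp
  generalize (fun x => f x + p x) = s at *
  generalize (fun x => g x + p x) = r at *
  obtain ⟨h1, ⟨hb, hb'⟩ | ⟨h2, c, hb, hb'⟩⟩ := h'.bent hs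
  · obtain ⟨φ, hφ, h3⟩ := h'.canonical (g := fun _ => 0) (fun x => (add_zero _).symm) hb hb'
    simp only [add_zero] at h3
    refine h3.not_mm ?_
    rwa [wt_comp s hφ]
  · obtain ⟨φ, hφ, h3⟩ := h'.canonical (g := pt c) (fun x => (z2_add_add _ _).symm) hb hb'
    obtain ⟨d, rfl⟩ := hφ.2 c
    have e : ∀ x, pt (φ d) (φ x) = pt d x := by
      intro x
      unfold pt
      simp only [hφ.1.eq_iff]
    simp only [e] at h3
    refine h3.not_mm_pt ?_
    rwa [wt_comp s hφ]

theorem deg_pow_prod {n : ℕ} (d : Fin n →₀ ℕ) (s : Finset (Fin n)) :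
    Deg (∑ i ∈ s, d i) (fun x : V n => ∏ i ∈ s, x i ^ d i) := by
  have hp : ∀ (i : Fin n) (k : ℕ), Deg k (fun x : V n => x i ^ k) := by
    intro i k
    induction k with
    | zero => simpa only [pow_zero] using Deg.const 0 1
    | succ k ih => simpa only [pow_succ] using ih.pmul (deg_coord i)
  induction s using Finset.induction_on with
  | empty => simpa only [Finset.sum_empty, Finset.prod_empty] using Deg.const 0 1
  | insert i s hi ih =>
    simp only [Finset.sum_insert hi, Finset.prod_insert hi]
    exact (hp i (d i)).pmul ih

theorem Deg.sum {n k : ℕ} {ι : Type*} (s : Finset ι) {f : ι → V n → ZMod 2}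
    (h : ∀ i ∈ s, Deg k (f i)) : Deg k (fun x => ∑ i ∈ s, f i x) := by
  classical
  induction s using Finset.induction_on with
  | empty => simpa only [Finset.sum_empty] using Deg.const k 0
  | insert i s hi ih =>
    simp only [Finset.sum_insert hi]
    exact (h i (Finset.mem_insert_self _ _)).add
      (ih fun j hj => h j (Finset.mem_insert_of_mem hj))

theorem deg_of_mem_RM {r n : ℕ} {f : BF n} (h : f ∈ RM r n) : Deg r f := by
  obtain ⟨p, hp, h⟩ := h
  have e : f = fun x => ∑ d ∈ p.support, p.coeff d * ∏ i ∈ d.support, x i ^ d i := by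
    funext x
    rw [h, MvPolynomial.eval_eq]
  rw [e]
  refine Deg.sum _ fun d hd => ?_
  have h1 := (Deg.const 0 (p.coeff d)).pmul (deg_pow_prod d d.support)
  rw [zero_add] at h1
  exact h1.mono ((MvPolynomial.le_totalDegree hd).trans hp)

theorem mem_RM_of_deg {n : ℕ} {f : BF n} (h : Deg 2 f) : f ∈ RM 2 n := by
  obtain ⟨c, hc⟩ := exists_quad h
  obtain ⟨a, e, ha⟩ := deg_one_form hc
  open MvPolynomial in
  refine ⟨∑ i, ∑ j, (if i < j then C (c i j) * (X i * X j) else 0) + (∑ i, C (a i) * X i + C e),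
    ?_, fun x => ?_⟩
  · refine (MvPolynomial.totalDegree_add _ _).trans (max_le ?_
      ((MvPolynomial.totalDegree_add _ _).trans (max_le ?_ ?_)))
    · refine MvPolynomial.totalDegree_finsetSum_le fun i _ =>
        MvPolynomial.totalDegree_finsetSum_le fun j _ => ?_
      split_ifs
      · refine (MvPolynomial.totalDegree_mul _ _).trans ?_
        have := MvPolynomial.totalDegree_mul (MvPolynomial.X i : MvPolynomial (Fin n) (ZMod 2))
          (MvPolynomial.X j)
        rw [MvPolynomial.totalDegree_X, MvPolynomial.totalDegree_X] at this
        rw [MvPolynomial.totalDegree_C]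
        omega
      · rw [MvPolynomial.totalDegree_zero]
        omega
    · refine MvPolynomial.totalDegree_finsetSum_le fun i _ => ?_
      refine (MvPolynomial.totalDegree_mul _ _).trans ?_
      rw [MvPolynomial.totalDegree_C, MvPolynomial.totalDegree_X]
      omega
    · rw [MvPolynomial.totalDegree_C]
      omega
  · have h1 : MvPolynomial.eval x (∑ i, ∑ j, (if i < j then MvPolynomial.C (c i j) *
        (MvPolynomial.X i * MvPolynomial.X j) else 0) +
        (∑ i, MvPolynomial.C (a i) * MvPolynomial.X i + MvPolynomial.C e)) =
        quad c x + (a ⬝ᵥ x + e) := by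
      simp only [map_add, map_sum, apply_ite (MvPolynomial.eval x), map_mul, map_zero,
        MvPolynomial.eval_C, MvPolynomial.eval_X]
      rfl
    rw [h1, ← ha x]
    have := z2_add_self (quad c x)
    linear_combination -this

theorem hd_eq_wt {n : ℕ} (f g : BF n) : hd f g = wt (fun x => f x + g x) := by
  unfold hd wt
  rw [Finset.card_filter]
  refine Finset.sum_congr rfl fun x _ => ?_
  have ar : ∀ a b : ZMod 2, (if a ≠ b then 1 else 0) = (a + b).val := by decide
  exact ar _ _

theorem le_nl_iff {n k : ℕ} (f : BF n) : k ≤ nl 2 f ↔ Far k f := by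
  constructor
  · intro h p hp
    exact h.trans (Nat.sInf_le ⟨p, mem_RM_of_deg hp, (hd_eq_wt f p).symm⟩)
  · intro h
    refine le_csInf ⟨_, _, mem_RM_of_deg (Deg.const 2 0), rfl⟩ ?_
    rintro _ ⟨g, hg, rfl⟩
    rw [hd_eq_wt]
    exact h g (deg_of_mem_RM hg)

theorem wt_concat {n : ℕ} (f g : BF n) : wt (concat f g) = wt f + wt g := by
  unfold wt
  rw [← (Fin.snocEquiv (fun _ : Fin (n + 1) => ZMod 2)).sum_comp, Fintype.sum_prod_type]
  have h : (Finset.univ : Finset (ZMod 2)) = {0, 1} := by decide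
  have h0 : ∀ (b : ZMod 2) (x : V n), concat f g (Fin.snoc (α := fun _ => ZMod 2) x b) =
      (1 + b) * f x + b * g x := by
    intro b x
    have e : (Fin.snoc (α := fun _ => ZMod 2) x b : V (n + 1)) ∘ Fin.castSucc = x := by
      funext i
      exact Fin.snoc_castSucc (α := fun _ => ZMod 2) b x i
    unfold concat
    rw [e, Fin.snoc_last]
  have o1 : (1 : ZMod 2) + 1 = 0 := by decide
  rw [h, Finset.sum_pair (by decide)]
  congr 1
  · refine Finset.sum_congr rfl fun x _ => congrArg ZMod.val ?_
    refine (h0 0 x).trans ?_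
    rw [add_zero, one_mul, zero_mul, add_zero]
  · refine Finset.sum_congr rfl fun x _ => congrArg ZMod.val ?_
    refine (h0 1 x).trans ?_
    rw [o1, one_mul, zero_mul, zero_add]

theorem deg_concat {n : ℕ} {p q : BF n} (hp : Deg 2 p) (hpq : Deg 1 (fun x => p x + q x)) :
    Deg 2 (concat p q) := by
  have a : Aff (fun x : V (n + 1) => (x ∘ Fin.castSucc : V n)) := fun _ _ _ => rfl
  have := (hp.comp a).add ((deg_coord (Fin.last n)).pmul (hpq.comp a))
  convert this using 2 with x
  unfold concat
  ring

theorem far2_of_nl {f1 f2 : BF 6} (h : 40 < nl 2 (concat f1 f2)) : Far2 41 f1 f2 := by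
  intro p q hp hpq
  have h1 := (le_nl_iff _).1 h (concat p q) (deg_concat hp hpq)
  have e : (fun x => concat f1 f2 x + concat p q x) =
      concat (fun x => f1 x + p x) (fun x => f2 x + q x) := by
    funext x
    unfold concat
    ring
  rwa [e, wt_concat] at h1

theorem Far2.nl_bounds {f g : BF 6} (h : Far2 41 f g) : 15 ≤ nl 2 f ∧ nl 2 f ≤ 16 := by
  refine ⟨(le_nl_iff f).2 h.far_fifteen, ?_⟩
  have := mt (le_nl_iff f).1 h.not_far
  omega

end QuadraticDistance

/-- If `nl_2(f1||f2) > 40` then `15 ≤ nl_2(f_i) ≤ 16` for `i = 1, 2`. -/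
theorem stmt4 (f1 f2 : BF 6) (h : 40 < nl 2 (concat f1 f2)) :
    (15 ≤ nl 2 f1 ∧ nl 2 f1 ≤ 16) ∧ (15 ≤ nl 2 f2 ∧ nl 2 f2 ≤ 16) :=
  ⟨(QuadraticDistance.far2_of_nl h).nl_bounds, (QuadraticDistance.far2_of_nl h).symm.nl_bounds⟩
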